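/- Let Q_{12}, Q_{21} ∈ W^n_1[0,1] for some n ∈ ℕ. Assume J_{32} = 0, J_{14} ≠ 0, P^{(n−1)}(0) ≠ 0, and Q_{12}^{(j)}(0) = Q_{21}^{(j)}(1) = 0 for all 0 ≤ j < m, where m = ⌈(n−1)/2⌉. Then the system of root functions of the boundary value problem is complete in L²([0,1];ℂ²). -/

import Mathlib

open MeasureTheory Set Filter

noncomputable section

/-- The unit interval `[0,1]` as a subset of `ℝ`. -/
def I01 : Set ℝ := Set.Icc 0 1

/-- Lebesgue measure restricted to `[0,1]`. -/
def mu01 : MeasureTheory.Measure ℝ := MeasureTheory.volume.restrict I01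

/-- `f ∈ W^n_1[0,1]`: the derivatives of `f` up to order `n-1` exist and are continuous on
`[0,1]`, and the `(n-1)`-st derivative is absolutely continuous, i.e. an indefinite integral
of an integrable function (its a.e.-derivative `f⁽ⁿ⁾ ∈ L¹[0,1]`). -/
def MemW1 (n : ℕ) (f : ℝ → ℂ) : Prop :=
  ContDiffOn ℝ (n - 1 : ℕ) f I01 ∧
  ∃ g : ℝ → ℂ, MeasureTheory.IntegrableOn g I01 ∧
    ∀ x ∈ I01, iteratedDerivWithin (n - 1) f I01 x
      = iteratedDerivWithin (n - 1) f I01 0 + ∫ t in (0:ℝ)..x, g t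

/-- `Jdet a j k` is the minor `J_{(j+1)(k+1)} = a_{1,j} a_{2,k} - a_{1,k} a_{2,j}` of the
boundary coefficient matrix (`0`-based indices). -/
def Jdet (a : Fin 2 → Fin 4 → ℂ) (j k : Fin 4) : ℂ := a 0 j * a 1 k - a 0 k * a 1 j

/-- `y` satisfies the two-point boundary conditions `U_j(y) = 0`, `j = 1, 2`. -/
def SatisfiesBC (a : Fin 2 → Fin 4 → ℂ) (y : ℝ → ℂ × ℂ) : Prop :=
  ∀ j : Fin 2, a j 0 * (y 0).1 + a j 1 * (y 0).2 + a j 2 * (y 1).1 + a j 3 * (y 1).2 = 0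

/-- `y` is absolutely continuous on `[0,1]` (an indefinite integral of an integrable `g`,
which is then its a.e. derivative) and satisfies `-i B⁻¹ y' + Q y = rhs` a.e. on `[0,1]`. -/
def SolvesDirac (b₁ b₂ : ℝ) (Q12 Q21 : ℝ → ℂ) (y rhs : ℝ → ℂ × ℂ) : Prop :=
  ∃ g : ℝ → ℂ × ℂ, MeasureTheory.IntegrableOn g I01 ∧
    (∀ x ∈ I01, y x = y 0 + ∫ t in (0:ℝ)..x, g t) ∧
    (∀ᵐ x ∂mu01,
      (-Complex.I) * (b₁ : ℂ)⁻¹ * (g x).1 + Q12 x * (y x).2 = (rhs x).1 ∧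
      (-Complex.I) * (b₂ : ℂ)⁻¹ * (g x).2 + Q21 x * (y x).1 = (rhs x).2)

/-- `y` is a root function of the boundary value problem: a member of a chain
`ch 0, …, ch m` of absolutely continuous functions satisfying the boundary conditions,
with `ch 0 ≠ 0`, `L (ch 0) = λ • ch 0` a.e. and `L (ch j) = λ • ch j + ch (j-1)` a.e. -/
def IsRootFunction (b₁ b₂ : ℝ) (Q12 Q21 : ℝ → ℂ) (a : Fin 2 → Fin 4 → ℂ)
    (y : ℝ → ℂ × ℂ) : Prop :=
  ∃ (lam : ℂ) (m : ℕ) (ch : ℕ → ℝ → ℂ × ℂ),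
    (∀ j ≤ m, SatisfiesBC a (ch j)) ∧
    (∃ x ∈ I01, ch 0 x ≠ 0) ∧
    SolvesDirac b₁ b₂ Q12 Q21 (ch 0) (fun x => lam • ch 0 x) ∧
    (∀ j, 1 ≤ j → j ≤ m →
      SolvesDirac b₁ b₂ Q12 Q21 (ch j) (fun x => lam • ch j x + ch (j - 1) x)) ∧
    ∃ j ≤ m, y = ch j

/-- Completeness of the system of root functions in `L²([0,1]; ℂ²)`: the closed linear
span of (the `L²`-classes of) all root functions is the whole space. -/
def RootSystemComplete (b₁ b₂ : ℝ) (Q12 Q21 : ℝ → ℂ) (a : Fin 2 → Fin 4 → ℂ) : Prop :=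
  (Submodule.span ℂ {g : MeasureTheory.Lp (ℂ × ℂ) 2 mu01 |
    ∃ y : ℝ → ℂ × ℂ, IsRootFunction b₁ b₂ Q12 Q21 a y ∧
      (g : ℝ → ℂ × ℂ) =ᵐ[mu01] y}).topologicalClosure = ⊤

open Topology

theorem differentiable_dslope {f : ℂ → ℂ} (hf : Differentiable ℂ f) (c : ℂ) :
    Differentiable ℂ (dslope f c) := by
  rw [← differentiableOn_univ] at hf ⊢
  exact (Complex.differentiableOn_dslope univ_mem).2 hf

/-- A Harnack-type lower bound for a zero-free holomorphic function on a disc. -/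
theorem norm_lower_bound_of_zeroFree {g : ℂ → ℂ} (hg : Differentiable ℂ g) {r M : ℝ} (hr : 0 < r)
    (h0 : ∀ z ∈ Metric.ball (0 : ℂ) r, g z ≠ 0) (hM : ∀ z ∈ Metric.ball (0 : ℂ) r, ‖g z‖ ≤ M)
    {z : ℂ} (hz : ‖z‖ ≤ r / 2) : ‖g 0‖ * (‖g 0‖ / (2 * M)) ^ 2 ≤ ‖g z‖ := by
  have h00 : (0 : ℂ) ∈ Metric.ball (0 : ℂ) r := by simpa using hr
  have hg0 : 0 < ‖g 0‖ := norm_pos_iff.2 (h0 0 h00)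
  have hMpos : 0 < M := hg0.trans_le (hM 0 h00)
  have hd : DifferentiableOn ℂ (fun z => deriv g z / g z) (Metric.ball 0 r) :=
    (hg.deriv.differentiableOn).div hg.differentiableOn h0
  obtain ⟨h, hh⟩ := hd.isExactOn_ball
  let k : ℂ → ℂ := fun z => h z - h 0
  have hk : ∀ z ∈ Metric.ball (0 : ℂ) r, HasDerivAt k (deriv g z / g z) z := fun z hz =>
    (hh z hz).sub_const _
  have hgk : ∀ z ∈ Metric.ball (0 : ℂ) r, g z = g 0 * Complex.exp (k z) := by
    have hder : ∀ z ∈ Metric.ball (0 : ℂ) r,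
        HasDerivAt (fun z => g z * Complex.exp (-k z)) 0 z := by
      intro z hz
      have h1 := h0 z hz
      have h2 : g z * (deriv g z / g z) = deriv g z := mul_div_cancel₀ _ h1
      have h3 : (0 : ℂ) = deriv g z * Complex.exp (-k z) +
          g z * (Complex.exp (-k z) * -(deriv g z / g z)) := by
        linear_combination Complex.exp (-k z) * h2
      exact ((hg z).hasDerivAt.mul ((hk z hz).neg.cexp)).congr_deriv h3.symm
    intro z hz
    have hcst := Metric.isOpen_ball.is_const_of_deriv_eq_zero (f := fun z => g z * Complex.exp (-k z))
      (convex_ball (0 : ℂ) r).isPreconnected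
      (fun z hz => (hder z hz).differentiableAt.differentiableWithinAt)
      (fun z hz => (hder z hz).deriv) hz h00
    simp only [k, sub_self, neg_zero, Complex.exp_zero, mul_one] at hcst
    rw [← hcst, mul_assoc, ← Complex.exp_add]
    simp [k]
  set A : ℝ := Real.log (2 * M / ‖g 0‖) with hA
  have hApos : 0 < A := by
    apply Real.log_pos
    rw [lt_div_iff₀ hg0]
    linarith [hM 0 h00]
  have hexpA : Real.exp A = 2 * M / ‖g 0‖ := Real.exp_log (by positivity)
  have hre : MapsTo k (Metric.ball 0 r) {z | z.re ≤ A} := by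
    intro w hw
    have h1 := hM w hw
    rw [hgk w hw, norm_mul, Complex.norm_exp] at h1
    show (k w).re ≤ A
    rw [← Real.exp_le_exp, hexpA, le_div_iff₀ hg0]
    linarith
  have hzb : z ∈ Metric.ball (0 : ℂ) r := by simp; linarith
  have hb := Complex.borelCaratheodory_zero hApos
    (fun w hw => (hk w hw).differentiableAt.differentiableWithinAt) hre hr hzb (by simp [k])
  have hb2 : ‖k z‖ ≤ 2 * A := by
    refine hb.trans ?_
    rw [div_le_iff₀ (by linarith)]
    nlinarith
  rw [hgk z hzb, norm_mul, Complex.norm_exp]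
  gcongr
  have h3 : -(2 * A) ≤ (k z).re := by
    have := Complex.abs_re_le_norm (k z)
    have := neg_abs_le (k z).re
    linarith
  calc (‖g 0‖ / (2 * M)) ^ 2 = (Real.exp (-A)) ^ 2 := by
        rw [Real.exp_neg, hexpA, inv_div]
    _ = Real.exp (-(2 * A)) := by rw [← Real.exp_nat_mul]; congr 1; push_cast; ring
    _ ≤ _ := Real.exp_le_exp.2 h3

theorem norm_le_on_closedBall {f : ℂ → ℂ} (hf : Differentiable ℂ f) {R M : ℝ} (hR : 0 < R)
    (hM : ∀ z : ℂ, ‖z‖ = R → ‖f z‖ ≤ M) {z : ℂ} (hz : ‖z‖ ≤ R) : ‖f z‖ ≤ M := by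
  refine Complex.norm_le_of_forall_mem_frontier_norm_le (U := Metric.ball (0 : ℂ) R)
    Metric.isBounded_ball hf.diffContOnCl ?_ ?_
  · intro w hw
    rw [frontier_ball _ hR.ne'] at hw
    exact hM w (by simpa using hw)
  · rw [closure_ball _ hR.ne']
    simpa using hz

/-- Bound for an entire function `G` on a disc in terms of bounds for `Δ` and `G * Δ` on a
larger circle. -/
theorem norm_quotient_bound_aux {G : ℂ → ℂ} (hG : Differentiable ℂ G) {r M M' δ : ℝ} (hr : 0 < r)
    (hδ : 0 < δ) (N : ℕ) :
    ∀ Δ : ℂ → ℂ, Differentiable ℂ Δ → (∀ z : ℂ, ‖z‖ = 4 * r → ‖Δ z‖ ≤ M) →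
      (∀ z : ℂ, ‖z‖ = 4 * r → ‖G z * Δ z‖ ≤ M') → δ ≤ ‖Δ 0‖ → M < 3 ^ N * ‖Δ 0‖ →
      ∀ z : ℂ, ‖z‖ ≤ r / 2 → ‖G z‖ ≤ M' * ((2 * M) ^ 2 / δ ^ 3) := by
  induction N with
  | zero =>
    intro Δ hΔ h1 _ _ h4
    have := norm_le_on_closedBall hΔ (by positivity) h1 (z := 0) (by simp; linarith)
    simp at h4
    linarith
  | succ N ih =>
    intro Δ hΔ h1 h2 h3 h4
    by_cases hzero : ∃ u : ℂ, ‖u‖ ≤ r ∧ Δ u = 0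
    · obtain ⟨u, hu, hu0⟩ := hzero
      have hd : ∀ z, (z - u) * dslope Δ u z = Δ z := fun z => by
        have := sub_smul_dslope Δ u z
        rwa [hu0, sub_zero, smul_eq_mul] at this
      have hsph : ∀ z : ℂ, ‖z‖ = 4 * r → ∀ w : ℂ, ‖w * (3 * r * dslope Δ u z)‖ ≤ ‖w * Δ z‖ := by
        intro z hz w
        rw [← hd z, norm_mul, norm_mul, norm_mul w, norm_mul (z - u)]
        gcongr
        have h5 : ‖z‖ - ‖u‖ ≤ ‖z - u‖ := norm_sub_norm_le z u
        have h6 : ‖(3 * r : ℂ)‖ = 3 * r := by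
          rw [show (3 * r : ℂ) = ((3 * r : ℝ) : ℂ) by push_cast; rfl, Complex.norm_real,
            Real.norm_of_nonneg (by positivity)]
        rw [h6]
        linarith
      have h03 : 3 * ‖Δ 0‖ ≤ ‖3 * (r : ℂ) * dslope Δ u 0‖ := by
        rw [← hd 0, norm_mul, norm_mul, norm_mul, zero_sub, norm_neg]
        simp only [Complex.norm_ofNat, Complex.norm_real, Real.norm_of_nonneg hr.le]
        have : 0 ≤ ‖dslope Δ u 0‖ := norm_nonneg _
        nlinarith
      refine ih (fun z => 3 * r * dslope Δ u z)
        ((differentiable_dslope hΔ u).const_mul _) ?_ ?_ ?_ ?_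
      · intro z hz
        have := hsph z hz 1
        simp only [one_mul] at this
        exact this.trans (h1 z hz)
      · intro z hz
        exact (hsph z hz _).trans (h2 z hz)
      · linarith [norm_nonneg (Δ 0)]
      · have : (0 : ℝ) < 3 ^ N := by positivity
        calc M < 3 ^ (N + 1) * ‖Δ 0‖ := h4
          _ = 3 ^ N * (3 * ‖Δ 0‖) := by ring
          _ ≤ _ := by gcongr
    · push Not at hzero
      intro z hz
      have hM : ∀ z : ℂ, ‖z‖ ≤ 4 * r → ‖Δ z‖ ≤ M := fun z hz =>
        norm_le_on_closedBall hΔ (by positivity) h1 hz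
      have hM' : ‖G z * Δ z‖ ≤ M' :=
        norm_le_on_closedBall (f := fun z => G z * Δ z) (hG.mul hΔ) (by positivity) h2 (by linarith)
      have hlow := norm_lower_bound_of_zeroFree hΔ hr
        (fun z hz => hzero z (by simpa using (Metric.mem_ball.1 hz).le))
        (fun z hz => hM z (by have := Metric.mem_ball.1 hz; simp at this; linarith)) hz
      have hMpos : 0 < M := (hδ.trans_le h3).trans_le (hM 0 (by simp; linarith))
      have hlow2 : δ ^ 3 / (2 * M) ^ 2 ≤ ‖Δ z‖ := by
        refine le_trans ?_ hlow
        rw [div_pow, ← mul_div_assoc]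
        gcongr
        calc δ ^ 3 = δ * δ ^ 2 := by ring
          _ ≤ _ := by gcongr
      rw [norm_mul] at hM'
      have hp : 0 < δ ^ 3 / (2 * M) ^ 2 := by positivity
      calc ‖G z‖ ≤ M' / (δ ^ 3 / (2 * M) ^ 2) := by
            rw [le_div_iff₀ hp]
            refine le_trans ?_ hM'
            gcongr
        _ = _ := by field_simp

/-- The quotient of two entire functions of exponential type, if entire, is of exponential type. -/
theorem exists_exp_bound_of_quotient {F Δ G : ℂ → ℂ} (hΔ : Differentiable ℂ Δ)
    (hG : Differentiable ℂ G) (hFG : ∀ z, F z = G z * Δ z) (hne : ∃ z, Δ z ≠ 0) {C : ℝ}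
    (hFb : ∀ z, ‖F z‖ ≤ Real.exp (C * (1 + ‖z‖))) (hΔb : ∀ z, ‖Δ z‖ ≤ Real.exp (C * (1 + ‖z‖))) :
    ∃ A B : ℝ, ∀ z, ‖G z‖ ≤ A * Real.exp (B * ‖z‖) := by
  obtain ⟨c, hc⟩ := hne
  wlog hC : 0 < C generalizing C
  · refine this (C := 1) (fun z => (hFb z).trans ?_) (fun z => (hΔb z).trans ?_) one_pos <;>
    · apply Real.exp_le_exp.2
      have := norm_nonneg z
      nlinarith
  set δ := ‖Δ c‖ with hδdef
  have hδ : 0 < δ := norm_pos_iff.2 hc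
  have key : ∀ r : ℝ, 0 < r → ∀ z : ℂ, ‖z‖ ≤ r / 2 → ‖G (z + c)‖ ≤
      Real.exp (C * (1 + (4 * r + ‖c‖))) *
        ((2 * Real.exp (C * (1 + (4 * r + ‖c‖)))) ^ 2 / δ ^ 3) := by
    intro r hr z hz
    set M := Real.exp (C * (1 + (4 * r + ‖c‖))) with hM
    obtain ⟨N, hN⟩ := pow_unbounded_of_one_lt (M / δ) (by norm_num : (1 : ℝ) < 3)
    have hnorm : ∀ z : ℂ, ‖z‖ = 4 * r → Real.exp (C * (1 + ‖z + c‖)) ≤ M := by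
      intro z hz
      apply Real.exp_le_exp.2
      gcongr
      exact (norm_add_le _ _).trans (by rw [hz])
    refine norm_quotient_bound_aux (G := fun z => G (z + c)) (hG.comp (by fun_prop)) hr hδ N
      (fun z => Δ (z + c)) (hΔ.comp (by fun_prop)) (fun z hz => (hΔb _).trans (hnorm z hz)) ?_
      (by simp [hδdef]) ?_ z hz
    · intro z hz
      rw [← hFG]
      exact (hFb _).trans (hnorm z hz)
    · rw [div_lt_iff₀ hδ] at hN
      simpa [hδdef] using hN
  refine ⟨Real.exp (C * (1 + 16 + 9 * ‖c‖)) * (2 * Real.exp (C * (1 + 16 + 9 * ‖c‖))) ^ 2 / δ ^ 3,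
    C * 24, fun z => ?_⟩
  have h1 := key (2 * (‖z‖ + ‖c‖) + 4) (by positivity) (z - c)
    ((norm_sub_le _ _).trans (by linarith))
  rw [sub_add_cancel] at h1
  refine h1.trans (le_of_eq ?_)
  have h2 : Real.exp (C * (1 + (4 * (2 * (‖z‖ + ‖c‖) + 4) + ‖c‖))) =
      Real.exp (C * (1 + 16 + 9 * ‖c‖)) * Real.exp (C * 8 * ‖z‖) := by
    rw [← Real.exp_add]; congr 1; ring
  have h3 : Real.exp (C * 24 * ‖z‖) = Real.exp (C * 8 * ‖z‖) ^ 3 := by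
    rw [← Real.exp_nat_mul]; congr 1; push_cast; ring
  rw [h2, h3]
  ring

theorem exists_entire_quotient {F Δ : ℂ → ℂ} (hF : Differentiable ℂ F) (hΔ : Differentiable ℂ Δ)
    (hne : ∃ z, Δ z ≠ 0)
    (hord : ∀ z : ℂ, ∀ k : ℕ, (∀ j ≤ k, iteratedDeriv j Δ z = 0) → iteratedDeriv k F z = 0) :
    ∃ G : ℂ → ℂ, Differentiable ℂ G ∧ ∀ z, F z = G z * Δ z := by
  have hFa : ∀ z, AnalyticAt ℂ F z := fun z => hF.analyticAt z
  have hΔa : ∀ z, AnalyticAt ℂ Δ z := fun z => hΔ.analyticAt z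
  have hmer : MeromorphicOn (F / Δ) univ := fun z _ => (hFa z).meromorphicAt.div (hΔa z).meromorphicAt
  have hfin : ∀ z, analyticOrderAt Δ z ≠ ⊤ := by
    intro z hz
    obtain ⟨w, hw⟩ := hne
    have : Δ =ᶠ[𝓝 z] 0 := by
      rw [analyticOrderAt_eq_top] at hz
      exact hz
    have han : AnalyticOnNhd ℂ Δ univ := fun z _ => hΔa z
    exact hw (congrFun (han.eq_of_eventuallyEq (g := 0) (fun z _ => analyticAt_const) this) w)
  have hle : ∀ z, analyticOrderAt Δ z ≤ analyticOrderAt F z := by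
    intro z
    obtain ⟨n, hn⟩ := ENat.ne_top_iff_exists.1 (hfin z)
    rw [← hn, natCast_le_analyticOrderAt_iff_iteratedDeriv_eq_zero (hFa z)]
    intro i hi
    refine hord z i fun j hj => ?_
    exact (natCast_le_analyticOrderAt_iff_iteratedDeriv_eq_zero (hΔa z)).1 hn.le j (by omega)
  set G := toMeromorphicNFOn (F / Δ) univ with hGdef
  have hGan : ∀ z, AnalyticAt ℂ G z := by
    intro z
    rw [← (meromorphicNFOn_toMeromorphicNFOn (F / Δ) univ
      (mem_univ z)).meromorphicOrderAt_nonneg_iff_analyticAt,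
      meromorphicOrderAt_toMeromorphicNFOn hmer (mem_univ z),
      meromorphicOrderAt_div (hFa z).meromorphicAt (hΔa z).meromorphicAt,
      (hFa z).meromorphicOrderAt_eq, (hΔa z).meromorphicOrderAt_eq]
    obtain ⟨n, hn⟩ := ENat.ne_top_iff_exists.1 (hfin z)
    have hz := hle z
    rw [← hn] at hz ⊢
    rcases h : analyticOrderAt F z with _ | k
    · exact le_of_eq_of_le rfl (le_top : (0 : WithTop ℤ) ≤ ⊤)
    · rw [h] at hz
      have hnk : n ≤ k := ENat.natCast_le_natCast.1 hz
      change (0 : WithTop ℤ) ≤ ((k : ℤ) : WithTop ℤ) - ((n : ℤ) : WithTop ℤ)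
      rw [← WithTop.LinearOrderedAddCommGroup.coe_sub]
      exact_mod_cast sub_nonneg.2 (by exact_mod_cast hnk : (n : ℤ) ≤ k)
  have hGd : Differentiable ℂ G := fun z => (hGan z).differentiableAt
  refine ⟨G, hGd, fun z => ?_⟩
  have h1 : G =ᶠ[𝓝[≠] z] F / Δ := hmer.toMeromorphicNFOn_eq_self_on_nhdsNE (mem_univ z)
  have h2 : ∀ᶠ w in 𝓝[≠] z, Δ w ≠ 0 := by
    rcases (hΔa z).eventually_eq_zero_or_eventually_ne_zero with h | h
    · exact absurd (analyticOrderAt_eq_top.2 h) (hfin z)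
    · exact h
  have h3 : F =ᶠ[𝓝[≠] z] fun w => G w * Δ w := by
    filter_upwards [h1, h2] with w hw1 hw2
    rw [hw1]
    simp [div_mul_cancel₀ _ hw2]
  exact tendsto_nhds_unique (hF.continuous.continuousAt.continuousWithinAt.tendsto.congr' h3)
    ((hGd.mul hΔ).continuous.continuousAt.continuousWithinAt.tendsto)

theorem norm_le_of_bounded_on_axes {G : ℂ → ℂ} (hG : Differentiable ℂ G) {A B C : ℝ}
    (hexp : ∀ z, ‖G z‖ ≤ A * Real.exp (B * ‖z‖)) (hre : ∀ x : ℝ, ‖G x‖ ≤ C)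
    (him : ∀ x : ℝ, ‖G (x * Complex.I)‖ ≤ C) (z : ℂ) : ‖G z‖ ≤ C := by
  have hO : ∀ l : Filter ℂ, ∃ c < (2 : ℝ), ∃ B, G =O[l] fun z => Real.exp (B * ‖z‖ ^ c) := by
    intro l
    refine ⟨1, by norm_num, B, Asymptotics.IsBigO.of_bound A (Eventually.of_forall fun z => ?_)⟩
    rw [Real.rpow_one, Real.norm_of_nonneg (Real.exp_pos _).le]
    exact hexp z
  rcases le_total 0 z.re with h1 | h1 <;> rcases le_total 0 z.im with h2 | h2
  · exact PhragmenLindelof.quadrant_I hG.diffContOnCl (hO _) (fun x _ => hre x)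
      (fun x _ => him x) h1 h2
  · exact PhragmenLindelof.quadrant_IV hG.diffContOnCl (hO _) (fun x _ => hre x)
      (fun x _ => him x) h1 h2
  · exact PhragmenLindelof.quadrant_II hG.diffContOnCl (hO _) (fun x _ => hre x)
      (fun x _ => him x) h1 h2
  · exact PhragmenLindelof.quadrant_III hG.diffContOnCl (hO _) (fun x _ => hre x)
      (fun x _ => him x) h1 h2

theorem eq_zero_of_const_of_decay {G : ℂ → ℂ} (hc : ∀ z, G z = G 0) {T C : ℝ}
    (hlow : ∀ t : ℝ, T ≤ t → ‖G (-t)‖ ≤ C / t) (z : ℂ) : G z = 0 := by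
  rw [hc z, ← norm_le_zero_iff]
  refine ge_of_tendsto (tendsto_const_nhds.div_atTop tendsto_id : Tendsto (fun t : ℝ => C / t) atTop (𝓝 0)) ?_
  filter_upwards [eventually_ge_atTop T] with t ht
  rw [← hc (-t)]
  exact hlow t ht

/-- An entire function of exponential type, of polynomial growth on two half-axes and decaying on
the two opposite half-axes, vanishes. -/
theorem eq_zero_of_growth_on_axes (K : ℕ) : ∀ (G : ℂ → ℂ) (_ : Differentiable ℂ G) (A B C T : ℝ)
    (_ : 1 ≤ T) (_ : ∀ z, ‖G z‖ ≤ A * Real.exp (B * ‖z‖))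
    (_ : ∀ t : ℝ, T ≤ t → ‖G t‖ ≤ C * t ^ K) (_ : ∀ t : ℝ, T ≤ t → ‖G (t * Complex.I)‖ ≤ C * t ^ K)
    (_ : ∀ t : ℝ, T ≤ t → ‖G (-t)‖ ≤ C / t) (_ : ∀ t : ℝ, T ≤ t → ‖G (-t * Complex.I)‖ ≤ C / t),
    ∀ z, G z = 0 := by
  induction K with
  | zero =>
    intro G hG A B C T hT hexp h1 h2 h3 h4
    obtain ⟨M, hM⟩ := (isCompact_closedBall (0 : ℂ) T).exists_bound_of_continuousOn
      hG.continuous.continuousOn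
    have hC : 0 ≤ C := by simpa using (norm_nonneg _).trans (h1 T le_rfl)
    have hcase : ∀ w : ℂ, ‖w‖ = 1 → (∀ t : ℝ, T ≤ t → ‖G (t * w)‖ ≤ C) →
        (∀ t : ℝ, T ≤ t → ‖G (-t * w)‖ ≤ C) → ∀ x : ℝ, ‖G (x * w)‖ ≤ max M C := by
      intro w hw ha hb x
      by_cases hx : |x| ≤ T
      · exact (hM _ (by simpa [hw] using hx)).trans (le_max_left _ _)
      · refine le_trans ?_ (le_max_right _ _)
        push Not at hx
        rcases abs_cases x with ⟨h, _⟩ | ⟨h, _⟩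
        · exact ha x (by linarith)
        · have := hb (-x) (by linarith)
          simpa using this
    have hdiv : ∀ t : ℝ, T ≤ t → C / t ≤ C := fun t ht => div_le_self hC (hT.trans ht)
    have hre := hcase 1 (by simp) (fun t ht => by simpa using h1 t ht)
      (fun t ht => by simpa using (h3 t ht).trans (hdiv t ht))
    have him := hcase Complex.I (by simp) (fun t ht => by simpa using h2 t ht)
      (fun t ht => (h4 t ht).trans (hdiv t ht))
    have hb := norm_le_of_bounded_on_axes hG hexp (fun x => by simpa using hre x) him
    refine eq_zero_of_const_of_decay (fun z => hG.apply_eq_apply_of_bounded ?_ z 0) h3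
    rw [isBounded_iff_forall_norm_le]
    exact ⟨_, by rintro _ ⟨z, rfl⟩; exact hb z⟩
  | succ K ih =>
    intro G hG A B C T hT hexp h1 h2 h3 h4
    have hC : 0 ≤ C := by
      have := (norm_nonneg _).trans (h3 T le_rfl)
      by_contra hneg
      push Not at hneg
      exact absurd this (not_le.2 (div_neg_of_neg_of_pos hneg (by linarith)))
    obtain ⟨M, hM⟩ := (isCompact_closedBall (0 : ℂ) 1).exists_bound_of_continuousOn
      (differentiable_dslope hG 0).continuous.continuousOn
    have hd : ∀ z : ℂ, ‖z‖ * ‖dslope G 0 z‖ ≤ ‖G z‖ + ‖G 0‖ := fun z => by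
      have := sub_smul_dslope G 0 z
      rw [sub_zero, smul_eq_mul] at this
      rw [← norm_mul, this]
      exact norm_sub_le _ _
    have hA : 0 ≤ A := by simpa using (norm_nonneg _).trans (hexp 0)
    have hdexp : ∀ z, ‖dslope G 0 z‖ ≤ (|M| + A + ‖G 0‖) * Real.exp (|B| * ‖z‖) := by
      intro z
      have he : 1 ≤ Real.exp (|B| * ‖z‖) := Real.one_le_exp (by positivity)
      have hG0 := norm_nonneg (G 0)
      by_cases hz : ‖z‖ ≤ 1
      · have := hM z (by simpa using hz)
        nlinarith [le_abs_self M, abs_nonneg M]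
      · push Not at hz
        have h5 : ‖G z‖ ≤ A * Real.exp (|B| * ‖z‖) := (hexp z).trans (by
          gcongr
          exact le_abs_self B)
        have h6 := hd z
        have h7 := norm_nonneg (dslope G 0 z)
        nlinarith [abs_nonneg M]
    have hpos : ∀ t : ℝ, T ≤ t → ∀ z : ℂ, ‖z‖ = t → ‖G z‖ ≤ C * t ^ (K + 1) →
        ‖dslope G 0 z‖ ≤ (C + ‖G 0‖) * t ^ K := by
      intro t ht z hz hb
      have h5 := hd z
      have ht1 : 1 ≤ t := hT.trans ht
      rw [hz] at h5
      have h6 : 1 ≤ t ^ (K + 1) := one_le_pow₀ ht1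
      have h7 : t * ‖dslope G 0 z‖ ≤ t * ((C + ‖G 0‖) * t ^ K) := by
        calc _ ≤ _ := h5
          _ ≤ (C + ‖G 0‖) * t ^ (K + 1) := by nlinarith [norm_nonneg (G 0)]
          _ = _ := by ring
      exact le_of_mul_le_mul_left h7 (by linarith)
    have hneg : ∀ t : ℝ, T ≤ t → ∀ z : ℂ, ‖z‖ = t → ‖G z‖ ≤ C / t →
        ‖dslope G 0 z‖ ≤ (C + ‖G 0‖) / t := by
      intro t ht z hz hb
      have h5 := hd z
      have ht1 : 1 ≤ t := hT.trans ht
      rw [hz] at h5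
      rw [le_div_iff₀ (by linarith), mul_comm]
      linarith [div_le_self hC ht1]
    have habs : ∀ t : ℝ, T ≤ t → |t| = t := fun t ht => abs_of_nonneg (by linarith)
    have h0 := ih (dslope G 0) (differentiable_dslope hG 0) _ _ (C + ‖G 0‖) T hT hdexp
      (fun t ht => hpos t ht _ (by simp [habs t ht]) (h1 t ht))
      (fun t ht => hpos t ht _ (by simp [habs t ht]) (h2 t ht))
      (fun t ht => hneg t ht _ (by simp [habs t ht]) (h3 t ht))
      (fun t ht => hneg t ht _ (by simp [habs t ht]) (h4 t ht))
    refine eq_zero_of_const_of_decay (fun z => ?_) h3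
    have := sub_smul_dslope G 0 z
    rw [h0 z, smul_zero] at this
    exact (sub_eq_zero.1 this.symm)

theorem hasDerivAt_cexp_linear (κ : ℂ) (c s : ℝ) :
    HasDerivAt (fun s : ℝ => Complex.exp (κ * ((c : ℂ) - s))) (-κ * Complex.exp (κ * ((c : ℂ) - s))) s := by
  have h1 : HasDerivAt (fun s : ℝ => κ * ((c : ℂ) - s)) (-κ) s := by
    have := (((hasDerivAt_id s).ofReal_comp).const_sub (c : ℂ)).const_mul κ
    simpa using this
  have := h1.cexp
  rwa [mul_comm] at this

/-- Variation of constants for a scalar linear equation. -/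
theorem duhamel {y f : ℝ → ℂ} {κ : ℂ} (hy : ContinuousOn y (Icc 0 1)) (hf : ContinuousOn f (Icc 0 1))
    (hd : ∀ x ∈ Ioo (0 : ℝ) 1, HasDerivAt y (κ * y x + f x) x) {x₀ x : ℝ} (hx₀ : x₀ ∈ Icc (0 : ℝ) 1)
    (hx : x ∈ Icc (0 : ℝ) 1) :
    y x = Complex.exp (κ * ((x : ℂ) - x₀)) * y x₀ +
      ∫ s in x₀..x, Complex.exp (κ * ((x : ℂ) - s)) * f s := by
  have hsub : uIcc x₀ x ⊆ Icc 0 1 := uIcc_subset_Icc hx₀ hx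
  have hc : Continuous fun s : ℝ => Complex.exp (κ * ((x : ℂ) - s)) := by fun_prop
  have h := intervalIntegral.integral_eq_sub_of_hasDeriv_right
    (f := fun s => Complex.exp (κ * ((x : ℂ) - s)) * y s)
    (f' := fun s => Complex.exp (κ * ((x : ℂ) - s)) * f s) (a := x₀) (b := x)
    (hc.continuousOn.mul (hy.mono hsub)) ?_ (hc.continuousOn.mul (hf.mono hsub)).intervalIntegrable
  · rw [h]
    simp
  · intro s hs
    have hs' : s ∈ Ioo (0 : ℝ) 1 :=
      ⟨(le_min hx₀.1 hx.1).trans_lt hs.1, hs.2.trans_le (max_le hx₀.2 hx.2)⟩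
    refine HasDerivAt.hasDerivWithinAt ?_
    refine ((hasDerivAt_cexp_linear κ x s).mul (hd s hs')).congr_deriv ?_
    ring

theorem integral_exp_linear_le {c d x₀ x : ℝ} (hd : 0 < d) :
    ∫ s in x₀..x, Real.exp (c + d * s) ≤ Real.exp (c + d * x) / d := by
  have h : ∫ s in x₀..x, Real.exp (c + d * s) =
      Real.exp (c + d * x) / d - Real.exp (c + d * x₀) / d := by
    apply intervalIntegral.integral_eq_sub_of_hasDerivAt (f := fun s => Real.exp (c + d * s) / d)
    · intro s _
      have h1 : HasDerivAt (fun s => c + d * s) d s := by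
        simpa using ((hasDerivAt_id s).const_mul d).const_add c
      refine (h1.exp.div_const d).congr_deriv ?_
      field_simp
    · exact (by fun_prop : Continuous fun s => Real.exp (c + d * s)).intervalIntegrable _ _
  rw [h]
  have : 0 ≤ Real.exp (c + d * x₀) / d := by positivity
  linarith

theorem integral_exp_linear_le' {c d x₀ x : ℝ} (hd : 0 < d) :
    ∫ s in x₀..x, Real.exp (c - d * s) ≤ Real.exp (c - d * x₀) / d := by
  have h : ∫ s in x₀..x, Real.exp (c - d * s) =
      -(Real.exp (c - d * x) / d) - -(Real.exp (c - d * x₀) / d) := by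
    apply intervalIntegral.integral_eq_sub_of_hasDerivAt (f := fun s => -(Real.exp (c - d * s) / d))
    · intro s _
      have h1 : HasDerivAt (fun s => c - d * s) (-d) s := by
        simpa using ((hasDerivAt_id s).const_mul d).const_sub c
      refine (h1.exp.div_const d).neg.congr_deriv ?_
      field_simp
    · exact (by fun_prop : Continuous fun s => Real.exp (c - d * s)).intervalIntegrable _ _
  rw [h]
  have : 0 ≤ Real.exp (c - d * x) / d := by positivity
  linarith

theorem norm_le_backward {y f : ℝ → ℂ} {κ : ℂ} (hy : ContinuousOn y (Icc 0 1))
    (hf : ContinuousOn f (Icc 0 1))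
    (hd : ∀ x ∈ Ioo (0 : ℝ) 1, HasDerivAt y (κ * y x + f x) x) (h1 : y 1 = 0) {F d : ℝ}
    (hF : ∀ s ∈ Icc (0 : ℝ) 1, ‖f s‖ ≤ F * Real.exp (-d * s)) (hpos : 0 < κ.re + d) {x : ℝ}
    (hx : x ∈ Icc (0 : ℝ) 1) : ‖y x‖ ≤ F / (κ.re + d) * Real.exp (-d * x) := by
  have hF0 : 0 ≤ F := by simpa using (norm_nonneg _).trans (hF 0 (by simp))
  rw [duhamel hy hf hd (x₀ := 1) (by simp) hx, h1, mul_zero, zero_add,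
    intervalIntegral.integral_symm, norm_neg]
  have hb : ∀ s ∈ Ioc x 1, ‖Complex.exp (κ * ((x : ℂ) - s)) * f s‖ ≤
      F * Real.exp (κ.re * x - (κ.re + d) * s) := by
    intro s hs
    rw [norm_mul, Complex.norm_exp]
    have h2 := hF s ⟨hx.1.trans hs.1.le, hs.2⟩
    have h3 : (κ * ((x : ℂ) - s)).re = κ.re * (x - s) := by
      rw [← Complex.ofReal_sub, Complex.re_mul_ofReal]
    rw [h3]
    calc _ ≤ Real.exp (κ.re * (x - s)) * (F * Real.exp (-d * s)) := by gcongr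
      _ = F * (Real.exp (κ.re * (x - s)) * Real.exp (-d * s)) := by ring
      _ = _ := by rw [← Real.exp_add]; ring_nf
  refine (intervalIntegral.norm_integral_le_of_norm_le hx.2
    (ae_of_all _ fun s hs => hb s hs) (Continuous.intervalIntegrable (by fun_prop) _ _)).trans ?_
  rw [intervalIntegral.integral_const_mul]
  refine (mul_le_mul_of_nonneg_left (integral_exp_linear_le' hpos) hF0).trans (le_of_eq ?_)
  rw [show κ.re * x - (κ.re + d) * x = -d * x by ring]
  ring

theorem norm_sub_le_forward {y f : ℝ → ℂ} {κ : ℂ} (hy : ContinuousOn y (Icc 0 1))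
    (hf : ContinuousOn f (Icc 0 1))
    (hd : ∀ x ∈ Ioo (0 : ℝ) 1, HasDerivAt y (κ * y x + f x) x) {F d : ℝ}
    (hF : ∀ s ∈ Icc (0 : ℝ) 1, ‖f s‖ ≤ F * Real.exp (-d * s)) (hpos : 0 < -κ.re - d) {x : ℝ}
    (hx : x ∈ Icc (0 : ℝ) 1) :
    ‖y x - Complex.exp (κ * x) * y 0‖ ≤ F / (-κ.re - d) * Real.exp (-d * x) := by
  have hF0 : 0 ≤ F := by simpa using (norm_nonneg _).trans (hF 0 (by simp))
  rw [duhamel hy hf hd (x₀ := 0) (by simp) hx, Complex.ofReal_zero, sub_zero, add_sub_cancel_left]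
  have hb : ∀ s ∈ Ioc 0 x, ‖Complex.exp (κ * ((x : ℂ) - s)) * f s‖ ≤
      F * Real.exp (κ.re * x + (-κ.re - d) * s) := by
    intro s hs
    rw [norm_mul, Complex.norm_exp]
    have h2 := hF s ⟨hs.1.le, hs.2.trans hx.2⟩
    have h3 : (κ * ((x : ℂ) - s)).re = κ.re * (x - s) := by
      rw [← Complex.ofReal_sub, Complex.re_mul_ofReal]
    rw [h3]
    calc _ ≤ Real.exp (κ.re * (x - s)) * (F * Real.exp (-d * s)) := by gcongr
      _ = F * (Real.exp (κ.re * (x - s)) * Real.exp (-d * s)) := by ring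
      _ = _ := by rw [← Real.exp_add]; ring_nf
  refine (intervalIntegral.norm_integral_le_of_norm_le hx.1
    (ae_of_all _ fun s hs => hb s hs) (Continuous.intervalIntegrable (by fun_prop) _ _)).trans ?_
  rw [intervalIntegral.integral_const_mul]
  refine (mul_le_mul_of_nonneg_left (integral_exp_linear_le hpos) hF0).trans (le_of_eq ?_)
  rw [show κ.re * x + (-κ.re - d) * x = -d * x by ring]
  ring

theorem norm_le_forward_critical {y f : ℝ → ℂ} {κ : ℂ} (hy : ContinuousOn y (Icc 0 1))
    (hf : ContinuousOn f (Icc 0 1))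
    (hd : ∀ x ∈ Ioo (0 : ℝ) 1, HasDerivAt y (κ * y x + f x) x) {F : ℝ}
    (hF : ∀ s ∈ Icc (0 : ℝ) 1, ‖f s‖ ≤ F * Real.exp (κ.re * s)) {x : ℝ}
    (hx : x ∈ Icc (0 : ℝ) 1) : ‖y x‖ ≤ (‖y 0‖ + F) * Real.exp (κ.re * x) := by
  have hF0 : 0 ≤ F := by simpa using (norm_nonneg _).trans (hF 0 (by simp))
  rw [duhamel hy hf hd (x₀ := 0) (by simp) hx, Complex.ofReal_zero, sub_zero]
  have hb : ∀ s ∈ uIoc 0 x, ‖Complex.exp (κ * ((x : ℂ) - s)) * f s‖ ≤ F * Real.exp (κ.re * x) := by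
    intro s hs
    rw [uIoc_of_le hx.1] at hs
    rw [norm_mul, Complex.norm_exp]
    have h2 := hF s ⟨hs.1.le, hs.2.trans hx.2⟩
    have h3 : (κ * ((x : ℂ) - s)).re = κ.re * (x - s) := by
      rw [← Complex.ofReal_sub, Complex.re_mul_ofReal]
    rw [h3]
    calc _ ≤ Real.exp (κ.re * (x - s)) * (F * Real.exp (κ.re * s)) := by gcongr
      _ = F * (Real.exp (κ.re * (x - s)) * Real.exp (κ.re * s)) := by ring
      _ = _ := by rw [← Real.exp_add]; ring_nf
  have h4 := intervalIntegral.norm_integral_le_of_norm_le_const hb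
  rw [sub_zero, abs_of_nonneg hx.1] at h4
  refine (norm_add_le _ _).trans ?_
  rw [norm_mul, Complex.norm_exp, Complex.re_mul_ofReal]
  have h5 : 0 ≤ F * Real.exp (κ.re * x) := by positivity
  nlinarith [hx.2, hx.1]

/-- Classical solutions on `[0,1]` of the inhomogeneous system `L y = lam * y + u`. -/
structure DiracSol (b₁ b₂ : ℝ) (q₁ q₂ : ℝ → ℂ) (lam : ℂ) (u₁ u₂ y₁ y₂ : ℝ → ℂ) : Prop where
  cont₁ : ContinuousOn y₁ (Icc 0 1)
  cont₂ : ContinuousOn y₂ (Icc 0 1)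
  deriv₁ : ∀ x ∈ Ioo (0 : ℝ) 1,
    HasDerivAt y₁ (Complex.I * b₁ * (lam * y₁ x + u₁ x - q₁ x * y₂ x)) x
  deriv₂ : ∀ x ∈ Ioo (0 : ℝ) 1,
    HasDerivAt y₂ (Complex.I * b₂ * (lam * y₂ x + u₂ x - q₂ x * y₁ x)) x

section Estimates

variable {b₁ b₂ : ℝ} {q₁ q₂ : ℝ → ℂ} {lam : ℂ} {u₁ u₂ y₁ y₂ : ℝ → ℂ}

theorem DiracSol.linear₁ (h : DiracSol b₁ b₂ q₁ q₂ lam u₁ u₂ y₁ y₂) : ∀ x ∈ Ioo (0 : ℝ) 1,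
    HasDerivAt y₁ (Complex.I * b₁ * lam * y₁ x + Complex.I * b₁ * (u₁ x - q₁ x * y₂ x)) x :=
  fun x hx => (h.deriv₁ x hx).congr_deriv (by ring)

theorem DiracSol.linear₂ (h : DiracSol b₁ b₂ q₁ q₂ lam u₁ u₂ y₁ y₂) : ∀ x ∈ Ioo (0 : ℝ) 1,
    HasDerivAt y₂ (Complex.I * b₂ * lam * y₂ x + Complex.I * b₂ * (u₂ x - q₂ x * y₁ x)) x :=
  fun x hx => (h.deriv₂ x hx).congr_deriv (by ring)

theorem re_I_mul_mul (b : ℝ) (lam : ℂ) : (Complex.I * b * lam).re = -(b * lam.im) := by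
  simp [mul_assoc]

theorem DiracSol.add_smul {v₁ v₂ z₁ z₂ : ℝ → ℂ} (h : DiracSol b₁ b₂ q₁ q₂ lam u₁ u₂ y₁ y₂)
    (h' : DiracSol b₁ b₂ q₁ q₂ lam v₁ v₂ z₁ z₂) (c : ℂ) :
    DiracSol b₁ b₂ q₁ q₂ lam (fun x => u₁ x + c * v₁ x) (fun x => u₂ x + c * v₂ x)
      (fun x => y₁ x + c * z₁ x) (fun x => y₂ x + c * z₂ x) where
  cont₁ := h.cont₁.add (continuousOn_const.mul h'.cont₁)
  cont₂ := h.cont₂.add (continuousOn_const.mul h'.cont₂)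
  deriv₁ x hx := ((h.deriv₁ x hx).add ((h'.deriv₁ x hx).const_mul c)).congr_deriv (by ring)
  deriv₂ x hx := ((h.deriv₂ x hx).add ((h'.deriv₂ x hx).const_mul c)).congr_deriv (by ring)

theorem continuousOn_comp_one_sub {f : ℝ → ℂ} (hf : ContinuousOn f (Icc 0 1)) :
    ContinuousOn (fun x => f (1 - x)) (Icc 0 1) :=
  hf.comp (by fun_prop) fun x hx => ⟨by linarith [hx.2], by linarith [hx.1]⟩

theorem hasDerivAt_comp_one_sub {f : ℝ → ℂ} {f' : ℂ} {x : ℝ} (hf : HasDerivAt f f' (1 - x)) :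
    HasDerivAt (fun x => f (1 - x)) (-f') x := by
  have := hf.scomp x ((hasDerivAt_id x).const_sub 1)
  rw [neg_one_smul] at this
  exact this

theorem DiracSol.reflect (h : DiracSol b₁ b₂ q₁ q₂ lam u₁ u₂ y₁ y₂) :
    DiracSol (-b₂) (-b₁) (fun x => q₂ (1 - x)) (fun x => q₁ (1 - x)) lam
      (fun x => u₂ (1 - x)) (fun x => u₁ (1 - x)) (fun x => y₂ (1 - x)) (fun x => y₁ (1 - x)) where
  cont₁ := continuousOn_comp_one_sub h.cont₂
  cont₂ := continuousOn_comp_one_sub h.cont₁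
  deriv₁ x hx := (hasDerivAt_comp_one_sub
    (h.deriv₂ (1 - x) ⟨by linarith [hx.2], by linarith [hx.1]⟩)).congr_deriv (by push_cast; ring)
  deriv₂ x hx := (hasDerivAt_comp_one_sub
    (h.deriv₁ (1 - x) ⟨by linarith [hx.2], by linarith [hx.1]⟩)).congr_deriv (by push_cast; ring)

theorem DiracSol.reverse (h : DiracSol b₁ b₂ q₁ q₂ lam u₁ u₂ y₁ y₂) :
    DiracSol b₁ b₂ (fun x => -q₁ (1 - x)) (fun x => -q₂ (1 - x)) (-lam)
      (fun x => -u₁ (1 - x)) (fun x => -u₂ (1 - x)) (fun x => y₁ (1 - x)) (fun x => y₂ (1 - x)) where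
  cont₁ := continuousOn_comp_one_sub h.cont₁
  cont₂ := continuousOn_comp_one_sub h.cont₂
  deriv₁ x hx := (hasDerivAt_comp_one_sub
    (h.deriv₁ (1 - x) ⟨by linarith [hx.2], by linarith [hx.1]⟩)).congr_deriv (by ring)
  deriv₂ x hx := (hasDerivAt_comp_one_sub
    (h.deriv₂ (1 - x) ⟨by linarith [hx.2], by linarith [hx.1]⟩)).congr_deriv (by ring)

/-- Resolvent estimate for the boundary conditions `y₁ 1 = y₂ 0 = 0` in the upper half-plane. -/
theorem DiracSol.norm_le_of_zero_data (hb₁ : b₁ < 0) (hb₂ : 0 < b₂) (hq₁ : ContinuousOn q₁ (Icc 0 1))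
    (hq₂ : ContinuousOn q₂ (Icc 0 1)) (hu₁ : ContinuousOn u₁ (Icc 0 1))
    (hu₂ : ContinuousOn u₂ (Icc 0 1)) {q₀ U τ : ℝ}
    (hq₁b : ∀ x ∈ Icc (0 : ℝ) 1, ‖q₁ x‖ ≤ q₀) (hq₂b : ∀ x ∈ Icc (0 : ℝ) 1, ‖q₂ x‖ ≤ q₀)
    (hu₁b : ∀ x ∈ Icc (0 : ℝ) 1, ‖u₁ x‖ ≤ U) (hu₂b : ∀ x ∈ Icc (0 : ℝ) 1, ‖u₂ x‖ ≤ U)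
    (hτ : 0 < τ) (hτq : 2 * q₀ ≤ τ) (hlam : lam.im = τ)
    (h : DiracSol b₁ b₂ q₁ q₂ lam u₁ u₂ y₁ y₂) (h1 : y₁ 1 = 0) (h2 : y₂ 0 = 0) :
    ∀ x ∈ Icc (0 : ℝ) 1, ‖y₁ x‖ ≤ 2 * U / τ ∧ ‖y₂ x‖ ≤ 2 * U / τ := by
  obtain ⟨x₀, hx₀, hmax⟩ := isCompact_Icc.exists_isMaxOn (nonempty_Icc.2 (zero_le_one' ℝ))
    (h.cont₁.norm.sup h.cont₂.norm)
  set M := max ‖y₁ x₀‖ ‖y₂ x₀‖ with hM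
  have hM1 : ∀ x ∈ Icc (0 : ℝ) 1, ‖y₁ x‖ ≤ M := fun x hx => (le_max_left _ _).trans (hmax hx)
  have hM2 : ∀ x ∈ Icc (0 : ℝ) 1, ‖y₂ x‖ ≤ M := fun x hx => (le_max_right _ _).trans (hmax hx)
  have hq0 : 0 ≤ q₀ := (norm_nonneg _).trans (hq₁b 0 (by simp))
  have hM0 : 0 ≤ M := (norm_nonneg _).trans (hM1 0 (by simp))
  have hbd : ∀ (b : ℝ) (u q y : ℝ → ℂ), (∀ x ∈ Icc (0 : ℝ) 1, ‖u x‖ ≤ U) →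
      (∀ x ∈ Icc (0 : ℝ) 1, ‖q x‖ ≤ q₀) → (∀ x ∈ Icc (0 : ℝ) 1, ‖y x‖ ≤ M) →
      ∀ s ∈ Icc (0 : ℝ) 1, ‖Complex.I * b * (u s - q s * y s)‖ ≤
        |b| * (U + q₀ * M) * Real.exp (-0 * s) := by
    intro b u q y hu hq hy s hs
    simp only [norm_mul, Complex.norm_I, one_mul, Complex.norm_real, Real.norm_eq_abs, neg_zero,
      zero_mul, Real.exp_zero, mul_one]
    gcongr
    refine (norm_sub_le _ _).trans ?_
    rw [norm_mul]
    gcongr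
    exacts [hu s hs, hq s hs, hy s hs]
  have e1 : ∀ x ∈ Icc (0 : ℝ) 1, ‖y₁ x‖ ≤ (U + q₀ * M) / τ := by
    intro x hx
    have hp : 0 < (Complex.I * b₁ * lam).re + 0 := by
      rw [re_I_mul_mul, hlam]
      nlinarith
    have := norm_le_backward h.cont₁ (continuousOn_const.mul (hu₁.sub (hq₁.mul h.cont₂)))
      h.linear₁ h1 (hbd b₁ u₁ q₁ y₂ hu₁b hq₁b hM2) hp hx
    refine this.trans (le_of_eq ?_)
    rw [re_I_mul_mul, hlam, abs_of_neg hb₁, neg_zero, zero_mul, Real.exp_zero]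
    have := hb₁.ne
    field_simp
    ring
  have e2 : ∀ x ∈ Icc (0 : ℝ) 1, ‖y₂ x‖ ≤ (U + q₀ * M) / τ := by
    intro x hx
    have hp : 0 < -(Complex.I * b₂ * lam).re - 0 := by
      rw [re_I_mul_mul, hlam]
      nlinarith
    have := norm_sub_le_forward h.cont₂ (continuousOn_const.mul (hu₂.sub (hq₂.mul h.cont₁)))
      h.linear₂ (hbd b₂ u₂ q₂ y₁ hu₂b hq₂b hM1) hp hx
    rw [h2, mul_zero, sub_zero] at this
    refine this.trans (le_of_eq ?_)
    rw [re_I_mul_mul, hlam, abs_of_pos hb₂, neg_zero, zero_mul, Real.exp_zero]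
    have := hb₂.ne'
    field_simp
    ring
  have hMle : M ≤ (U + q₀ * M) / τ := max_le (e1 x₀ hx₀) (e2 x₀ hx₀)
  have hMle2 : M ≤ 2 * U / τ := by
    rw [le_div_iff₀ hτ] at hMle ⊢
    nlinarith
  exact fun x hx => ⟨(hM1 x hx).trans hMle2, (hM2 x hx).trans hMle2⟩

/-- The solution of the homogeneous system with `y₁ 1 = 0` decays exponentially away from `0`. -/
theorem DiracSol.norm_le_exp (hb₁ : b₁ < 0) (hb₂ : 0 < b₂) (hq₁ : ContinuousOn q₁ (Icc 0 1))
    (hq₂ : ContinuousOn q₂ (Icc 0 1)) {q₀ τ : ℝ}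
    (hq₁b : ∀ x ∈ Icc (0 : ℝ) 1, ‖q₁ x‖ ≤ q₀) (hq₂b : ∀ x ∈ Icc (0 : ℝ) 1, ‖q₂ x‖ ≤ q₀)
    (hτ : 0 < τ) (hτq : 2 * b₂ * q₀ ^ 2 ≤ τ) (hlam : lam.im = τ)
    (h : DiracSol b₁ b₂ q₁ q₂ lam 0 0 y₁ y₂) (h1 : y₁ 1 = 0) :
    ∀ x ∈ Icc (0 : ℝ) 1, ‖y₂ x‖ ≤ 2 * ‖y₂ 0‖ * Real.exp (-(b₂ * τ) * x) ∧
      ‖y₁ x‖ ≤ q₀ / τ * (2 * ‖y₂ 0‖) * Real.exp (-(b₂ * τ) * x) := by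
  obtain ⟨x₀, hx₀, hmax⟩ := isCompact_Icc.exists_isMaxOn (nonempty_Icc.2 (zero_le_one' ℝ))
    (h.cont₂.norm.mul (by fun_prop : Continuous fun x => Real.exp (b₂ * τ * x)).continuousOn)
  set M := ‖y₂ x₀‖ * Real.exp (b₂ * τ * x₀) with hM
  have hM2 : ∀ x ∈ Icc (0 : ℝ) 1, ‖y₂ x‖ ≤ M * Real.exp (-(b₂ * τ) * x) := fun x hx => by
    have h3 : ‖y₂ x‖ * Real.exp (b₂ * τ * x) ≤ M := hmax hx
    rw [neg_mul, Real.exp_neg, ← div_eq_mul_inv, le_div_iff₀ (Real.exp_pos _)]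
    exact h3
  have hq0 : 0 ≤ q₀ := (norm_nonneg _).trans (hq₁b 0 (by simp))
  have hM0 : 0 ≤ M := by positivity
  have e1 : ∀ x ∈ Icc (0 : ℝ) 1, ‖y₁ x‖ ≤ q₀ / τ * M * Real.exp (-(b₂ * τ) * x) := by
    intro x hx
    have hp : 0 < (Complex.I * b₁ * lam).re + b₂ * τ := by
      rw [re_I_mul_mul, hlam]
      nlinarith [mul_pos hb₂ hτ]
    have hf : ∀ s ∈ Icc (0 : ℝ) 1, ‖Complex.I * b₁ * ((0 : ℝ → ℂ) s - q₁ s * y₂ s)‖ ≤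
        (-b₁ * q₀ * M) * Real.exp (-(b₂ * τ) * s) := by
      intro s hs
      simp only [norm_mul, Complex.norm_I, one_mul, Complex.norm_real, Real.norm_eq_abs,
        Pi.zero_apply, zero_sub, norm_neg, abs_of_neg hb₁]
      have h3 := neg_pos.2 hb₁
      calc -b₁ * (‖q₁ s‖ * ‖y₂ s‖) ≤ -b₁ * (q₀ * (M * Real.exp (-(b₂ * τ) * s))) := by
            gcongr
            exacts [hq₁b s hs, hM2 s hs]
        _ = _ := by ring
    have := norm_le_backward h.cont₁ (continuousOn_const.mul (continuousOn_const.sub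
      (hq₁.mul h.cont₂))) h.linear₁ h1 hf hp hx
    refine this.trans ?_
    gcongr
    rw [div_le_iff₀ hp, re_I_mul_mul, hlam]
    have h5 : 0 ≤ q₀ / τ * M := by positivity
    have h6 : q₀ / τ * M * (-(b₁ * τ)) = -b₁ * q₀ * M := by field_simp
    have : 0 ≤ q₀ / τ * M * (b₂ * τ) := by positivity
    nlinarith
  have hMle : M ≤ 2 * ‖y₂ 0‖ := by
    have hf : ∀ s ∈ Icc (0 : ℝ) 1, ‖Complex.I * b₂ * ((0 : ℝ → ℂ) s - q₂ s * y₁ s)‖ ≤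
        (b₂ * q₀ * (q₀ / τ * M)) * Real.exp ((Complex.I * b₂ * lam).re * s) := by
      intro s hs
      rw [re_I_mul_mul, hlam]
      simp only [norm_mul, Complex.norm_I, one_mul, Complex.norm_real, Real.norm_eq_abs,
        Pi.zero_apply, zero_sub, norm_neg, abs_of_pos hb₂]
      calc b₂ * (‖q₂ s‖ * ‖y₁ s‖) ≤ b₂ * (q₀ * (q₀ / τ * M * Real.exp (-(b₂ * τ) * s))) := by
            gcongr
            exacts [hq₂b s hs, e1 s hs]
        _ = _ := by ring
    have := norm_le_forward_critical h.cont₂ (continuousOn_const.mul (continuousOn_const.sub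
      (hq₂.mul h.cont₁))) h.linear₂ hf hx₀
    rw [re_I_mul_mul, hlam] at this
    have h7 : M ≤ ‖y₂ 0‖ + b₂ * q₀ * (q₀ / τ * M) := by
      calc M ≤ (‖y₂ 0‖ + b₂ * q₀ * (q₀ / τ * M)) * Real.exp (-(b₂ * τ) * x₀)
            * Real.exp (b₂ * τ * x₀) := by
            rw [hM]
            gcongr
        _ = _ := by rw [mul_assoc, ← Real.exp_add]; simp
    have h8 : b₂ * q₀ * (q₀ / τ * M) ≤ M / 2 := by
      have : b₂ * q₀ * (q₀ / τ * M) = (2 * b₂ * q₀ ^ 2) * (M / (2 * τ)) := by field_simp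
      rw [this]
      calc _ ≤ τ * (M / (2 * τ)) := by gcongr
        _ = M / 2 := by field_simp
    linarith
  intro x hx
  refine ⟨(hM2 x hx).trans (by gcongr), (e1 x hx).trans (by gcongr)⟩

end Estimates

section Asymptotics

variable {b₁ b₂ : ℝ} {q₁ q₂ : ℝ → ℂ} {lam : ℂ} {y₁ y₂ : ℝ → ℂ}

theorem pow_le_const_mul_exp {ε τ s : ℝ} (hε : 0 < ε) (hτ : 0 < τ) (hs : 0 ≤ s) (m : ℕ) :
    s ^ m ≤ m.factorial / ε ^ m / τ ^ m * Real.exp (ε * τ * s) := by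
  have h := Real.pow_div_factorial_le_exp (ε * τ * s) (by positivity) m
  rw [div_le_iff₀ (by positivity), mul_pow, mul_pow] at h
  rw [div_div, div_mul_eq_mul_div, le_div_iff₀ (by positivity)]
  linarith

/-- Asymptotics of the decaying solution of the homogeneous system, when the potential `q₁` vanishes
to order `m` at `0`. -/
theorem DiracSol.asymptotics (hb₁ : b₁ < 0) (hb₂ : 0 < b₂) (hq₁ : ContinuousOn q₁ (Icc 0 1))
    (hq₂ : ContinuousOn q₂ (Icc 0 1)) {q₀ K E τ : ℝ}
    (hq₁b : ∀ x ∈ Icc (0 : ℝ) 1, ‖q₁ x‖ ≤ q₀) (hq₂b : ∀ x ∈ Icc (0 : ℝ) 1, ‖q₂ x‖ ≤ q₀) {m : ℕ}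
    (hK : ∀ x ∈ Icc (0 : ℝ) 1, ‖q₁ x‖ ≤ K * x ^ m) (hE : E = m.factorial / (b₂ / 4) ^ m)
    (hτ : 0 < τ) (hτq : 2 * b₂ * q₀ ^ 2 ≤ τ) (hlam : lam.im = τ)
    (h : DiracSol b₁ b₂ q₁ q₂ lam 0 0 y₁ y₂) (h1 : y₁ 1 = 0) (h2 : y₂ 0 = 1) :
    ‖y₁ 0‖ ≤ 2 * K * E / τ ^ (m + 1) ∧
    ‖y₁ 0 - Complex.I * b₁ * ∫ s in (0 : ℝ)..1, Complex.exp (Complex.I * (b₂ - b₁) * lam * s) * q₁ s‖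
      ≤ 8 * q₀ * K ^ 2 * E ^ 2 / τ ^ (2 * m + 3) := by
  have hq0 : 0 ≤ q₀ := (norm_nonneg _).trans (hq₁b 0 (by simp))
  have hK0 : 0 ≤ K := by simpa using (norm_nonneg _).trans (hK 1 (by simp))
  have hb₁' := neg_pos.2 hb₁
  have hE0 : 0 ≤ E := by rw [hE]; positivity
  have hpow : ∀ s ∈ Icc (0 : ℝ) 1, ‖q₁ s‖ ≤ K * (E / τ ^ m * Real.exp (b₂ / 4 * τ * s)) := by
    intro s hs
    refine (hK s hs).trans ?_
    rw [hE]
    gcongr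
    exact pow_le_const_mul_exp (by positivity) hτ hs.1 m
  have hbase := h.norm_le_exp hb₁ hb₂ hq₁ hq₂ hq₁b hq₂b hτ hτq hlam h1
  have e1 : ∀ x ∈ Icc (0 : ℝ) 1,
      ‖y₁ x‖ ≤ 2 * K * E / τ ^ (m + 1) * Real.exp (-(b₂ * 3 / 4 * τ) * x) := by
    intro x hx
    have hf : ∀ s ∈ Icc (0 : ℝ) 1, ‖Complex.I * b₁ * ((0 : ℝ → ℂ) s - q₁ s * y₂ s)‖ ≤
        (-b₁ * (2 * K * E / τ ^ m)) * Real.exp (-(b₂ * 3 / 4 * τ) * s) := by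
      intro s hs
      simp only [norm_mul, Complex.norm_I, one_mul, Complex.norm_real, Real.norm_eq_abs,
        Pi.zero_apply, zero_sub, norm_neg, abs_of_neg hb₁]
      have h5 := (hbase s hs).1
      rw [h2, norm_one] at h5
      calc -b₁ * (‖q₁ s‖ * ‖y₂ s‖) ≤ -b₁ * (K * (E / τ ^ m * Real.exp (b₂ / 4 * τ * s)) *
              (2 * 1 * Real.exp (-(b₂ * τ) * s))) := by
            gcongr
            exact hpow s hs
        _ = -b₁ * (2 * K * E / τ ^ m) *
              (Real.exp (b₂ / 4 * τ * s) * Real.exp (-(b₂ * τ) * s)) := by ring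
        _ = _ := by rw [← Real.exp_add]; ring_nf
    have hp : 0 < (Complex.I * b₁ * lam).re + b₂ * 3 / 4 * τ := by
      rw [re_I_mul_mul, hlam]
      nlinarith [mul_pos hb₂ hτ]
    have := norm_le_backward h.cont₁ (continuousOn_const.mul (continuousOn_const.sub
      (hq₁.mul h.cont₂))) h.linear₁ h1 hf hp hx
    refine this.trans (mul_le_mul_of_nonneg_right ?_ (Real.exp_pos _).le)
    rw [div_le_iff₀ hp, re_I_mul_mul, hlam]
    have h6 : 2 * K * E / τ ^ (m + 1) * (-(b₁ * τ)) = -b₁ * (2 * K * E / τ ^ m) := by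
      field_simp
      ring
    have : 0 ≤ 2 * K * E / τ ^ (m + 1) * (b₂ * 3 / 4 * τ) := by positivity
    nlinarith
  refine ⟨by simpa using e1 0 (by simp), ?_⟩
  have e2 : ∀ x ∈ Icc (0 : ℝ) 1, ‖y₂ x - Complex.exp (Complex.I * b₂ * lam * x)‖ ≤
      8 * q₀ * K * E / τ ^ (m + 2) * Real.exp (-(b₂ * 3 / 4 * τ) * x) := by
    intro x hx
    have hf : ∀ s ∈ Icc (0 : ℝ) 1, ‖Complex.I * b₂ * ((0 : ℝ → ℂ) s - q₂ s * y₁ s)‖ ≤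
        (b₂ * (q₀ * (2 * K * E / τ ^ (m + 1)))) * Real.exp (-(b₂ * 3 / 4 * τ) * s) := by
      intro s hs
      simp only [norm_mul, Complex.norm_I, one_mul, Complex.norm_real, Real.norm_eq_abs,
        Pi.zero_apply, zero_sub, norm_neg, abs_of_pos hb₂]
      calc b₂ * (‖q₂ s‖ * ‖y₁ s‖) ≤ b₂ * (q₀ * (2 * K * E / τ ^ (m + 1) *
            Real.exp (-(b₂ * 3 / 4 * τ) * s))) := by
            gcongr
            exacts [hq₂b s hs, e1 s hs]
        _ = _ := by ring
    have hp : 0 < -(Complex.I * b₂ * lam).re - b₂ * 3 / 4 * τ := by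
      rw [re_I_mul_mul, hlam]
      nlinarith [mul_pos hb₂ hτ]
    have := norm_sub_le_forward h.cont₂ (continuousOn_const.mul (continuousOn_const.sub
      (hq₂.mul h.cont₁))) h.linear₂ hf hp hx
    rw [h2, mul_one] at this
    refine this.trans (le_of_eq ?_)
    congr 1
    rw [re_I_mul_mul, hlam]
    have : -(-(b₂ * τ)) - b₂ * 3 / 4 * τ = b₂ * τ / 4 := by ring
    rw [this]
    field_simp
    ring
  have hduh := duhamel h.cont₁ (continuousOn_const.mul (continuousOn_const.sub
      (hq₁.mul h.cont₂))) h.linear₁ (x₀ := 1) (x := 0) (by simp) (by simp)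
  simp only [Pi.mul_apply, Pi.sub_apply] at hduh
  have hmain : y₁ 0 - Complex.I * b₁ *
      ∫ s in (0 : ℝ)..1, Complex.exp (Complex.I * (b₂ - b₁) * lam * s) * q₁ s =
      ∫ s in (0 : ℝ)..1, Complex.I * b₁ * (Complex.exp (-(Complex.I * b₁ * lam * s)) * q₁ s *
        (y₂ s - Complex.exp (Complex.I * b₂ * lam * s))) := by
    rw [hduh, h1, mul_zero, zero_add, intervalIntegral.integral_symm,
      ← intervalIntegral.integral_const_mul, ← intervalIntegral.integral_neg,
      ← intervalIntegral.integral_sub]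
    · refine intervalIntegral.integral_congr fun s _ => ?_
      have : Complex.exp (Complex.I * (b₂ - b₁) * lam * s) =
          Complex.exp (-(Complex.I * b₁ * lam * s)) * Complex.exp (Complex.I * b₂ * lam * s) := by
        rw [← Complex.exp_add]; ring_nf
      have h0 : (⟨0, 0⟩ : ℂ) = 0 := rfl
      simp only [this, h0, Complex.ofReal_zero, zero_sub, mul_neg]
      ring
    · apply ContinuousOn.intervalIntegrable
      rw [uIcc_of_le zero_le_one]
      exact ((by fun_prop : Continuous fun s : ℝ => Complex.exp (Complex.I * b₁ * lam *
        (((0 : ℝ) : ℂ) - s))).continuousOn.mul (continuousOn_const.mul (continuousOn_const.sub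
        (hq₁.mul h.cont₂)))).neg
    · apply ContinuousOn.intervalIntegrable
      rw [uIcc_of_le zero_le_one]
      exact continuousOn_const.mul ((by fun_prop : Continuous fun s : ℝ =>
        Complex.exp (Complex.I * (b₂ - b₁) * lam * s)).continuousOn.mul hq₁)
  rw [hmain]
  have hb : ∀ s ∈ Ioc (0 : ℝ) 1, ‖Complex.I * b₁ * (Complex.exp (-(Complex.I * b₁ * lam * s)) * q₁ s *
        (y₂ s - Complex.exp (Complex.I * b₂ * lam * s)))‖ ≤
      -b₁ * (8 * q₀ * K ^ 2 * E ^ 2 / τ ^ (2 * m + 2)) *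
        Real.exp (0 - (-b₁ + b₂ / 2) * τ * s) := by
    intro s hs
    have hs' : s ∈ Icc (0 : ℝ) 1 := ⟨hs.1.le, hs.2⟩
    have h7 : (-(Complex.I * b₁ * lam * s)).re = b₁ * τ * s := by
      rw [Complex.neg_re, Complex.re_mul_ofReal, re_I_mul_mul, hlam]; ring
    simp only [norm_mul, Complex.norm_I, one_mul, Complex.norm_real, Real.norm_eq_abs,
      abs_of_neg hb₁, Complex.norm_exp, h7]
    calc _ ≤ -b₁ * (Real.exp (b₁ * τ * s) * (K * (E / τ ^ m * Real.exp (b₂ / 4 * τ * s))) *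
          (8 * q₀ * K * E / τ ^ (m + 2) * Real.exp (-(b₂ * 3 / 4 * τ) * s))) := by
          gcongr
          exacts [hpow s hs', e2 s hs']
      _ = -b₁ * (8 * q₀ * K ^ 2 * E ^ 2 / (τ ^ m * τ ^ (m + 2))) *
          (Real.exp (b₁ * τ * s) * Real.exp (b₂ / 4 * τ * s) *
            Real.exp (-(b₂ * 3 / 4 * τ) * s)) := by
          rw [div_mul_eq_div_div]; ring
      _ = _ := by
          rw [← Real.exp_add, ← Real.exp_add, ← pow_add]
          ring_nf
  refine (intervalIntegral.norm_integral_le_of_norm_le zero_le_one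
    (ae_of_all _ fun s hs => hb s hs) (Continuous.intervalIntegrable (by fun_prop) _ _)).trans ?_
  rw [intervalIntegral.integral_const_mul]
  have hd : 0 < (-b₁ + b₂ / 2) * τ := by positivity
  have h8 : (1 : ℝ) / ((-b₁ + b₂ / 2) * τ) ≤ 1 / (-b₁ * τ) := by
    apply one_div_le_one_div_of_le (by positivity)
    gcongr
    linarith
  have h9 := integral_exp_linear_le' (c := 0) (x₀ := 0) (x := 1) hd
  rw [mul_zero, sub_zero, Real.exp_zero] at h9
  calc _ ≤ -b₁ * (8 * q₀ * K ^ 2 * E ^ 2 / τ ^ (2 * m + 2)) * (1 / (-b₁ * τ)) := by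
        gcongr
        exact h9.trans h8
    _ = _ := by
        have := hb₁.ne
        field_simp
        ring

end Asymptotics

theorem integrableOn_pow_mul_exp_neg {c : ℝ} (hc : 0 < c) (k : ℕ) :
    IntegrableOn (fun s : ℝ => s ^ k * Real.exp (-c * s)) (Ioi 0) := by
  have := integrableOn_rpow_mul_exp_neg_mul_rpow (s := k) (p := 1) (b := c)
    (by linarith [(Nat.cast_nonneg k : (0 : ℝ) ≤ k)]) one_pos hc
  simpa using this

theorem integrableOn_pow_mul_cexp_neg {w : ℂ} (hw : 0 < w.re) (k : ℕ) :
    IntegrableOn (fun s : ℝ => (s : ℂ) ^ k * Complex.exp (-w * s)) (Ioi 0) := by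
  refine Integrable.mono' (integrableOn_pow_mul_exp_neg hw k)
    (by fun_prop : Continuous fun s : ℝ => (s : ℂ) ^ k * Complex.exp (-w * s)).aestronglyMeasurable ?_
  refine (ae_restrict_iff' measurableSet_Ioi).2 (ae_of_all _ fun s hs => le_of_eq ?_)
  simp [Complex.norm_exp, abs_of_pos (mem_Ioi.1 hs)]

theorem tendsto_pow_mul_cexp_neg {w : ℂ} (hw : 0 < w.re) (k : ℕ) :
    Tendsto (fun s : ℝ => (s : ℂ) ^ k * Complex.exp (-w * s)) atTop (𝓝 0) := by
  rw [tendsto_zero_iff_norm_tendsto_zero]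
  refine (tendsto_rpow_mul_exp_neg_mul_atTop_nhds_zero k w.re hw).congr' ?_
  filter_upwards [eventually_gt_atTop 0] with s hs
  simp [Complex.norm_exp, abs_of_pos hs]

theorem hasDerivAt_cexp_neg_mul (w : ℂ) (s : ℝ) :
    HasDerivAt (fun s : ℝ => Complex.exp (-w * s)) (-w * Complex.exp (-w * s)) s := by
  have h1 : HasDerivAt (fun s : ℝ => -w * (s : ℂ)) (-w) s := by
    have := ((hasDerivAt_id s).ofReal_comp).const_mul (-w)
    rw [Complex.ofReal_one, mul_one] at this
    exact this
  exact h1.cexp.congr_deriv (mul_comm _ _)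

theorem integral_pow_mul_cexp_neg {w : ℂ} (hw : 0 < w.re) (k : ℕ) :
    ∫ s in Ioi (0 : ℝ), (s : ℂ) ^ k * Complex.exp (-w * s) = k.factorial / w ^ (k + 1) := by
  have hw0 : w ≠ 0 := fun h => by simp [h] at hw
  induction k with
  | zero =>
    have hint := (integrableOn_pow_mul_cexp_neg hw 0).const_mul (-w)
    simp only [pow_zero, one_mul] at hint ⊢
    have h := integral_Ioi_of_hasDerivAt_of_tendsto (a := 0) (m := 0)
      (hasDerivAt_cexp_neg_mul w 0).continuousAt.continuousWithinAt
      (fun s _ => hasDerivAt_cexp_neg_mul w s) hint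
      (by simpa using tendsto_pow_mul_cexp_neg hw 0)
    rw [integral_const_mul] at h
    simp only [Complex.ofReal_zero, mul_zero, Complex.exp_zero] at h
    simp only [zero_add, pow_one, Nat.factorial_zero, Nat.cast_one]
    rw [eq_div_iff hw0]
    linear_combination -h
  | succ k ih =>
    have hder : ∀ s : ℝ, HasDerivAt (fun s : ℝ => (s : ℂ) ^ (k + 1) * Complex.exp (-w * s))
        (((k : ℂ) + 1) * ((s : ℂ) ^ k * Complex.exp (-w * s)) +
          -w * ((s : ℂ) ^ (k + 1) * Complex.exp (-w * s))) s := by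
      intro s
      have h1 : HasDerivAt (fun s : ℝ => (s : ℂ) ^ (k + 1)) ((k + 1) * (s : ℂ) ^ k) s := by
        have := ((hasDerivAt_id s).ofReal_comp).pow (k + 1)
        simp only [Nat.add_sub_cancel, Complex.ofReal_one, mul_one, Nat.cast_add, Nat.cast_one] at this
        exact this
      exact (h1.mul (hasDerivAt_cexp_neg_mul w s)).congr_deriv (by ring)
    have h := integral_Ioi_of_hasDerivAt_of_tendsto (a := 0) (m := 0)
      (hder 0).continuousAt.continuousWithinAt (fun s _ => hder s)
      (((integrableOn_pow_mul_cexp_neg hw k).const_mul _).add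
        ((integrableOn_pow_mul_cexp_neg hw (k + 1)).const_mul _))
      (tendsto_pow_mul_cexp_neg hw (k + 1))
    rw [integral_add ((integrableOn_pow_mul_cexp_neg hw k).const_mul _)
      ((integrableOn_pow_mul_cexp_neg hw (k + 1)).const_mul _), integral_const_mul,
      integral_const_mul, ih] at h
    simp only [Complex.ofReal_zero, zero_pow (Nat.succ_ne_zero k), zero_mul, sub_zero] at h
    have h2 : w * ∫ s in Ioi (0 : ℝ), (s : ℂ) ^ (k + 1) * Complex.exp (-w * s) =
        w * (((k + 1).factorial : ℂ) / w ^ (k + 1 + 1)) := by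
      rw [Nat.factorial_succ]
      push_cast
      have h3 : w * (((k : ℂ) + 1) * (k.factorial : ℂ) / w ^ (k + 1 + 1)) =
          ((k : ℂ) + 1) * ((k.factorial : ℂ) / w ^ (k + 1)) := by
        field_simp
        ring
      rw [h3]
      linear_combination -h
    exact mul_left_cancel₀ hw0 h2

/-- Watson's lemma. -/
theorem tendsto_laplace {P : ℝ → ℂ} {K : ℝ} {k : ℕ} {p w : ℂ} (hP : ContinuousOn P (Icc 0 1))
    (hK : ∀ t ∈ Icc (0 : ℝ) 1, ‖P t‖ ≤ K * t ^ k)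
    (hlim : Tendsto (fun t : ℝ => P t / (t : ℂ) ^ k) (𝓝[>] 0) (𝓝 p)) (hw : 0 < w.re) :
    Tendsto (fun τ : ℝ => (τ : ℂ) ^ (k + 1) * ∫ t in (0 : ℝ)..1, Complex.exp (-w * τ * t) * P t) atTop
      (𝓝 (p * (k.factorial / w ^ (k + 1)))) := by
  have heq : ∀ τ : ℝ, 0 < τ →
      (τ : ℂ) ^ (k + 1) * ∫ t in (0 : ℝ)..1, Complex.exp (-w * τ * t) * P t =
      ∫ s in Ioi (0 : ℝ), (Ioc 0 τ).indicator
        (fun s : ℝ => (τ : ℂ) ^ k * (Complex.exp (-w * s) * P (τ⁻¹ * s))) s := by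
    intro τ hτ
    have h1 := intervalIntegral.smul_integral_comp_mul_left (a := 0) (b := 1)
      (fun s : ℝ => Complex.exp (-w * s) * P (τ⁻¹ * s)) τ
    rw [mul_zero, mul_one, intervalIntegral.integral_of_le hτ.le] at h1
    rw [setIntegral_indicator measurableSet_Ioc, integral_const_mul,
      inter_eq_right.2 Ioc_subset_Ioi_self, ← h1, Complex.real_smul, ← mul_assoc, ← pow_succ]
    congr 1
    refine intervalIntegral.integral_congr fun t _ => ?_
    simp only [Complex.ofReal_mul, mul_assoc, inv_mul_cancel_left₀ hτ.ne']
  rw [← integral_pow_mul_cexp_neg hw, ← integral_const_mul]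
  refine Tendsto.congr' (f₁ := fun τ => ∫ s in Ioi (0 : ℝ), (Ioc 0 τ).indicator
        (fun s : ℝ => (τ : ℂ) ^ k * (Complex.exp (-w * s) * P (τ⁻¹ * s))) s)
    ((eventually_gt_atTop 0).mono fun τ hτ => (heq τ hτ).symm) ?_
  refine tendsto_integral_filter_of_dominated_convergence
    (fun s => K * (s ^ k * Real.exp (-w.re * s))) ?_ ?_
    ((integrableOn_pow_mul_exp_neg hw k).const_mul K) ?_
  · filter_upwards [eventually_gt_atTop 0] with τ hτ
    refine AEStronglyMeasurable.restrict ?_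
    rw [aestronglyMeasurable_indicator_iff measurableSet_Ioc]
    refine ContinuousOn.aestronglyMeasurable ?_ measurableSet_Ioc
    refine continuousOn_const.mul (ContinuousOn.mul (by fun_prop) (hP.comp (by fun_prop) ?_))
    intro s hs
    refine ⟨mul_nonneg (by positivity) hs.1.le, ?_⟩
    rw [inv_mul_le_iff₀ hτ, mul_one]
    exact hs.2
  · filter_upwards [eventually_gt_atTop 0] with τ hτ
    refine (ae_restrict_iff' measurableSet_Ioi).2 (ae_of_all _ fun s hs => ?_)
    have hs0 : (0 : ℝ) < s := hs
    have hK0 : 0 ≤ K := by simpa using (norm_nonneg _).trans (hK 1 (by simp))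
    by_cases hsτ : s ∈ Ioc 0 τ
    · rw [indicator_of_mem hsτ]
      have h2 := hK (τ⁻¹ * s) ⟨by positivity, by
        rw [inv_mul_le_iff₀ hτ, mul_one]
        exact hsτ.2⟩
      simp only [norm_mul, norm_pow, Complex.norm_real, Real.norm_of_nonneg hτ.le, Complex.norm_exp,
        Complex.re_mul_ofReal, Complex.neg_re]
      calc _ ≤ τ ^ k * (Real.exp (-w.re * s) * (K * (τ⁻¹ * s) ^ k)) := by gcongr
        _ = _ := by
          rw [mul_pow, inv_pow]
          field_simp
    · rw [indicator_of_notMem hsτ, norm_zero]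
      positivity
  · refine (ae_restrict_iff' measurableSet_Ioi).2 (ae_of_all _ fun s hs => ?_)
    have hs0 : (0 : ℝ) < s := hs
    have h3 : Tendsto (fun τ : ℝ => τ⁻¹ * s) atTop (𝓝[>] 0) := by
      refine tendsto_nhdsWithin_iff.2 ⟨?_, ?_⟩
      · simpa using tendsto_inv_atTop_zero.mul_const s
      · filter_upwards [eventually_gt_atTop 0] with τ hτ
        exact mul_pos (by positivity) hs0
    have h4 := ((hlim.comp h3).mul_const ((s : ℂ) ^ k * Complex.exp (-w * s)))
    refine h4.congr' ?_
    filter_upwards [eventually_ge_atTop s, eventually_gt_atTop 0] with τ hτ hτ0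
    have hs1 : (s : ℂ) ≠ 0 := by exact_mod_cast hs0.ne'
    have hτ1 : (τ : ℂ) ≠ 0 := by exact_mod_cast hτ0.ne'
    rw [indicator_of_mem (show s ∈ Ioc 0 τ from ⟨hs0, hτ⟩)]
    simp only [Function.comp]
    push_cast
    rw [mul_pow, inv_pow]
    field_simp

/-- Continuous `ℂ²`-valued functions on `[0,1]`. -/
abbrev Curve : Type := C(Icc (0 : ℝ) 1, ℂ × ℂ)

/-- The extension of a function on `[0,1]` to the real line, constant outside `[0,1]`. -/
abbrev ext01 {α : Type*} (f : Icc (0 : ℝ) 1 → α) : ℝ → α := IccExtend zero_le_one f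

theorem continuous_ext01 {α : Type*} [TopologicalSpace α] (f : C(Icc (0 : ℝ) 1, α)) :
    Continuous (ext01 f) :=
  f.continuous.Icc_extend'

/-- The primitive vanishing at `0`. -/
def primitive : Curve →L[ℂ] Curve :=
  LinearMap.mkContinuous
    { toFun := fun f => ⟨fun x => ∫ t in (0 : ℝ)..x, ext01 f t,
        (intervalIntegral.continuous_primitive
          (fun a b => (continuous_ext01 f).intervalIntegrable a b) 0).comp continuous_subtype_val⟩
      map_add' := fun f g => by
        ext1 x
        exact intervalIntegral.integral_add ((continuous_ext01 f).intervalIntegrable _ _)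
          ((continuous_ext01 g).intervalIntegrable _ _)
      map_smul' := fun c f => by
        ext1 x
        exact intervalIntegral.integral_smul c (ext01 f) }
    1 (fun f => by
      rw [one_mul, ContinuousMap.norm_le _ (norm_nonneg _)]
      intro x
      refine (intervalIntegral.norm_integral_le_of_norm_le_const (C := ‖f‖) fun t _ =>
        f.norm_coe_le_norm _).trans ?_
      rw [sub_zero, abs_of_nonneg x.2.1]
      exact mul_le_of_le_one_right (norm_nonneg _) x.2.2)

theorem primitive_apply (f : Curve) (x : Icc (0 : ℝ) 1) :
    primitive f x = ∫ t in (0 : ℝ)..x, ext01 f t := rfl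

/-- Pointwise multiplication by a continuous matrix function. -/
def mulOp (M : C(Icc (0 : ℝ) 1, (ℂ × ℂ) →L[ℂ] (ℂ × ℂ))) : Curve →L[ℂ] Curve :=
  LinearMap.mkContinuous
    { toFun := fun f => ⟨fun x => M x (f x), by fun_prop⟩
      map_add' := fun f g => by
        ext1 x
        exact map_add (M x) (f x) (g x)
      map_smul' := fun c f => by
        ext1 x
        exact map_smul (M x) c (f x) }
    ‖M‖ (fun f => by
      rw [ContinuousMap.norm_le _ (by positivity)]
      exact fun x => (ContinuousLinearMap.le_opNorm _ _).trans
        (mul_le_mul (M.norm_coe_le_norm x) (f.norm_coe_le_norm x) (norm_nonneg (f x)) (norm_nonneg M)))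

theorem mulOp_apply (M : C(Icc (0 : ℝ) 1, (ℂ × ℂ) →L[ℂ] (ℂ × ℂ))) (f : Curve) (x : Icc (0 : ℝ) 1) :
    mulOp M f x = M x (f x) := rfl

theorem norm_volterra_pow_apply_le (M : C(Icc (0 : ℝ) 1, (ℂ × ℂ) →L[ℂ] (ℂ × ℂ))) (f : Curve) (n : ℕ) :
    ∀ x : Icc (0 : ℝ) 1, ‖((primitive ∘L mulOp M) ^ n) f x‖ ≤
      (‖M‖ ^ n / n.factorial * ‖f‖) * (x : ℝ) ^ n := by
  induction n with
  | zero => intro x; simpa using f.norm_coe_le_norm x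
  | succ n ih =>
    intro x
    rw [pow_succ']
    change ‖∫ t in (0 : ℝ)..x, ext01 (mulOp M (((primitive ∘L mulOp M) ^ n) f)) t‖ ≤ _
    have h1 : ∀ t ∈ Ioc (0 : ℝ) x, ‖ext01 (mulOp M (((primitive ∘L mulOp M) ^ n) f)) t‖ ≤
        ‖M‖ * ((‖M‖ ^ n / n.factorial * ‖f‖) * t ^ n) := by
      intro t ht
      have ht1 : t ∈ Icc (0 : ℝ) 1 := ⟨ht.1.le, ht.2.trans x.2.2⟩
      rw [ext01, IccExtend_of_mem _ _ ht1, mulOp_apply]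
      refine (ContinuousLinearMap.le_opNorm _ _).trans ?_
      exact mul_le_mul (M.norm_coe_le_norm _) (ih ⟨t, ht1⟩) (norm_nonneg _) (norm_nonneg M)
    refine (intervalIntegral.norm_integral_le_of_norm_le x.2.1 (ae_of_all _ h1)
      (Continuous.intervalIntegrable (by fun_prop) _ _)).trans (le_of_eq ?_)
    rw [intervalIntegral.integral_const_mul, intervalIntegral.integral_const_mul, integral_pow,
      Nat.factorial_succ]
    push_cast
    simp only [ne_eq, Nat.succ_ne_zero, not_false_eq_true, zero_pow, sub_zero]
    field_simp
    ring

theorem norm_volterra_pow_le (M : C(Icc (0 : ℝ) 1, (ℂ × ℂ) →L[ℂ] (ℂ × ℂ))) (n : ℕ) :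
    ‖(primitive ∘L mulOp M) ^ n‖ ≤ ‖M‖ ^ n / n.factorial := by
  refine ContinuousLinearMap.opNorm_le_bound _ (by positivity) fun f => ?_
  rw [ContinuousMap.norm_le _ (by positivity)]
  refine fun x => (norm_volterra_pow_apply_le M f n x).trans ?_
  exact mul_le_of_le_one_right (by positivity) (pow_le_one₀ x.2.1 x.2.2)

theorem summable_norm_of_pow_bound {A : Type*} [NormedRing A] {x : A} {K : ℝ}
    (h : ∀ n : ℕ, ‖x ^ n‖ ≤ K ^ n / n.factorial) : Summable fun n => ‖x ^ n‖ :=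
  Summable.of_nonneg_of_le (fun _ => norm_nonneg _) h (Real.summable_pow_div_factorial _)

theorem isUnit_one_sub_of_norm_pow_le {A : Type*} [NormedRing A] [CompleteSpace A] {x : A} {K : ℝ}
    (h : ∀ n : ℕ, ‖x ^ n‖ ≤ K ^ n / n.factorial) :
    IsUnit (1 - x) ∧ ‖Ring.inverse (1 - x)‖ ≤ Real.exp K := by
  have hs := summable_norm_of_pow_bound h
  let u : Aˣ := ⟨1 - x, ∑' n, x ^ n, hs.of_norm.one_sub_mul_tsum_pow, hs.of_norm.tsum_pow_mul_one_sub⟩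
  refine ⟨⟨u, rfl⟩, ?_⟩
  change ‖Ring.inverse (u : A)‖ ≤ _
  rw [Ring.inverse_unit]
  refine (norm_tsum_le_tsum_norm hs).trans ?_
  rw [Real.exp_eq_exp_ℝ, NormedSpace.exp_eq_tsum_div]
  exact hs.tsum_le_tsum h (Real.summable_pow_div_factorial _)

theorem differentiable_inverse_one_sub_affine {A : Type*} [NormedRing A] [NormedAlgebra ℂ A]
    [CompleteSpace A] {p r : A} (h : ∀ z : ℂ, IsUnit (1 - (p + z • r))) :
    Differentiable ℂ fun z : ℂ => Ring.inverse (1 - (p + z • r)) := by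
  intro z
  have h1 : DifferentiableAt ℂ (fun z : ℂ => 1 - (p + z • r)) z := by fun_prop
  exact (differentiableAt_inverse (𝕜 := ℂ) (h z)).comp z h1

section Dirac

variable (b₁ b₂ : ℝ) (q₁ q₂ : C(Icc (0 : ℝ) 1, ℂ))

/-- The matrix of the spectral parameter in the first-order system. -/
def leadMatrix : C(Icc (0 : ℝ) 1, (ℂ × ℂ) →L[ℂ] (ℂ × ℂ)) :=
  ContinuousMap.const _
    ((Complex.I * b₁) • (ContinuousLinearMap.inl ℂ ℂ ℂ ∘L ContinuousLinearMap.fst ℂ ℂ ℂ) +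
      (Complex.I * b₂) • (ContinuousLinearMap.inr ℂ ℂ ℂ ∘L ContinuousLinearMap.snd ℂ ℂ ℂ))

/-- The matrix of the potential in the first-order system. -/
def potMatrix : C(Icc (0 : ℝ) 1, (ℂ × ℂ) →L[ℂ] (ℂ × ℂ)) :=
  ⟨fun x => (-(Complex.I * b₁ * q₁ x)) •
      (ContinuousLinearMap.inl ℂ ℂ ℂ ∘L ContinuousLinearMap.snd ℂ ℂ ℂ) +
      (-(Complex.I * b₂ * q₂ x)) •
        (ContinuousLinearMap.inr ℂ ℂ ℂ ∘L ContinuousLinearMap.fst ℂ ℂ ℂ), by fun_prop⟩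

/-- The operator multiplying by `i B`. -/
def leadOp : Curve →L[ℂ] Curve := mulOp (leadMatrix b₁ b₂)

/-- The operator multiplying by `-i B Q`. -/
def potOp : Curve →L[ℂ] Curve := mulOp (potMatrix b₁ b₂ q₁ q₂)

theorem leadOp_apply (f : Curve) (x : Icc (0 : ℝ) 1) :
    leadOp b₁ b₂ f x = (Complex.I * b₁ * (f x).1, Complex.I * b₂ * (f x).2) := by
  simp [leadOp, mulOp_apply, leadMatrix]

theorem potOp_apply (f : Curve) (x : Icc (0 : ℝ) 1) :
    potOp b₁ b₂ q₁ q₂ f x =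
      (-(Complex.I * b₁ * q₁ x) * (f x).2, -(Complex.I * b₂ * q₂ x) * (f x).1) := by
  simp [potOp, mulOp_apply, potMatrix]

/-- The Volterra operator of the first-order system. -/
def diracVolterra (lam : ℂ) : Curve →L[ℂ] Curve :=
  primitive ∘L potOp b₁ b₂ q₁ q₂ + lam • (primitive ∘L leadOp b₁ b₂)

theorem diracVolterra_eq (lam : ℂ) : diracVolterra b₁ b₂ q₁ q₂ lam =
    primitive ∘L mulOp (potMatrix b₁ b₂ q₁ q₂ + lam • leadMatrix b₁ b₂) := by
  ext1 f
  change primitive _ + lam • primitive _ = primitive _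
  rw [← map_smul, ← map_add]
  congr 1

/-- The solution operator `(1 - V)⁻¹`. -/
def diracResolvent (lam : ℂ) : Curve →L[ℂ] Curve :=
  Ring.inverse (1 - diracVolterra b₁ b₂ q₁ q₂ lam)

theorem isUnit_one_sub_diracVolterra (lam : ℂ) :
    IsUnit (1 - diracVolterra b₁ b₂ q₁ q₂ lam) := by
  rw [diracVolterra_eq]
  exact (isUnit_one_sub_of_norm_pow_le (A := Curve →L[ℂ] Curve) (norm_volterra_pow_le _)).1

theorem diracResolvent_spec (lam : ℂ) (f : Curve) :
    diracResolvent b₁ b₂ q₁ q₂ lam f =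
      f + diracVolterra b₁ b₂ q₁ q₂ lam (diracResolvent b₁ b₂ q₁ q₂ lam f) := by
  have h := Ring.mul_inverse_cancel _ (isUnit_one_sub_diracVolterra b₁ b₂ q₁ q₂ lam)
  have h1 := congrArg (fun A : Curve →L[ℂ] Curve => A f) h
  change diracResolvent b₁ b₂ q₁ q₂ lam f -
    diracVolterra b₁ b₂ q₁ q₂ lam (diracResolvent b₁ b₂ q₁ q₂ lam f) = f at h1
  exact sub_eq_iff_eq_add.1 h1

theorem differentiable_diracResolvent : Differentiable ℂ (diracResolvent b₁ b₂ q₁ q₂) := by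
  exact differentiable_inverse_one_sub_affine (A := Curve →L[ℂ] Curve)
    (isUnit_one_sub_diracVolterra b₁ b₂ q₁ q₂)

theorem norm_diracResolvent_le : ∃ C, 0 ≤ C ∧ ∀ lam,
    ‖diracResolvent b₁ b₂ q₁ q₂ lam‖ ≤ Real.exp (C * (1 + ‖lam‖)) := by
  refine ⟨max ‖potMatrix b₁ b₂ q₁ q₂‖ ‖leadMatrix b₁ b₂‖, le_max_of_le_left (norm_nonneg (potMatrix b₁ b₂ q₁ q₂)),
    fun lam => ?_⟩
  rw [diracResolvent, diracVolterra_eq]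
  refine (isUnit_one_sub_of_norm_pow_le (A := Curve →L[ℂ] Curve) (norm_volterra_pow_le _)).2.trans
    (Real.exp_le_exp.2 ?_)
  refine (norm_add_le (potMatrix b₁ b₂ q₁ q₂) (lam • leadMatrix b₁ b₂)).trans ?_
  have h1 : ‖lam • leadMatrix b₁ b₂‖ ≤ ‖leadMatrix b₁ b₂‖ * ‖lam‖ := by
    rw [ContinuousMap.norm_le _ (mul_nonneg (norm_nonneg (leadMatrix b₁ b₂)) (norm_nonneg lam))]
    intro x
    rw [mul_comm]
    exact (norm_smul_le lam (leadMatrix b₁ b₂ x)).trans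
      (mul_le_mul_of_nonneg_left ((leadMatrix b₁ b₂).norm_coe_le_norm x) (norm_nonneg _))
  refine (add_le_add_right h1 _).trans ?_
  rw [mul_add, mul_one]
  gcongr
  · exact le_max_left _ _
  · exact le_max_right _ _

/-- The solutions of `L y = lam * y + u`, in integrated form. -/
def CurveSol (lam : ℂ) (u y : Curve) : Prop :=
  ∃ v : ℂ × ℂ, y = ContinuousMap.const _ v + primitive (leadOp b₁ b₂ u) +
    diracVolterra b₁ b₂ q₁ q₂ lam y

end Dirac

section Dirac

variable {b₁ b₂ : ℝ} {q₁ q₂ : C(Icc (0 : ℝ) 1, ℂ)} {lam : ℂ} {u y : Curve}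

variable (b₁ b₂ q₁ q₂ lam u y) in
/-- The right-hand side of the first-order system. -/
def diracRhs : Curve := leadOp b₁ b₂ u + (potOp b₁ b₂ q₁ q₂ y + lam • leadOp b₁ b₂ y)

theorem curveSol_iff : CurveSol b₁ b₂ q₁ q₂ lam u y ↔ ∃ v : ℂ × ℂ, ∀ x ∈ Icc (0 : ℝ) 1,
    ext01 y x = v + ∫ t in (0 : ℝ)..x,
      ext01 (diracRhs b₁ b₂ q₁ q₂ lam u y) t := by
  refine exists_congr fun v => ?_
  have h1 : ContinuousMap.const _ v + primitive (leadOp b₁ b₂ u) + diracVolterra b₁ b₂ q₁ q₂ lam y =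
      ContinuousMap.const _ v +
        primitive (diracRhs b₁ b₂ q₁ q₂ lam u y) := by
    rw [diracRhs, map_add, map_add, map_smul, ← add_assoc]
    rfl
  rw [h1]
  constructor
  · intro h x hx
    rw [ext01, IccExtend_of_mem _ _ hx]
    exact DFunLike.congr_fun h ⟨x, hx⟩
  · intro h
    ext1 x
    have := h x x.2
    rw [ext01, IccExtend_of_mem _ _ x.2] at this
    exact this

theorem CurveSol.integral_eq (h : CurveSol b₁ b₂ q₁ q₂ lam u y) : ∀ x ∈ Icc (0 : ℝ) 1,
    ext01 y x = ext01 y 0 + ∫ t in (0 : ℝ)..x,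
      ext01 (diracRhs b₁ b₂ q₁ q₂ lam u y) t := by
  obtain ⟨v, hv⟩ := curveSol_iff.1 h
  have h0 := hv 0 (by simp)
  rw [intervalIntegral.integral_same, add_zero] at h0
  rwa [h0]

theorem ext01_rhs (x : ℝ) :
    ext01 (diracRhs b₁ b₂ q₁ q₂ lam u y) x =
      (Complex.I * b₁ * (lam * (ext01 y x).1 + (ext01 u x).1 - ext01 q₁ x * (ext01 y x).2),
        Complex.I * b₂ * (lam * (ext01 y x).2 + (ext01 u x).2 - ext01 q₂ x * (ext01 y x).1)) := by
  change leadOp b₁ b₂ u _ + (potOp b₁ b₂ q₁ q₂ y _ + lam • leadOp b₁ b₂ y _) = _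
  rw [leadOp_apply, leadOp_apply, potOp_apply]
  refine Prod.ext ?_ ?_ <;>
  · simp only [Prod.fst_add, Prod.snd_add, Prod.smul_fst, Prod.smul_snd, smul_eq_mul, ext01, IccExtend,
      Function.comp]
    ring

theorem CurveSol.diracSol (h : CurveSol b₁ b₂ q₁ q₂ lam u y) :
    DiracSol b₁ b₂ (ext01 q₁) (ext01 q₂) lam (fun x => (ext01 u x).1) (fun x => (ext01 u x).2)
      (fun x => (ext01 y x).1) (fun x => (ext01 y x).2) := by
  have hd : ∀ x ∈ Ioo (0 : ℝ) 1, HasDerivAt (ext01 y)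
      (ext01 (diracRhs b₁ b₂ q₁ q₂ lam u y) x) x := by
    intro x hx
    refine HasDerivAt.congr_of_eventuallyEq
      ((intervalIntegral.integral_hasDerivAt_right
        ((continuous_ext01 _).intervalIntegrable 0 _)
        ((continuous_ext01 _).stronglyMeasurableAtFilter _ _) (continuous_ext01 _).continuousAt).const_add
          (ext01 y 0)) ?_
    filter_upwards [Icc_mem_nhds hx.1 hx.2] with t ht using h.integral_eq t ht
  refine ⟨(continuous_ext01 y).fst.continuousOn, (continuous_ext01 y).snd.continuousOn,
    fun x hx => ?_, fun x hx => ?_⟩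
  · exact ((ContinuousLinearMap.fst ℝ ℂ ℂ).hasFDerivAt.comp_hasDerivAt x (hd x hx)).congr_deriv
      (congrArg Prod.fst (ext01_rhs x))
  · exact ((ContinuousLinearMap.snd ℝ ℂ ℂ).hasFDerivAt.comp_hasDerivAt x (hd x hx)).congr_deriv
      (congrArg Prod.snd (ext01_rhs x))

theorem CurveSol.solvesDirac (hb₁ : b₁ ≠ 0) (hb₂ : b₂ ≠ 0) {Q12 Q21 : ℝ → ℂ}
    (hq₁ : ∀ x ∈ I01, ext01 q₁ x = Q12 x) (hq₂ : ∀ x ∈ I01, ext01 q₂ x = Q21 x)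
    (h : CurveSol b₁ b₂ q₁ q₂ lam u y) :
    SolvesDirac b₁ b₂ Q12 Q21 (ext01 y) (fun x => lam • ext01 y x + ext01 u x) := by
  refine ⟨_, (continuous_ext01 _).continuousOn.integrableOn_Icc, h.integral_eq, ?_⟩
  refine (ae_restrict_iff' measurableSet_Icc).2 (ae_of_all _ fun x hx => ?_)
  rw [ext01_rhs, ← hq₁ x hx, ← hq₂ x hx]
  have h1 : (b₁ : ℂ) ≠ 0 := by exact_mod_cast hb₁
  have h2 : (b₂ : ℂ) ≠ 0 := by exact_mod_cast hb₂
  constructor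
  · simp only [Prod.fst_add, Prod.smul_fst, smul_eq_mul]
    rw [show -Complex.I * (b₁ : ℂ)⁻¹ * (Complex.I * b₁ * (lam * (ext01 y x).1 + (ext01 u x).1 -
      ext01 q₁ x * (ext01 y x).2)) = -(Complex.I * Complex.I) * ((b₁ : ℂ)⁻¹ * b₁) *
      (lam * (ext01 y x).1 + (ext01 u x).1 - ext01 q₁ x * (ext01 y x).2) by ring,
      Complex.I_mul_I, inv_mul_cancel₀ h1]
    ring
  · simp only [Prod.snd_add, Prod.smul_snd, smul_eq_mul]
    rw [show -Complex.I * (b₂ : ℂ)⁻¹ * (Complex.I * b₂ * (lam * (ext01 y x).2 + (ext01 u x).2 -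
      ext01 q₂ x * (ext01 y x).1)) = -(Complex.I * Complex.I) * ((b₂ : ℂ)⁻¹ * b₂) *
      (lam * (ext01 y x).2 + (ext01 u x).2 - ext01 q₂ x * (ext01 y x).1) by ring,
      Complex.I_mul_I, inv_mul_cancel₀ h2]
    ring

variable (b₁ b₂ q₁ q₂ lam u)

/-- The homogeneous solution with value `v` at `0`. -/
def fundSol (v : ℂ × ℂ) : Curve := diracResolvent b₁ b₂ q₁ q₂ lam (ContinuousMap.const _ v)

/-- The solution of the inhomogeneous problem vanishing at `0`. -/
def partSol : Curve := diracResolvent b₁ b₂ q₁ q₂ lam (primitive (leadOp b₁ b₂ u))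

theorem primitive_zero (f : Curve) : primitive f ⟨0, by simp⟩ = 0 := by
  rw [primitive_apply]
  exact intervalIntegral.integral_same

theorem fundSol_spec (v : ℂ × ℂ) : fundSol b₁ b₂ q₁ q₂ lam v =
    ContinuousMap.const _ v + diracVolterra b₁ b₂ q₁ q₂ lam (fundSol b₁ b₂ q₁ q₂ lam v) :=
  diracResolvent_spec _ _ _ _ _ _

theorem partSol_spec : partSol b₁ b₂ q₁ q₂ lam u =
    primitive (leadOp b₁ b₂ u) + diracVolterra b₁ b₂ q₁ q₂ lam (partSol b₁ b₂ q₁ q₂ lam u) :=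
  diracResolvent_spec _ _ _ _ _ _

theorem fundSol_zero (v : ℂ × ℂ) : fundSol b₁ b₂ q₁ q₂ lam v ⟨0, by simp⟩ = v := by
  have h := DFunLike.congr_fun (fundSol_spec b₁ b₂ q₁ q₂ lam v) ⟨0, by simp⟩
  change _ = v + (primitive _ _ + lam • primitive _ _) at h
  rwa [primitive_zero, primitive_zero, smul_zero, add_zero, add_zero] at h

theorem curveSol_fundSol (v : ℂ × ℂ) :
    CurveSol b₁ b₂ q₁ q₂ lam 0 (fundSol b₁ b₂ q₁ q₂ lam v) := by
  refine ⟨v, ?_⟩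
  rw [map_zero, map_zero, add_zero]
  exact fundSol_spec _ _ _ _ _ _

theorem exists_diracSol (b₁ b₂ : ℝ) {Q₁ Q₂ : ℝ → ℂ} (hQ₁ : ContinuousOn Q₁ (Icc 0 1))
    (hQ₂ : ContinuousOn Q₂ (Icc 0 1)) (lam : ℂ) (v : ℂ × ℂ) :
    ∃ y₁ y₂ : ℝ → ℂ, DiracSol b₁ b₂ Q₁ Q₂ lam 0 0 y₁ y₂ ∧ y₁ 0 = v.1 ∧ y₂ 0 = v.2 := by
  let q₁ : C(Icc (0 : ℝ) 1, ℂ) := ⟨_, hQ₁.domRestrict⟩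
  let q₂ : C(Icc (0 : ℝ) 1, ℂ) := ⟨_, hQ₂.domRestrict⟩
  have h := (curveSol_fundSol b₁ b₂ q₁ q₂ lam v).diracSol
  have h0 : ext01 (fundSol b₁ b₂ q₁ q₂ lam v) 0 = v := by
    rw [ext01, IccExtend_of_mem _ _ (show (0 : ℝ) ∈ Icc 0 1 by simp), fundSol_zero]
  refine ⟨_, _, ⟨h.cont₁, h.cont₂, fun x hx => (h.deriv₁ x hx).congr_deriv ?_,
    fun x hx => (h.deriv₂ x hx).congr_deriv ?_⟩, congrArg Prod.fst h0, congrArg Prod.snd h0⟩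
  · simp only [ext01]
    rw [IccExtend_of_mem _ q₁ (Ioo_subset_Icc_self hx)]
    rfl
  · simp only [ext01]
    rw [IccExtend_of_mem _ q₂ (Ioo_subset_Icc_self hx)]
    rfl

end Dirac

/-- Continuous potentials on `[0,1]` bounded by `q₀`. -/
structure BddPot (q₁ q₂ : ℝ → ℂ) (q₀ : ℝ) : Prop where
  cont₁ : ContinuousOn q₁ (Icc 0 1)
  cont₂ : ContinuousOn q₂ (Icc 0 1)
  bound₁ : ∀ x ∈ Icc (0 : ℝ) 1, ‖q₁ x‖ ≤ q₀
  bound₂ : ∀ x ∈ Icc (0 : ℝ) 1, ‖q₂ x‖ ≤ q₀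

theorem one_sub_mem_Icc {x : ℝ} (hx : x ∈ Icc (0 : ℝ) 1) : 1 - x ∈ Icc (0 : ℝ) 1 :=
  ⟨by linarith [hx.2], by linarith [hx.1]⟩

theorem BddPot.reflect {q₁ q₂ : ℝ → ℂ} {q₀ : ℝ} (h : BddPot q₁ q₂ q₀) :
    BddPot (fun x => q₂ (1 - x)) (fun x => q₁ (1 - x)) q₀ :=
  ⟨continuousOn_comp_one_sub h.cont₂, continuousOn_comp_one_sub h.cont₁,
    fun _ hx => h.bound₂ _ (one_sub_mem_Icc hx), fun _ hx => h.bound₁ _ (one_sub_mem_Icc hx)⟩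

theorem BddPot.reverse {q₁ q₂ : ℝ → ℂ} {q₀ : ℝ} (h : BddPot q₁ q₂ q₀) :
    BddPot (fun x => -q₁ (1 - x)) (fun x => -q₂ (1 - x)) q₀ :=
  ⟨(continuousOn_comp_one_sub h.cont₁).neg, (continuousOn_comp_one_sub h.cont₂).neg,
    fun _ hx => (norm_neg _).trans_le (h.bound₁ _ (one_sub_mem_Icc hx)),
    fun _ hx => (norm_neg _).trans_le (h.bound₂ _ (one_sub_mem_Icc hx))⟩

theorem BddPot.nonneg {q₁ q₂ : ℝ → ℂ} {q₀ : ℝ} (h : BddPot q₁ q₂ q₀) : 0 ≤ q₀ :=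
  (norm_nonneg _).trans (h.bound₁ 0 (by simp))

/-- The solutions of the homogeneous system with `(y₁ 1, y₂ 0) = (1, 0)` and `(0, 1)`. -/
structure SpecialPair (b₁ b₂ : ℝ) (q₁ q₂ : ℝ → ℂ) (lam : ℂ) (α₁ α₂ β₁ β₂ : ℝ → ℂ) : Prop where
  solα : DiracSol b₁ b₂ q₁ q₂ lam 0 0 α₁ α₂
  solβ : DiracSol b₁ b₂ q₁ q₂ lam 0 0 β₁ β₂
  α₁_one : α₁ 1 = 1
  α₂_zero : α₂ 0 = 0
  β₁_one : β₁ 1 = 0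
  β₂_zero : β₂ 0 = 1

/-- The characteristic determinant with respect to a special pair. -/
def bcDet (a : Fin 2 → Fin 4 → ℂ) (r₁₁ r₁₂ r₂₁ r₂₂ : ℂ) : ℂ :=
  (a 0 2 + r₁₁ * a 0 0 + r₂₁ * a 0 3) * (a 1 1 + r₁₂ * a 1 0 + r₂₂ * a 1 3) -
    (a 0 1 + r₁₂ * a 0 0 + r₂₂ * a 0 3) * (a 1 2 + r₁₁ * a 1 0 + r₂₁ * a 1 3)

theorem bcDet_eq (a : Fin 2 → Fin 4 → ℂ) (r₁₁ r₁₂ r₂₁ r₂₂ : ℂ) : bcDet a r₁₁ r₁₂ r₂₁ r₂₂ =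
    Jdet a 2 1 + r₁₂ * Jdet a 2 0 + r₂₁ * Jdet a 3 1 + (r₂₂ * Jdet a 2 3 + r₁₁ * Jdet a 0 1 +
      r₁₁ * r₂₂ * Jdet a 0 3 + r₂₁ * r₁₂ * Jdet a 3 0) := by
  simp only [bcDet, Jdet]
  ring

section Special

variable {b₁ b₂ : ℝ} {q₁ q₂ : ℝ → ℂ} {q₀ τ : ℝ} {lam : ℂ} {α₁ α₂ β₁ β₂ : ℝ → ℂ}

theorem SpecialPair.reflect (h : SpecialPair b₁ b₂ q₁ q₂ lam α₁ α₂ β₁ β₂) :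
    SpecialPair (-b₂) (-b₁) (fun x => q₂ (1 - x)) (fun x => q₁ (1 - x)) lam
      (fun x => β₂ (1 - x)) (fun x => β₁ (1 - x)) (fun x => α₂ (1 - x)) (fun x => α₁ (1 - x)) where
  solα := h.solβ.reflect
  solβ := h.solα.reflect
  α₁_one := by simpa using h.β₂_zero
  α₂_zero := by simpa using h.β₁_one
  β₁_one := by simpa using h.α₂_zero
  β₂_zero := by simpa using h.α₁_one

/-- The spectral parameter is large compared with the potential. -/
structure LargeParam (b₁ b₂ q₀ τ : ℝ) : Prop where
  pos : 0 < τ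
  le₀ : 2 * q₀ ≤ τ
  le₂ : 2 * b₂ * q₀ ^ 2 ≤ τ
  le₁ : 2 * (-b₁) * q₀ ^ 2 ≤ τ

theorem eventually_largeParam (b₁ b₂ q₀ : ℝ) : ∀ᶠ τ in atTop, LargeParam b₁ b₂ q₀ τ := by
  filter_upwards [eventually_gt_atTop 0, eventually_ge_atTop (2 * q₀),
    eventually_ge_atTop (2 * b₂ * q₀ ^ 2), eventually_ge_atTop (2 * (-b₁) * q₀ ^ 2)] with τ h1 h2 h3 h4
    using ⟨h1, h2, h3, h4⟩

theorem LargeParam.reflect (h : LargeParam b₁ b₂ q₀ τ) : LargeParam (-b₂) (-b₁) q₀ τ :=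
  ⟨h.pos, h.le₀, h.le₁, by simpa using h.le₂⟩

theorem SpecialPair.exists (hb₁ : b₁ < 0) (hb₂ : 0 < b₂) (hq : BddPot q₁ q₂ q₀)
    (hτ : LargeParam b₁ b₂ q₀ τ) (hlam : lam.im = τ) :
    ∃ α₁ α₂ β₁ β₂, SpecialPair b₁ b₂ q₁ q₂ lam α₁ α₂ β₁ β₂ := by
  obtain ⟨f₁, f₂, hf, hf1, hf2⟩ := exists_diracSol b₁ b₂ hq.cont₁ hq.cont₂ lam (1, 0)
  obtain ⟨g₁, g₂, hg, hg1, hg2⟩ := exists_diracSol b₁ b₂ hq.cont₁ hq.cont₂ lam (0, 1)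
  simp only at hf1 hf2 hg1 hg2
  have hne : f₁ 1 ≠ 0 := by
    intro h
    have := (hf.norm_le_of_zero_data hb₁ hb₂ hq.cont₁ hq.cont₂ continuousOn_const continuousOn_const
      hq.bound₁ hq.bound₂ (U := 0) (fun _ _ => norm_zero.le)
      (fun _ _ => norm_zero.le) hτ.pos hτ.le₀ hlam h hf2 0 (by simp)).1
    rw [hf1] at this
    norm_num at this
  have h0 : DiracSol b₁ b₂ q₁ q₂ lam 0 0 0 0 :=
    ⟨continuousOn_const, continuousOn_const, fun x _ => (hasDerivAt_const x (0 : ℂ)).congr_deriv (by simp),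
      fun x _ => (hasDerivAt_const x (0 : ℂ)).congr_deriv (by simp)⟩
  have hα := h0.add_smul hf (f₁ 1)⁻¹
  have hβ := hg.add_smul hf (-(g₁ 1 * (f₁ 1)⁻¹))
  have hz : ∀ c : ℂ, (fun x : ℝ => (0 : ℝ → ℂ) x + c * (0 : ℝ → ℂ) x) = 0 := fun c => by
    ext
    simp
  rw [hz] at hα hβ
  exact ⟨_, _, _, _, hα, hβ, by simp [hne], by simp [hf2], by simp [hne], by simp [hf2, hg2]⟩

theorem SpecialPair.norm_β_le (hb₁ : b₁ < 0) (hb₂ : 0 < b₂) (hq : BddPot q₁ q₂ q₀)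
    (hτ : LargeParam b₁ b₂ q₀ τ) (hlam : lam.im = τ)
    (h : SpecialPair b₁ b₂ q₁ q₂ lam α₁ α₂ β₁ β₂) :
    ‖β₂ 1‖ ≤ 2 * Real.exp (-(b₂ * τ)) ∧ ∀ x ∈ Icc (0 : ℝ) 1, ‖β₁ x‖ ≤ 2 ∧ ‖β₂ x‖ ≤ 2 := by
  have h1 := h.solβ.norm_le_exp hb₁ hb₂ hq.cont₁ hq.cont₂ hq.bound₁ hq.bound₂ hτ.pos hτ.le₂ hlam h.β₁_one
  rw [h.β₂_zero, norm_one, mul_one] at h1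
  refine ⟨by simpa using (h1 1 (by simp)).1, fun x hx => ?_⟩
  have h2 : Real.exp (-(b₂ * τ) * x) ≤ 1 := Real.exp_le_one_iff.2 (by
    have := mul_nonneg (mul_pos hb₂ hτ.pos).le hx.1
    linarith)
  have h3 : q₀ / τ ≤ 1 := by
    rw [div_le_one hτ.pos]
    linarith [hτ.le₀, hq.nonneg]
  have h4 : 0 ≤ q₀ / τ := div_nonneg hq.nonneg hτ.pos.le
  constructor
  · refine (h1 x hx).2.trans ?_
    calc q₀ / τ * 2 * Real.exp (-(b₂ * τ) * x) ≤ 1 * 2 * 1 := by gcongr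
      _ = 2 := by norm_num
  · refine (h1 x hx).1.trans ?_
    linarith

theorem SpecialPair.norm_α_le (hb₁ : b₁ < 0) (hb₂ : 0 < b₂) (hq : BddPot q₁ q₂ q₀)
    (hτ : LargeParam b₁ b₂ q₀ τ) (hlam : lam.im = τ)
    (h : SpecialPair b₁ b₂ q₁ q₂ lam α₁ α₂ β₁ β₂) :
    ‖α₁ 0‖ ≤ 2 * Real.exp (-(-b₁ * τ)) ∧ ∀ x ∈ Icc (0 : ℝ) 1, ‖α₁ x‖ ≤ 2 ∧ ‖α₂ x‖ ≤ 2 := by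
  have h1 := h.reflect.norm_β_le (neg_neg_of_pos hb₂) (neg_pos.2 hb₁) hq.reflect hτ.reflect hlam
  simp only [sub_self] at h1
  refine ⟨h1.1, fun x hx => ?_⟩
  have := h1.2 _ (one_sub_mem_Icc hx)
  simp only [sub_sub_cancel] at this
  exact this.symm

/-- Resolvent estimate in terms of the characteristic determinant. -/
theorem DiracSol.norm_le_of_bc (hb₁ : b₁ < 0) (hb₂ : 0 < b₂) (hq : BddPot q₁ q₂ q₀)
    (hτ : LargeParam b₁ b₂ q₀ τ) (hlam : lam.im = τ) {a : Fin 2 → Fin 4 → ℂ} {A : ℝ}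
    (hA : ∀ i j, ‖a i j‖ ≤ A) (h : SpecialPair b₁ b₂ q₁ q₂ lam α₁ α₂ β₁ β₂)
    (hD : bcDet a (α₁ 0) (β₁ 0) (α₂ 1) (β₂ 1) ≠ 0) {u₁ u₂ y₁ y₂ : ℝ → ℂ} {U : ℝ}
    (hu₁ : ContinuousOn u₁ (Icc 0 1)) (hu₂ : ContinuousOn u₂ (Icc 0 1))
    (hu₁b : ∀ x ∈ Icc (0 : ℝ) 1, ‖u₁ x‖ ≤ U) (hu₂b : ∀ x ∈ Icc (0 : ℝ) 1, ‖u₂ x‖ ≤ U)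
    (hy : DiracSol b₁ b₂ q₁ q₂ lam u₁ u₂ y₁ y₂)
    (hbc : ∀ j, a j 0 * y₁ 0 + a j 1 * y₂ 0 + a j 2 * y₁ 1 + a j 3 * y₂ 1 = 0) :
    ∀ x ∈ Icc (0 : ℝ) 1,
      ‖y₁ x‖ ≤ 2 * U / τ * (1 + 80 * A ^ 2 / ‖bcDet a (α₁ 0) (β₁ 0) (α₂ 1) (β₂ 1)‖) ∧
      ‖y₂ x‖ ≤ 2 * U / τ * (1 + 80 * A ^ 2 / ‖bcDet a (α₁ 0) (β₁ 0) (α₂ 1) (β₂ 1)‖) := by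
  set D := bcDet a (α₁ 0) (β₁ 0) (α₂ 1) (β₂ 1) with hDdef
  set s := y₁ 1 with hs
  set t := y₂ 0 with ht
  set ρ := 2 * U / τ with hρ
  have hz := ((hy.add_smul h.solα (-s)).add_smul h.solβ (-t)).norm_le_of_zero_data hb₁ hb₂ hq.cont₁
    hq.cont₂ (by simpa using hu₁) (by simpa using hu₂) hq.bound₁ hq.bound₂ (by simpa using hu₁b)
    (by simpa using hu₂b) hτ.pos hτ.le₀ hlam (by simp [h.α₁_one, h.β₁_one, hs])
    (by simp [h.α₂_zero, h.β₂_zero, ht])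
  have hA0 : 0 ≤ A := (norm_nonneg _).trans (hA 0 0)
  have hαb := (h.norm_α_le hb₁ hb₂ hq hτ hlam).2
  have hβb := (h.norm_β_le hb₁ hb₂ hq hτ hlam).2
  have hρ0 : 0 ≤ ρ := (norm_nonneg _).trans (hz 0 (by simp)).1
  set z₀ := y₁ 0 + -s * α₁ 0 + -t * β₁ 0 with hz₀
  set z₁ := y₂ 1 + -s * α₂ 1 + -t * β₂ 1 with hz₁
  have hz₀b : ‖z₀‖ ≤ ρ := (hz 0 (by simp)).1
  have hz₁b : ‖z₁‖ ≤ ρ := (hz 1 (by simp)).2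
  have hcol : ∀ j k r r', ‖r‖ ≤ 2 → ‖r'‖ ≤ 2 → ‖a j k + r * a j 0 + r' * a j 3‖ ≤ 5 * A := by
    intro j k r r' hr hr'
    calc _ ≤ ‖a j k‖ + ‖r‖ * ‖a j 0‖ + ‖r'‖ * ‖a j 3‖ := by
          refine (norm_add_le _ _).trans (add_le_add ((norm_add_le _ _).trans ?_) ?_)
          · rw [norm_mul]
          · rw [norm_mul]
      _ ≤ A + 2 * A + 2 * A := by
          gcongr
          exacts [hA _ _, hA _ _, hA _ _]
      _ = 5 * A := by ring
  have hg : ∀ j, ‖a j 0 * z₀ + a j 3 * z₁‖ ≤ 2 * A * ρ := by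
    intro j
    calc _ ≤ ‖a j 0‖ * ‖z₀‖ + ‖a j 3‖ * ‖z₁‖ := by
          rw [← norm_mul, ← norm_mul]
          exact norm_add_le _ _
      _ ≤ A * ρ + A * ρ := by
          gcongr
          exacts [hA _ _, hA _ _]
      _ = _ := by ring
  have hdet : ∀ p q r s : ℂ, ‖p‖ ≤ 2 * A * ρ → ‖q‖ ≤ 5 * A → ‖r‖ ≤ 2 * A * ρ → ‖s‖ ≤ 5 * A →
      ‖p * q - r * s‖ ≤ 20 * A ^ 2 * ρ := by
    intro p q r s hp hq hr hs
    calc _ ≤ ‖p‖ * ‖q‖ + ‖r‖ * ‖s‖ := by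
          rw [← norm_mul, ← norm_mul]
          exact norm_sub_le _ _
      _ ≤ 2 * A * ρ * (5 * A) + 2 * A * ρ * (5 * A) := by gcongr
      _ = _ := by ring
  have h0m : (0 : ℝ) ∈ Icc (0 : ℝ) 1 := by simp
  have h1m : (1 : ℝ) ∈ Icc (0 : ℝ) 1 := by simp
  have hDpos : 0 < ‖D‖ := norm_pos_iff.2 hD
  have hsD : ‖s‖ ≤ 20 * A ^ 2 * ρ / ‖D‖ := by
    rw [le_div_iff₀ hDpos, ← norm_mul]
    have : s * D = (a 1 0 * z₀ + a 1 3 * z₁) * (a 0 1 + β₁ 0 * a 0 0 + β₂ 1 * a 0 3) -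
        (a 0 0 * z₀ + a 0 3 * z₁) * (a 1 1 + β₁ 0 * a 1 0 + β₂ 1 * a 1 3) := by
      have e0 := hbc 0
      have e1 := hbc 1
      rw [hDdef, bcDet, hz₀, hz₁]
      linear_combination (a 1 1 + β₁ 0 * a 1 0 + β₂ 1 * a 1 3) * e0 -
        (a 0 1 + β₁ 0 * a 0 0 + β₂ 1 * a 0 3) * e1
    rw [this]
    exact hdet _ _ _ _ (hg 1) (hcol _ _ _ _ (hβb 0 h0m).1 (hβb 1 h1m).2) (hg 0)
      (hcol _ _ _ _ (hβb 0 h0m).1 (hβb 1 h1m).2)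
  have htD : ‖t‖ ≤ 20 * A ^ 2 * ρ / ‖D‖ := by
    rw [le_div_iff₀ hDpos, ← norm_mul]
    have : t * D = (a 0 0 * z₀ + a 0 3 * z₁) * (a 1 2 + α₁ 0 * a 1 0 + α₂ 1 * a 1 3) -
        (a 1 0 * z₀ + a 1 3 * z₁) * (a 0 2 + α₁ 0 * a 0 0 + α₂ 1 * a 0 3) := by
      have e0 := hbc 0
      have e1 := hbc 1
      rw [hDdef, bcDet, hz₀, hz₁]
      linear_combination -(a 1 2 + α₁ 0 * a 1 0 + α₂ 1 * a 1 3) * e0 +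
        (a 0 2 + α₁ 0 * a 0 0 + α₂ 1 * a 0 3) * e1
    rw [this]
    exact hdet _ _ _ _ (hg 0) (hcol _ _ _ _ (hαb 0 h0m).1 (hαb 1 h1m).2) (hg 1)
      (hcol _ _ _ _ (hαb 0 h0m).1 (hαb 1 h1m).2)
  have hfin : ∀ w p q : ℂ, ‖w + -s * p + -t * q‖ ≤ ρ → ‖p‖ ≤ 2 → ‖q‖ ≤ 2 →
      ‖w‖ ≤ ρ * (1 + 80 * A ^ 2 / ‖D‖) := by
    intro w p q hw hp hq
    calc ‖w‖ = ‖(w + -s * p + -t * q) + s * p + t * q‖ := by ring_nf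
      _ ≤ ‖w + -s * p + -t * q‖ + ‖s‖ * ‖p‖ + ‖t‖ * ‖q‖ := by
          rw [← norm_mul, ← norm_mul]
          exact (norm_add_le _ _).trans (add_le_add_left (norm_add_le _ _) _)
      _ ≤ ρ + 20 * A ^ 2 * ρ / ‖D‖ * 2 + 20 * A ^ 2 * ρ / ‖D‖ * 2 := by gcongr
      _ = _ := by ring
  exact fun x hx => ⟨hfin _ _ _ (hz x hx).1 (hαb x hx).1 (hβb x hx).1,
    hfin _ _ _ (hz x hx).2 (hαb x hx).2 (hβb x hx).2⟩

end Special

section Det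

variable {b₁ b₂ : ℝ} {q₁ q₂ : ℝ → ℂ} {q₀ K : ℝ} {m : ℕ} {a : Fin 2 → Fin 4 → ℂ}

/-- Potentials flat of order `m` at the endpoints `0` and `1`, respectively. -/
structure FlatPot (q₁ q₂ : ℝ → ℂ) (K : ℝ) (m : ℕ) : Prop where
  le₁ : ∀ x ∈ Icc (0 : ℝ) 1, ‖q₁ x‖ ≤ K * x ^ m
  le₂ : ∀ x ∈ Icc (0 : ℝ) 1, ‖q₂ (1 - x)‖ ≤ K * x ^ m

theorem FlatPot.reflect (h : FlatPot q₁ q₂ K m) :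
    FlatPot (fun x => q₂ (1 - x)) (fun x => q₁ (1 - x)) K m :=
  ⟨h.le₂, fun x hx => by simpa using h.le₁ x hx⟩

theorem BddPot.flatPot (h : BddPot q₁ q₂ q₀) : FlatPot q₁ q₂ q₀ 0 :=
  ⟨fun x hx => by simpa using h.bound₁ x hx, fun x hx => by simpa using h.bound₂ _ (one_sub_mem_Icc hx)⟩

theorem exists_norm_beta_le (hb₁ : b₁ < 0) (hb₂ : 0 < b₂) (hq : BddPot q₁ q₂ q₀)
    (hK : FlatPot q₁ q₂ K m) : ∃ C, ∀ τ lam (α₁ α₂ β₁ β₂ : ℝ → ℂ), LargeParam b₁ b₂ q₀ τ → 1 ≤ τ →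
      lam.im = τ → SpecialPair b₁ b₂ q₁ q₂ lam α₁ α₂ β₁ β₂ →
      ‖β₁ 0‖ ≤ C / τ ^ (m + 1) ∧
      ‖β₁ 0 - Complex.I * b₁ * ∫ s in (0 : ℝ)..1, Complex.exp (Complex.I * (b₂ - b₁) * lam * s) * q₁ s‖
        ≤ C / τ ^ (2 * m + 2) := by
  set E := m.factorial / (b₂ / 4) ^ m with hE
  refine ⟨max (2 * K * E) (8 * q₀ * K ^ 2 * E ^ 2), fun τ lam α₁ α₂ β₁ β₂ hτ hτ1 hlam h => ?_⟩
  have hτ0 := hτ.pos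
  obtain ⟨h1, h2⟩ := h.solβ.asymptotics hb₁ hb₂ hq.cont₁ hq.cont₂ hq.bound₁ hq.bound₂ hK.le₁ hE hτ.pos
    hτ.le₂ hlam h.β₁_one h.β₂_zero
  refine ⟨h1.trans (by gcongr; exact le_max_left _ _), h2.trans ?_⟩
  have := hq.nonneg
  have hpow : τ ^ (2 * m + 2) ≤ τ ^ (2 * m + 3) := pow_le_pow_right₀ hτ1 (by omega)
  calc _ ≤ 8 * q₀ * K ^ 2 * E ^ 2 / τ ^ (2 * m + 2) := by gcongr
    _ ≤ _ := by gcongr; exact le_max_right _ _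

theorem exists_norm_alpha_le (hb₁ : b₁ < 0) (hb₂ : 0 < b₂) (hq : BddPot q₁ q₂ q₀)
    (hK : FlatPot q₁ q₂ K m) : ∃ C, ∀ τ lam (α₁ α₂ β₁ β₂ : ℝ → ℂ), LargeParam b₁ b₂ q₀ τ → 1 ≤ τ →
      lam.im = τ → SpecialPair b₁ b₂ q₁ q₂ lam α₁ α₂ β₁ β₂ →
      ‖α₂ 1‖ ≤ C / τ ^ (m + 1) ∧
      ‖α₂ 1 + Complex.I * b₂ *
          ∫ s in (0 : ℝ)..1, Complex.exp (Complex.I * (b₂ - b₁) * lam * s) * q₂ (1 - s)‖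
        ≤ C / τ ^ (2 * m + 2) := by
  obtain ⟨C, hC⟩ := exists_norm_beta_le (neg_neg_of_pos hb₂) (neg_pos.2 hb₁) hq.reflect hK.reflect
  refine ⟨C, fun τ lam α₁ α₂ β₁ β₂ hτ hτ1 hlam h => ?_⟩
  have := hC τ lam _ _ _ _ hτ.reflect hτ1 hlam h.reflect
  simpa [← sub_eq_neg_add, sub_neg_eq_add] using this

theorem exists_bound_Jdet (a : Fin 2 → Fin 4 → ℂ) : ∃ J, ∀ i j, ‖Jdet a i j‖ ≤ J := by
  obtain ⟨J, hJ⟩ := Finite.exists_le (fun p : Fin 4 × Fin 4 => ‖Jdet a p.1 p.2‖)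
  exact ⟨J, fun i j => hJ (i, j)⟩

/-- Expansion of the characteristic determinant in the upper half-plane. -/
theorem exists_bcDet_approx (hb₁ : b₁ < 0) (hb₂ : 0 < b₂) (hq : BddPot q₁ q₂ q₀)
    (hK : FlatPot q₁ q₂ K m) (a : Fin 2 → Fin 4 → ℂ) : ∃ C δ, 0 < δ ∧
    ∀ τ lam (α₁ α₂ β₁ β₂ : ℝ → ℂ), LargeParam b₁ b₂ q₀ τ → 1 ≤ τ →
      lam.im = τ → SpecialPair b₁ b₂ q₁ q₂ lam α₁ α₂ β₁ β₂ →
      ‖bcDet a (α₁ 0) (β₁ 0) (α₂ 1) (β₂ 1) - Jdet a 2 1‖ ≤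
        C * (Real.exp (-(δ * τ)) + 1 / τ ^ (m + 1)) ∧
      ‖bcDet a (α₁ 0) (β₁ 0) (α₂ 1) (β₂ 1) - Jdet a 2 1 + Complex.I *
        ∫ s in (0 : ℝ)..1, Complex.exp (Complex.I * (b₂ - b₁) * lam * s) *
          (Jdet a 0 2 * b₁ * q₁ s + Jdet a 3 1 * b₂ * q₂ (1 - s))‖ ≤
        C * (Real.exp (-(δ * τ)) + 1 / τ ^ (2 * m + 2)) := by
  obtain ⟨Cβ, hβ⟩ := exists_norm_beta_le hb₁ hb₂ hq hK
  obtain ⟨Cα, hα⟩ := exists_norm_alpha_le hb₁ hb₂ hq hK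
  obtain ⟨J, hJ⟩ := exists_bound_Jdet a
  have hJ0 : 0 ≤ J := (norm_nonneg _).trans (hJ 0 0)
  set M := max (max Cα Cβ) 0 with hM
  have hM0 : 0 ≤ M := le_max_right _ _
  refine ⟨J * (8 + 2 * M + M ^ 2), min (-b₁) b₂, lt_min (neg_pos.2 hb₁) hb₂,
    fun τ lam α₁ α₂ β₁ β₂ hτ hτ1 hlam h => ?_⟩
  set δ := min (-b₁) b₂
  have hτ0 := hτ.pos
  obtain ⟨hβ1, hβ2⟩ := hβ τ lam _ _ _ _ hτ hτ1 hlam h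
  obtain ⟨hα1, hα2⟩ := hα τ lam _ _ _ _ hτ hτ1 hlam h
  have hle : ∀ k : ℕ, Cβ / τ ^ k ≤ M / τ ^ k ∧ Cα / τ ^ k ≤ M / τ ^ k := fun k =>
    ⟨div_le_div_of_nonneg_right ((le_max_right _ _).trans (le_max_left _ _)) (by positivity),
      div_le_div_of_nonneg_right ((le_max_left _ _).trans (le_max_left _ _)) (by positivity)⟩
  replace hβ1 := hβ1.trans (hle _).1
  replace hβ2 := hβ2.trans (hle _).1
  replace hα1 := hα1.trans (hle _).2
  replace hα2 := hα2.trans (hle _).2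
  obtain ⟨hr22, hβb⟩ := h.norm_β_le hb₁ hb₂ hq hτ hlam
  obtain ⟨hr11, hαb⟩ := h.norm_α_le hb₁ hb₂ hq hτ hlam
  have hr22' : ‖β₂ 1‖ ≤ 2 * Real.exp (-(δ * τ)) := hr22.trans (by gcongr; exact min_le_right _ _)
  have hr11' : ‖α₁ 0‖ ≤ 2 * Real.exp (-(δ * τ)) := hr11.trans (by gcongr; exact min_le_left _ _)
  have hr22b := (hβb 1 (by simp)).2
  set e := Real.exp (-(δ * τ))
  have he : 0 < e := Real.exp_pos _
  have htail : ‖β₂ 1 * Jdet a 2 3 + α₁ 0 * Jdet a 0 1 + α₁ 0 * β₂ 1 * Jdet a 0 3 +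
      α₂ 1 * β₁ 0 * Jdet a 3 0‖ ≤ J * (8 * e + M ^ 2 * (1 / τ ^ (2 * m + 2))) := by
    calc _ ≤ ‖β₂ 1‖ * ‖Jdet a 2 3‖ + ‖α₁ 0‖ * ‖Jdet a 0 1‖ + ‖α₁ 0‖ * ‖β₂ 1‖ * ‖Jdet a 0 3‖ +
        ‖α₂ 1‖ * ‖β₁ 0‖ * ‖Jdet a 3 0‖ := by
          simp only [← norm_mul]
          exact (norm_add_le _ _).trans (add_le_add_left ((norm_add_le _ _).trans
            (add_le_add_left (norm_add_le _ _) _)) _)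
      _ ≤ 2 * e * J + 2 * e * J + 2 * e * 2 * J + M / τ ^ (m + 1) * (M / τ ^ (m + 1)) * J := by
          gcongr <;> exact hJ _ _
      _ = _ := by
          rw [show 2 * m + 2 = (m + 1) + (m + 1) by ring, pow_add]
          field_simp
          ring
  have hpow : 1 / τ ^ (2 * m + 2) ≤ 1 / τ ^ (m + 1) :=
    one_div_le_one_div_of_le (by positivity) (pow_le_pow_right₀ hτ1 (by omega))
  have hp0 : 0 < 1 / τ ^ (2 * m + 2) := by positivity
  have hp1 : 0 < 1 / τ ^ (m + 1) := by positivity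
  have hfinal : ∀ p r : ℝ, 0 ≤ p → 1 / τ ^ (2 * m + 2) ≤ p → r ≤ 2 * M * p * J →
      r + J * (8 * e + M ^ 2 * (1 / τ ^ (2 * m + 2))) ≤ J * (8 + 2 * M + M ^ 2) * (e + p) := by
    intro p r hp hp' hr
    have h1 : J * (M ^ 2 * (1 / τ ^ (2 * m + 2))) ≤ J * (M ^ 2 * p) := by gcongr
    have h2 : 0 ≤ J * (2 * M + M ^ 2) * e := by positivity
    have h3 : 0 ≤ J * 8 * p := by positivity
    nlinarith
  rw [bcDet_eq]
  constructor
  · refine le_trans ?_ (hfinal _ (‖β₁ 0 * Jdet a 2 0 + α₂ 1 * Jdet a 3 1‖) hp1.le hpow ?_)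
    · refine le_trans (le_of_eq ?_) ((norm_add_le _ _).trans (add_le_add_right htail _))
      congr 1
      ring
    · calc _ ≤ ‖β₁ 0‖ * ‖Jdet a 2 0‖ + ‖α₂ 1‖ * ‖Jdet a 3 1‖ := by
            simp only [← norm_mul]
            exact norm_add_le _ _
        _ ≤ M / τ ^ (m + 1) * J + M / τ ^ (m + 1) * J := by
            gcongr <;> exact hJ _ _
        _ = _ := by ring
  · have hexp : Continuous fun s : ℝ => Complex.exp (Complex.I * (b₂ - b₁) * lam * s) := by fun_prop
    have hi₁ : IntervalIntegrable (fun s : ℝ => Complex.exp (Complex.I * (b₂ - b₁) * lam * s) * q₁ s)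
        volume 0 1 := by
      refine ContinuousOn.intervalIntegrable ?_
      rw [uIcc_of_le zero_le_one]
      exact hexp.continuousOn.mul hq.cont₁
    have hi₂ : IntervalIntegrable
        (fun s : ℝ => Complex.exp (Complex.I * (b₂ - b₁) * lam * s) * q₂ (1 - s)) volume 0 1 := by
      refine ContinuousOn.intervalIntegrable ?_
      rw [uIcc_of_le zero_le_one]
      exact hexp.continuousOn.mul (continuousOn_comp_one_sub hq.cont₂)
    have hsplit : ∫ s in (0 : ℝ)..1, Complex.exp (Complex.I * (b₂ - b₁) * lam * s) *
          (Jdet a 0 2 * b₁ * q₁ s + Jdet a 3 1 * b₂ * q₂ (1 - s)) =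
        Jdet a 0 2 * b₁ * (∫ s in (0 : ℝ)..1, Complex.exp (Complex.I * (b₂ - b₁) * lam * s) * q₁ s) +
        Jdet a 3 1 * b₂ *
          ∫ s in (0 : ℝ)..1, Complex.exp (Complex.I * (b₂ - b₁) * lam * s) * q₂ (1 - s) := by
      rw [← intervalIntegral.integral_const_mul, ← intervalIntegral.integral_const_mul,
        ← intervalIntegral.integral_add (hi₁.const_mul _) (hi₂.const_mul _)]
      exact intervalIntegral.integral_congr fun s _ => by ring
    rw [hsplit]
    set X₁ := ∫ s in (0 : ℝ)..1, Complex.exp (Complex.I * (b₂ - b₁) * lam * s) * q₁ s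
    set X₂ := ∫ s in (0 : ℝ)..1, Complex.exp (Complex.I * (b₂ - b₁) * lam * s) * q₂ (1 - s)
    refine le_trans ?_ (hfinal _ (‖(β₁ 0 - Complex.I * b₁ * X₁) * Jdet a 2 0 +
      (α₂ 1 + Complex.I * b₂ * X₂) * Jdet a 3 1‖) hp0.le le_rfl ?_)
    · refine le_trans (le_of_eq ?_) ((norm_add_le _ _).trans (add_le_add_right htail _))
      congr 1
      simp only [Jdet]
      ring
    · calc _ ≤ ‖β₁ 0 - Complex.I * b₁ * X₁‖ * ‖Jdet a 2 0‖ +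
          ‖α₂ 1 + Complex.I * b₂ * X₂‖ * ‖Jdet a 3 1‖ := by
            simp only [← norm_mul]
            exact norm_add_le _ _
        _ ≤ M / τ ^ (2 * m + 2) * J + M / τ ^ (2 * m + 2) * J := by
            gcongr <;> exact hJ _ _
        _ = _ := by ring

theorem tendsto_pow_mul_exp_neg_mul {δ : ℝ} (hδ : 0 < δ) (k : ℕ) :
    Tendsto (fun τ : ℝ => τ ^ k * Real.exp (-(δ * τ))) atTop (𝓝 0) := by
  have := tendsto_rpow_mul_exp_neg_mul_atTop_nhds_zero k δ hδ
  simpa using this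

/-- Lower bound for the characteristic determinant along rays in the upper half-plane when the
leading coefficient vanishes. -/
theorem eventually_bcDet_lower_bound (hb₁ : b₁ < 0) (hb₂ : 0 < b₂) (hq : BddPot q₁ q₂ q₀)
    (hK : FlatPot q₁ q₂ K m) (hJ : Jdet a 2 1 = 0) {k : ℕ} (hk : k ≤ 2 * m) {K' : ℝ} {p : ℂ}
    (hPK : ∀ t ∈ Icc (0 : ℝ) 1,
      ‖Jdet a 0 2 * b₁ * q₁ t + Jdet a 3 1 * b₂ * q₂ (1 - t)‖ ≤ K' * t ^ k)
    (hPlim : Tendsto (fun t : ℝ => (Jdet a 0 2 * b₁ * q₁ t + Jdet a 3 1 * b₂ * q₂ (1 - t)) / (t : ℂ) ^ k)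
      (𝓝[>] 0) (𝓝 p)) (hp : p ≠ 0) (ε : ℝ) :
    ∃ c, 0 < c ∧ ∀ᶠ τ : ℝ in atTop, ∀ α₁ α₂ β₁ β₂,
      SpecialPair b₁ b₂ q₁ q₂ ((ε + Complex.I) * τ) α₁ α₂ β₁ β₂ →
      c / τ ^ (k + 1) ≤ ‖bcDet a (α₁ 0) (β₁ 0) (α₂ 1) (β₂ 1)‖ := by
  obtain ⟨C, δ, hδ, hC⟩ := exists_bcDet_approx hb₁ hb₂ hq hK a
  set w : ℂ := (b₂ - b₁) * (1 - Complex.I * ε) with hw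
  have hwre : 0 < w.re := by
    rw [hw]
    simp
    linarith
  have hw0 : w ≠ 0 := fun h => by simp [h] at hwre
  have hPc : ContinuousOn (fun t => Jdet a 0 2 * b₁ * q₁ t + Jdet a 3 1 * b₂ * q₂ (1 - t)) (Icc 0 1) :=
    (continuousOn_const.mul hq.cont₁).add (continuousOn_const.mul (continuousOn_comp_one_sub hq.cont₂))
  have hlap := (tendsto_laplace hPc hPK hPlim hwre).norm
  set L := ‖p * (k.factorial / w ^ (k + 1))‖ with hL
  have hLpos : 0 < L := by
    rw [hL, norm_pos_iff]
    exact mul_ne_zero hp (div_ne_zero (by exact_mod_cast k.factorial_ne_zero) (pow_ne_zero _ hw0))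
  refine ⟨L / 4, by positivity, ?_⟩
  filter_upwards [hlap.eventually_const_lt (half_lt_self hLpos),
    eventually_largeParam b₁ b₂ q₀, eventually_ge_atTop 1, (((tendsto_pow_mul_exp_neg_mul hδ (k + 1)).add
      tendsto_inv_atTop_zero).const_mul |C|).eventually_lt_const
      (show |C| * (0 + 0) < L / 4 by simpa using hLpos)]
    with τ h1 h3 h4 h2 α₁ α₂ β₁ β₂ h
  have hτ0 := h3.pos
  have hI : ∀ s : ℝ, Complex.I * (b₂ - b₁) * ((ε + Complex.I) * τ) * s = -w * τ * s := by
    intro s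
    rw [hw]
    linear_combination ((b₂ : ℂ) - b₁) * τ * s * Complex.I_mul_I
  have h5 := (hC τ ((ε + Complex.I) * τ) α₁ α₂ β₁ β₂ h3 h4 (by simp) h).2
  simp only [hI] at h5
  rw [hJ, sub_zero] at h5
  set D := bcDet a (α₁ 0) (β₁ 0) (α₂ 1) (β₂ 1)
  set X := ∫ s in (0 : ℝ)..1, Complex.exp (-w * τ * s) *
    (Jdet a 0 2 * b₁ * q₁ s + Jdet a 3 1 * b₂ * q₂ (1 - s))
  rw [norm_mul, norm_pow, Complex.norm_real, Real.norm_of_nonneg hτ0.le] at h1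
  have h6 : ‖X‖ ≤ ‖D‖ + ‖D + Complex.I * X‖ := by
    have : ‖Complex.I * X‖ ≤ ‖D + Complex.I * X‖ + ‖D‖ := by
      simpa using norm_sub_le (D + Complex.I * X) D
    rw [norm_mul, Complex.norm_I, one_mul] at this
    linarith
  have h7 : τ ^ (k + 1) * ‖D + Complex.I * X‖ ≤ L / 4 := by
    calc τ ^ (k + 1) * ‖D + Complex.I * X‖
        ≤ τ ^ (k + 1) * (|C| * (Real.exp (-(δ * τ)) + 1 / τ ^ (k + 2))) := by
          gcongr
          refine h5.trans ?_
          gcongr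
          · exact le_abs_self C
      _ = |C| * (τ ^ (k + 1) * Real.exp (-(δ * τ)) + τ⁻¹) := by
          field_simp
          ring
      _ ≤ L / 4 := h2.le
  rw [div_le_iff₀ (by positivity)]
  nlinarith [mul_le_mul_of_nonneg_left h6 (by positivity : 0 ≤ τ ^ (k + 1))]

/-- Lower bound for the characteristic determinant in the upper half-plane when the leading
coefficient does not vanish. -/
theorem eventually_bcDet_lower_bound_of_ne (hb₁ : b₁ < 0) (hb₂ : 0 < b₂) (hq : BddPot q₁ q₂ q₀)
    (hJ : Jdet a 2 1 ≠ 0) : ∃ c, 0 < c ∧ ∀ᶠ τ : ℝ in atTop, ∀ lam α₁ α₂ β₁ β₂, lam.im = τ →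
      SpecialPair b₁ b₂ q₁ q₂ lam α₁ α₂ β₁ β₂ →
      c ≤ ‖bcDet a (α₁ 0) (β₁ 0) (α₂ 1) (β₂ 1)‖ := by
  obtain ⟨C, δ, hδ, hC⟩ := exists_bcDet_approx hb₁ hb₂ hq hq.flatPot a
  have hJ0 : 0 < ‖Jdet a 2 1‖ := norm_pos_iff.2 hJ
  have hsmall : Tendsto (fun τ : ℝ => C * (Real.exp (-(δ * τ)) + 1 / τ ^ (0 + 1))) atTop (𝓝 0) := by
    simpa using ((tendsto_pow_mul_exp_neg_mul hδ 0).add tendsto_inv_atTop_zero).const_mul C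
  refine ⟨‖Jdet a 2 1‖ / 2, by positivity, ?_⟩
  filter_upwards [hsmall.eventually_lt_const (half_pos hJ0), eventually_largeParam b₁ b₂ q₀,
    eventually_ge_atTop 1] with τ h1 h2 h3 lam α₁ α₂ β₁ β₂ hlam h
  have h4 := (hC τ lam α₁ α₂ β₁ β₂ h2 h3 hlam h).1
  have h5 := norm_sub_norm_le (Jdet a 2 1) (Jdet a 2 1 - bcDet a (α₁ 0) (β₁ 0) (α₂ 1) (β₂ 1))
  rw [sub_sub_cancel, norm_sub_rev (Jdet a 2 1)] at h5
  linarith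

end Det

/-- Every solution of the boundary value problem with right-hand side bounded by `U` is bounded
by `M * U`. -/
def ResolventBound (a : Fin 2 → Fin 4 → ℂ) (b₁ b₂ : ℝ) (q₁ q₂ : ℝ → ℂ) (lam : ℂ) (M : ℝ) : Prop :=
  ∀ (u₁ u₂ y₁ y₂ : ℝ → ℂ) (U : ℝ), ContinuousOn u₁ (Icc 0 1) → ContinuousOn u₂ (Icc 0 1) →
    (∀ x ∈ Icc (0 : ℝ) 1, ‖u₁ x‖ ≤ U) → (∀ x ∈ Icc (0 : ℝ) 1, ‖u₂ x‖ ≤ U) →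
    DiracSol b₁ b₂ q₁ q₂ lam u₁ u₂ y₁ y₂ →
    (∀ j, a j 0 * y₁ 0 + a j 1 * y₂ 0 + a j 2 * y₁ 1 + a j 3 * y₂ 1 = 0) →
    ∀ x ∈ Icc (0 : ℝ) 1, ‖y₁ x‖ ≤ M * U ∧ ‖y₂ x‖ ≤ M * U

section Bounds

variable {a : Fin 2 → Fin 4 → ℂ} {b₁ b₂ q₀ : ℝ} {q₁ q₂ : ℝ → ℂ} {lam : ℂ} {M : ℝ}

/-- Interchanging the end points of the interval. -/
def swapEnds (a : Fin 2 → Fin 4 → ℂ) : Fin 2 → Fin 4 → ℂ := fun j => ![a j 2, a j 3, a j 0, a j 1]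

theorem ResolventBound.reverse (h : ResolventBound (swapEnds a) b₁ b₂ (fun x => -q₁ (1 - x))
    (fun x => -q₂ (1 - x)) (-lam) M) : ResolventBound a b₁ b₂ q₁ q₂ lam M := by
  intro u₁ u₂ y₁ y₂ U hu₁ hu₂ hu₁b hu₂b hy hbc x hx
  have := h _ _ _ _ U (continuousOn_comp_one_sub hu₁).neg (continuousOn_comp_one_sub hu₂).neg
    (fun x hx => (norm_neg _).trans_le (hu₁b _ (one_sub_mem_Icc hx)))
    (fun x hx => (norm_neg _).trans_le (hu₂b _ (one_sub_mem_Icc hx))) hy.reverse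
    (fun j => by
      rw [← hbc j]
      simp [swapEnds]
      ring) (1 - x) (one_sub_mem_Icc hx)
  simpa using this

theorem resolventBound_of_bcDet (hb₁ : b₁ < 0) (hb₂ : 0 < b₂) (hq : BddPot q₁ q₂ q₀) {τ : ℝ}
    (hτ : LargeParam b₁ b₂ q₀ τ) (hlam : lam.im = τ) {A : ℝ} (hA : ∀ i j, ‖a i j‖ ≤ A) {d : ℝ}
    (hd : 0 < d) (hD : ∀ α₁ α₂ β₁ β₂, SpecialPair b₁ b₂ q₁ q₂ lam α₁ α₂ β₁ β₂ →
      d ≤ ‖bcDet a (α₁ 0) (β₁ 0) (α₂ 1) (β₂ 1)‖) :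
    ResolventBound a b₁ b₂ q₁ q₂ lam (2 / τ * (1 + 80 * A ^ 2 / d)) := by
  intro u₁ u₂ y₁ y₂ U hu₁ hu₂ hu₁b hu₂b hy hbc x hx
  obtain ⟨α₁, α₂, β₁, β₂, h⟩ := SpecialPair.exists hb₁ hb₂ hq hτ hlam
  have hDd := hD _ _ _ _ h
  have h1 := hy.norm_le_of_bc hb₁ hb₂ hq hτ hlam hA h (norm_pos_iff.1 (hd.trans_le hDd)) hu₁ hu₂
    hu₁b hu₂b hbc x hx
  have hτ0 := hτ.pos
  have hU : 0 ≤ U := (norm_nonneg _).trans (hu₁b x hx)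
  have h2 : 2 * U / τ * (1 + 80 * A ^ 2 / ‖bcDet a (α₁ 0) (β₁ 0) (α₂ 1) (β₂ 1)‖) ≤
      2 / τ * (1 + 80 * A ^ 2 / d) * U := by
    calc _ ≤ 2 * U / τ * (1 + 80 * A ^ 2 / d) := by gcongr
      _ = _ := by ring
  exact ⟨h1.1.trans h2, h1.2.trans h2⟩

theorem exists_bound_coeff (a : Fin 2 → Fin 4 → ℂ) : ∃ A, ∀ i j, ‖a i j‖ ≤ A :=
  ⟨∑ i, ∑ j, ‖a i j‖, fun i j =>
    (Finset.single_le_sum (f := fun j => ‖a i j‖) (fun _ _ => norm_nonneg _) (Finset.mem_univ j)).trans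
      (Finset.single_le_sum (f := fun i => ∑ j, ‖a i j‖)
        (fun _ _ => Finset.sum_nonneg fun _ _ => norm_nonneg _) (Finset.mem_univ i))⟩

theorem exists_resolventBound (hb₁ : b₁ < 0) (hb₂ : 0 < b₂) (hq : BddPot q₁ q₂ q₀) {K : ℝ} {m : ℕ}
    (hK : FlatPot q₁ q₂ K m) (hJ : Jdet a 2 1 = 0) {k : ℕ} (hk : k ≤ 2 * m) {K' : ℝ} {p : ℂ}
    (hPK : ∀ t ∈ Icc (0 : ℝ) 1,
      ‖Jdet a 0 2 * b₁ * q₁ t + Jdet a 3 1 * b₂ * q₂ (1 - t)‖ ≤ K' * t ^ k)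
    (hPlim : Tendsto (fun t : ℝ => (Jdet a 0 2 * b₁ * q₁ t + Jdet a 3 1 * b₂ * q₂ (1 - t)) / (t : ℂ) ^ k)
      (𝓝[>] 0) (𝓝 p)) (hp : p ≠ 0) (ε : ℝ) :
    ∃ C, 0 ≤ C ∧ ∀ᶠ τ : ℝ in atTop,
      ResolventBound a b₁ b₂ q₁ q₂ ((ε + Complex.I) * τ) (C * τ ^ k) := by
  obtain ⟨c, hc, h⟩ := eventually_bcDet_lower_bound hb₁ hb₂ hq hK hJ hk hPK hPlim hp ε
  obtain ⟨A, hA⟩ := exists_bound_coeff a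
  refine ⟨2 * (1 + 80 * A ^ 2 / c), by positivity, ?_⟩
  filter_upwards [h, eventually_largeParam b₁ b₂ q₀, eventually_ge_atTop 1] with τ h hτ hτ1
  have hτ0 := hτ.pos
  have hb := resolventBound_of_bcDet hb₁ hb₂ hq hτ (by simp) hA (by positivity) h
  intro u₁ u₂ y₁ y₂ U hu₁ hu₂ hu₁b hu₂b hy hbc x hx
  have hU : 0 ≤ U := (norm_nonneg _).trans (hu₁b x hx)
  have h1 := hb _ _ _ _ U hu₁ hu₂ hu₁b hu₂b hy hbc x hx
  have h2 : 2 / τ * (1 + 80 * A ^ 2 / (c / τ ^ (k + 1))) * U ≤ 2 * (1 + 80 * A ^ 2 / c) * τ ^ k * U := by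
    refine mul_le_mul_of_nonneg_right ?_ hU
    calc 2 / τ * (1 + 80 * A ^ 2 / (c / τ ^ (k + 1)))
        ≤ 2 / τ * (τ ^ (k + 1) + 80 * A ^ 2 / (c / τ ^ (k + 1))) := by
          gcongr
          exact one_le_pow₀ hτ1
      _ = _ := by
          field_simp
          ring
  exact ⟨h1.1.trans h2, h1.2.trans h2⟩

theorem exists_resolventBound_neg (hb₁ : b₁ < 0) (hb₂ : 0 < b₂) (hq : BddPot q₁ q₂ q₀)
    (hJ : Jdet a 0 3 ≠ 0) (ε : ℝ) :
    ∃ C, 0 ≤ C ∧ ∀ᶠ τ : ℝ in atTop,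
      ResolventBound a b₁ b₂ q₁ q₂ (-((ε + Complex.I) * τ)) (C / τ) := by
  obtain ⟨c, hc, h⟩ := eventually_bcDet_lower_bound_of_ne (a := swapEnds a) hb₁ hb₂ hq.reverse
    (by simpa [Jdet, swapEnds] using hJ)
  obtain ⟨A, hA⟩ := exists_bound_coeff (swapEnds a)
  refine ⟨2 * (1 + 80 * A ^ 2 / c), by positivity, ?_⟩
  filter_upwards [h, eventually_largeParam b₁ b₂ q₀] with τ h hτ
  have hb := resolventBound_of_bcDet (lam := (ε + Complex.I) * τ) hb₁ hb₂ hq.reverse hτ (by simp) hA hc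
    (fun α₁ α₂ β₁ β₂ => h _ α₁ α₂ β₁ β₂ (by simp))
  rw [show 2 * (1 + 80 * A ^ 2 / c) / τ = 2 / τ * (1 + 80 * A ^ 2 / c) by ring]
  exact ResolventBound.reverse (by simpa using hb)

end Bounds

section Taylor

theorem taylor_flat {f : ℝ → ℂ} {k : ℕ} (hf : ContDiffOn ℝ k f (Icc 0 1))
    (h0 : ∀ j < k, iteratedDerivWithin j f (Icc 0 1) 0 = 0) :
    (∃ K, ∀ t ∈ Icc (0 : ℝ) 1, ‖f t‖ ≤ K * t ^ k) ∧
      Tendsto (fun t : ℝ => f t / (t : ℂ) ^ k) (𝓝[>] 0)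
        (𝓝 (iteratedDerivWithin k f (Icc 0 1) 0 / k.factorial)) := by
  have hT : ∀ t, taylorWithinEval f k (Icc 0 1) 0 t =
      (t : ℂ) ^ k * (iteratedDerivWithin k f (Icc 0 1) 0 / k.factorial) := by
    intro t
    rw [taylor_within_apply, Finset.sum_range_succ, Finset.sum_eq_zero, zero_add, sub_zero,
      Complex.real_smul]
    · push_cast
      ring
    · intro j hj
      rw [h0 j (Finset.mem_range.1 hj), smul_zero]
  have hlittle := taylor_isLittleO (convex_Icc (0 : ℝ) 1) (x₀ := 0) (by simp) hf
  set c := iteratedDerivWithin k f (Icc 0 1) 0 / (k.factorial : ℂ) with hc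
  simp only [hT, sub_zero] at hlittle
  have hlim : Tendsto (fun t : ℝ => f t / (t : ℂ) ^ k) (𝓝[>] 0) (𝓝 c) := by
    have h1 : (fun t : ℝ => f t - (t : ℂ) ^ k * c) =o[𝓝[>] 0] (fun t : ℝ => t ^ k) :=
      hlittle.mono (le_trans (nhdsWithin_le_of_mem (Icc_mem_nhdsGT zero_lt_one)) le_rfl)
    have h2 : Tendsto (fun t : ℝ => (f t - (t : ℂ) ^ k * c) / (t : ℂ) ^ k) (𝓝[>] 0) (𝓝 0) := by
      have h3 : (fun t : ℝ => f t - (t : ℂ) ^ k * c) =o[𝓝[>] 0] (fun t : ℝ => (t : ℂ) ^ k) :=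
        h1.trans_isBigO (Asymptotics.isBigO_of_le _ fun t => by simp)
      exact h3.tendsto_div_nhds_zero
    have h4 := h2.add_const c
    rw [zero_add] at h4
    refine h4.congr' ?_
    filter_upwards [self_mem_nhdsWithin] with t ht
    have : (t : ℂ) ≠ 0 := by exact_mod_cast (ne_of_gt ht)
    field_simp
    ring
  refine ⟨?_, hlim⟩
  have hev : ∀ᶠ t in 𝓝[Icc 0 1] (0 : ℝ), ‖f t‖ ≤ (‖c‖ + 1) * t ^ k := by
    filter_upwards [hlittle.bound zero_lt_one, self_mem_nhdsWithin] with t ht ht1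
    rw [one_mul] at ht
    have h5 : ‖t ^ k‖ = t ^ k := by rw [Real.norm_eq_abs, abs_of_nonneg (pow_nonneg ht1.1 k)]
    have h6 : ‖(t : ℂ) ^ k * c‖ = ‖c‖ * t ^ k := by
      rw [norm_mul, norm_pow, Complex.norm_real, Real.norm_of_nonneg ht1.1, mul_comm]
    have h7 := norm_le_norm_add_norm_sub' (f t) ((t : ℂ) ^ k * c)
    linarith
  obtain ⟨δ, hδ, hδ'⟩ := Metric.mem_nhdsWithin_iff.1 hev
  obtain ⟨S, hS⟩ := isCompact_Icc.exists_bound_of_continuousOn hf.continuousOn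
  refine ⟨max (‖c‖ + 1) (S / δ ^ k), fun t ht => ?_⟩
  by_cases h : t < δ
  · refine (hδ' ⟨by simpa [abs_of_nonneg ht.1] using h, ht⟩).trans ?_
    have := pow_nonneg ht.1 k
    gcongr
    exact le_max_left _ _
  · push Not at h
    have hS0 : 0 ≤ S := (norm_nonneg _).trans (hS t ht)
    calc ‖f t‖ ≤ S := hS t ht
      _ = S / δ ^ k * δ ^ k := by field_simp
      _ ≤ S / δ ^ k * t ^ k := by gcongr
      _ ≤ _ := by
        have := pow_nonneg ht.1 k
        gcongr
        exact le_max_right _ _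

end Taylor

section Bounds

variable {a : Fin 2 → Fin 4 → ℂ} {b₁ b₂ : ℝ} {Q12 Q21 q₁ q₂ : ℝ → ℂ} {lam : ℂ} {M : ℝ}

theorem ResolventBound.congr (h : ResolventBound a b₁ b₂ Q12 Q21 lam M)
    (hq₁ : ∀ x ∈ I01, q₁ x = Q12 x) (hq₂ : ∀ x ∈ I01, q₂ x = Q21 x) :
    ResolventBound a b₁ b₂ q₁ q₂ lam M := by
  intro u₁ u₂ y₁ y₂ U hu₁ hu₂ hu₁b hu₂b hy hbc
  refine h u₁ u₂ y₁ y₂ U hu₁ hu₂ hu₁b hu₂b ⟨hy.cont₁, hy.cont₂, fun x hx => ?_, fun x hx => ?_⟩ hbc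
  · rw [← hq₁ x (Ioo_subset_Icc_self hx)]
    exact hy.deriv₁ x hx
  · rw [← hq₂ x (Ioo_subset_Icc_self hx)]
    exact hy.deriv₂ x hx

theorem exists_bddPot (hQ12 : ContinuousOn Q12 I01) (hQ21 : ContinuousOn Q21 I01) :
    ∃ q₀, BddPot Q12 Q21 q₀ := by
  obtain ⟨S₁, hS₁⟩ := isCompact_Icc.exists_bound_of_continuousOn (s := Icc (0 : ℝ) 1) hQ12
  obtain ⟨S₂, hS₂⟩ := isCompact_Icc.exists_bound_of_continuousOn (s := Icc (0 : ℝ) 1) hQ21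
  exact ⟨max S₁ S₂, hQ12, hQ21, fun x hx => (hS₁ x hx).trans (le_max_left _ _),
    fun x hx => (hS₂ x hx).trans (le_max_right _ _)⟩

theorem mapsTo_one_sub : MapsTo (fun x : ℝ => 1 - x) (Icc 0 1) (Icc 0 1) :=
  fun _ hx => one_sub_mem_Icc hx

open scoped Pointwise in
theorem iteratedDerivWithin_comp_one_sub (f : ℝ → ℂ) (j : ℕ) (x : ℝ) :
    iteratedDerivWithin j (fun t => f (1 - t)) (Icc 0 1) x =
      (-1 : ℝ) ^ j • iteratedDerivWithin j f (Icc 0 1) (1 - x) := by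
  have hs : (1 : ℝ) +ᵥ -Icc (0 : ℝ) 1 = Icc 0 1 := by
    ext x
    rw [Set.mem_vadd_set_iff_neg_vadd_mem]
    simp [add_comm]
  simp only [iteratedDerivWithin_comp_const_sub, hs]

theorem exists_resolventBound_of_iteratedDerivWithin (hb₁ : b₁ < 0) (hb₂ : 0 < b₂) {N m : ℕ}
    (hQ12 : ContDiffOn ℝ N Q12 I01) (hQ21 : ContDiffOn ℝ N Q21 I01) (hmN : m ≤ N) (hNm : N ≤ 2 * m)
    (hJ : Jdet a 2 1 = 0)
    (hPn : iteratedDerivWithin N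
      (fun x => Jdet a 0 2 * b₁ * Q12 x + Jdet a 3 1 * b₂ * Q21 (1 - x)) I01 0 ≠ 0)
    (hQ0 : ∀ j < m, iteratedDerivWithin j Q12 I01 0 = 0 ∧ iteratedDerivWithin j Q21 I01 1 = 0) :
    ∃ k : ℕ, ∀ ε : ℝ, ∃ C, 0 ≤ C ∧ ∀ᶠ τ : ℝ in atTop,
      ResolventBound a b₁ b₂ Q12 Q21 ((ε + Complex.I) * τ) (C * τ ^ k) := by
  rw [I01] at *
  set P : ℝ → ℂ := fun x => Jdet a 0 2 * b₁ * Q12 x + Jdet a 3 1 * b₂ * Q21 (1 - x) with hP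
  obtain ⟨q₀, hq⟩ := exists_bddPot hQ12.continuousOn hQ21.continuousOn
  have hR : ContDiffOn ℝ N (fun t => Q21 (1 - t)) (Icc 0 1) :=
    hQ21.comp (contDiffOn_const.sub contDiffOn_id) mapsTo_one_sub
  have hPc : ContDiffOn ℝ N P (Icc 0 1) :=
    (contDiffOn_const.mul hQ12).add (contDiffOn_const.mul hR)
  have hmN' : (m : WithTop ℕ∞) ≤ N := by exact_mod_cast hmN
  obtain ⟨⟨K₁, hK₁⟩, -⟩ := taylor_flat (hQ12.of_le hmN') fun j hj => (hQ0 j hj).1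
  obtain ⟨⟨K₂, hK₂⟩, -⟩ := taylor_flat (hR.of_le hmN') fun j hj => by
    rw [iteratedDerivWithin_comp_one_sub, sub_zero, (hQ0 j hj).2, smul_zero]
  have hflat : FlatPot Q12 Q21 (max K₁ K₂) m := by
    constructor
    · intro x hx
      refine (hK₁ x hx).trans (mul_le_mul_of_nonneg_right (le_max_left _ _) (pow_nonneg hx.1 m))
    · intro x hx
      refine (hK₂ x hx).trans (mul_le_mul_of_nonneg_right (le_max_right _ _) (pow_nonneg hx.1 m))
  classical
  have hex : ∃ k, iteratedDerivWithin k P (Icc 0 1) 0 ≠ 0 := ⟨N, hPn⟩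
  have hkN : Nat.find hex ≤ N := Nat.find_min' hex hPn
  obtain ⟨⟨K', hK'⟩, hlim⟩ := taylor_flat (hPc.of_le (by exact_mod_cast hkN))
    fun j hj => not_not.1 (Nat.find_min hex hj)
  exact ⟨Nat.find hex, exists_resolventBound hb₁ hb₂ hq hflat hJ (hkN.trans hNm) hK' hlim
    (div_ne_zero (Nat.find_spec hex) (by exact_mod_cast (Nat.find hex).factorial_ne_zero))⟩

end Bounds

section Cramer

variable (a : Fin 2 → Fin 4 → ℂ) (b₁ b₂ : ℝ) (q₁ q₂ : C(Icc (0 : ℝ) 1, ℂ)) (lam : ℂ) (u : Curve)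

/-- The boundary functionals on continuous curves. -/
def bcFun (j : Fin 2) : Curve →L[ℂ] ℂ :=
  (a j 0 • ContinuousLinearMap.fst ℂ ℂ ℂ + a j 1 • ContinuousLinearMap.snd ℂ ℂ ℂ) ∘L
      ContinuousMap.evalCLM ℂ ⟨0, by simp⟩ +
    (a j 2 • ContinuousLinearMap.fst ℂ ℂ ℂ + a j 3 • ContinuousLinearMap.snd ℂ ℂ ℂ) ∘L
      ContinuousMap.evalCLM ℂ ⟨1, by simp⟩

theorem bcFun_apply (j : Fin 2) (y : Curve) : bcFun a j y =
    a j 0 * (ext01 y 0).1 + a j 1 * (ext01 y 0).2 + a j 2 * (ext01 y 1).1 + a j 3 * (ext01 y 1).2 := by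
  rw [ext01, IccExtend_left, IccExtend_right]
  simp [bcFun]
  ring

theorem satisfiesBC_iff (y : Curve) : SatisfiesBC a (ext01 y) ↔ ∀ j, bcFun a j y = 0 := by
  simp only [bcFun_apply, SatisfiesBC]

/-- The characteristic determinant. -/
def charDet : ℂ :=
  bcFun a 0 (fundSol b₁ b₂ q₁ q₂ lam (1, 0)) * bcFun a 1 (fundSol b₁ b₂ q₁ q₂ lam (0, 1)) -
    bcFun a 0 (fundSol b₁ b₂ q₁ q₂ lam (0, 1)) * bcFun a 1 (fundSol b₁ b₂ q₁ q₂ lam (1, 0))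

/-- The initial value of the numerator of the Green operator. -/
def numInit : ℂ × ℂ :=
  (bcFun a 0 (fundSol b₁ b₂ q₁ q₂ lam (0, 1)) * bcFun a 1 (partSol b₁ b₂ q₁ q₂ lam u) -
      bcFun a 0 (partSol b₁ b₂ q₁ q₂ lam u) * bcFun a 1 (fundSol b₁ b₂ q₁ q₂ lam (0, 1)),
    bcFun a 0 (partSol b₁ b₂ q₁ q₂ lam u) * bcFun a 1 (fundSol b₁ b₂ q₁ q₂ lam (1, 0)) -
      bcFun a 0 (fundSol b₁ b₂ q₁ q₂ lam (1, 0)) * bcFun a 1 (partSol b₁ b₂ q₁ q₂ lam u))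

/-- The numerator of the Green operator. -/
def greenNum : Curve :=
  charDet a b₁ b₂ q₁ q₂ lam • partSol b₁ b₂ q₁ q₂ lam u +
    (numInit a b₁ b₂ q₁ q₂ lam u).1 • fundSol b₁ b₂ q₁ q₂ lam (1, 0) +
    (numInit a b₁ b₂ q₁ q₂ lam u).2 • fundSol b₁ b₂ q₁ q₂ lam (0, 1)

theorem bcFun_greenNum (j : Fin 2) : bcFun a j (greenNum a b₁ b₂ q₁ q₂ lam u) = 0 := by
  simp only [greenNum, map_add, map_smul, smul_eq_mul, charDet, numInit]
  fin_cases j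
  · simp only [Fin.zero_eta]
    ring
  · simp only [Fin.mk_one]
    ring

/-- Constant curves. -/
def constCurve : ℂ × ℂ →L[ℂ] Curve := ContinuousLinearMap.const ℂ _

theorem constCurve_apply (v : ℂ × ℂ) : constCurve v = ContinuousMap.const _ v := rfl

theorem greenNum_eq : greenNum a b₁ b₂ q₁ q₂ lam u =
    charDet a b₁ b₂ q₁ q₂ lam • primitive (leadOp b₁ b₂ u) + constCurve (numInit a b₁ b₂ q₁ q₂ lam u) +
      diracVolterra b₁ b₂ q₁ q₂ lam (greenNum a b₁ b₂ q₁ q₂ lam u) := by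
  set Δ := charDet a b₁ b₂ q₁ q₂ lam with hΔ
  set v := numInit a b₁ b₂ q₁ q₂ lam u with hv
  have h1 : constCurve v = v.1 • constCurve (1, 0) + v.2 • constCurve (0, 1) := by
    rw [← map_smul, ← map_smul, ← map_add]
    simp
  have hW := partSol_spec b₁ b₂ q₁ q₂ lam u
  have hΦ := fundSol_spec b₁ b₂ q₁ q₂ lam
  simp only [← constCurve_apply] at hΦ
  rw [greenNum, ← hΔ, ← hv, map_add, map_add, map_smul, map_smul, map_smul, h1]
  linear_combination (norm := module) Δ • hW + v.1 • hΦ (1, 0) + v.2 • hΦ (0, 1)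

end Cramer

section IteratedDeriv

variable {E F : Type*} [NormedAddCommGroup E] [NormedSpace ℂ E] [CompleteSpace E]
  [NormedAddCommGroup F] [NormedSpace ℂ F]

theorem Differentiable.hasDerivAt_iteratedDeriv {g : ℂ → E} (hg : Differentiable ℂ g) (k : ℕ) (z : ℂ) :
    HasDerivAt (iteratedDeriv k g) (iteratedDeriv (k + 1) g z) z := by
  rw [iteratedDeriv_succ]
  exact ((hg.contDiff (n := k + 1)).differentiable_iteratedDeriv k (by
    exact_mod_cast k.lt_succ_self) z).hasDerivAt

theorem ContinuousLinearMap.iteratedDeriv_comp (L : E →L[ℂ] F) {g : ℂ → E} (hg : Differentiable ℂ g)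
    (k : ℕ) : iteratedDeriv k (fun z => L (g z)) = fun z => L (iteratedDeriv k g z) := by
  induction k with
  | zero => simp
  | succ k ih =>
    ext z
    rw [iteratedDeriv_succ, ih]
    exact (L.hasFDerivAt.comp_hasDerivAt z (hg.hasDerivAt_iteratedDeriv k z)).deriv

theorem iteratedDeriv_eq_of_affine {A B : E →L[ℂ] E} {N f : ℂ → E} (hN : Differentiable ℂ N)
    (hf : Differentiable ℂ f) (h : ∀ z, N z = f z + (A (N z) + z • B (N z))) (k : ℕ) (z : ℂ) :
    iteratedDeriv (k + 1) N z = iteratedDeriv (k + 1) f z +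
      (A (iteratedDeriv (k + 1) N z) + z • B (iteratedDeriv (k + 1) N z)) +
        (k + 1 : ℂ) • B (iteratedDeriv k N z) := by
  have key : ∀ z j w, (∀ z, iteratedDeriv j N z = iteratedDeriv j f z +
      (A (iteratedDeriv j N z) + z • B (iteratedDeriv j N z)) + (j : ℂ) • w z) →
      ∀ w', HasDerivAt w w' z → iteratedDeriv (j + 1) N z = iteratedDeriv (j + 1) f z +
      (A (iteratedDeriv (j + 1) N z) + z • B (iteratedDeriv (j + 1) N z)) + B (iteratedDeriv j N z)
        + (j : ℂ) • w' := by
    intro z j w hj w' hw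
    have h1 := hN.hasDerivAt_iteratedDeriv j z
    have h2 := hf.hasDerivAt_iteratedDeriv j z
    have h3 := (h2.add ((A.hasFDerivAt.comp_hasDerivAt z h1).add
      ((hasDerivAt_id z).smul (B.hasFDerivAt.comp_hasDerivAt z h1)))).add (hw.const_smul (j : ℂ))
    have h4 : iteratedDeriv j N = _ := funext hj
    rw [h4] at h1
    have h5 := h1.unique h3
    nth_rw 1 [h5]
    simp only [id, one_smul, Function.comp_apply]
    abel
  induction k generalizing z with
  | zero =>
    have := key z 0 0 (fun z => by simpa using h z) 0 (hasDerivAt_const z 0)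
    simpa using this
  | succ k ih =>
    refine (key z (k + 1) (fun z => B (iteratedDeriv k N z)) (fun z => by simpa using ih z) _
      (B.hasFDerivAt.comp_hasDerivAt z (hN.hasDerivAt_iteratedDeriv k z))).trans ?_
    push_cast
    rw [add_smul ((k : ℂ) + 1), one_smul]
    abel

end IteratedDeriv

theorem smul_eq_of_affine {E : Type*} [NormedAddCommGroup E] [NormedSpace ℂ E] {A B : E →L[ℂ] E}
    {f n m : E} {z r c d : ℂ} (h : n = f + (A n + z • B n) + r • B m) (hc : c * r = d) :
    c • n = c • f + B (d • m) + (A (c • n) + z • B (c • n)) := by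
  rw [← hc]
  simp only [map_smul]
  linear_combination (norm := module) c • h

section Green

variable (a : Fin 2 → Fin 4 → ℂ) (b₁ b₂ : ℝ) (q₁ q₂ : C(Icc (0 : ℝ) 1, ℂ)) (lam : ℂ) (u : Curve)

theorem differentiable_fundSol (v : ℂ × ℂ) : Differentiable ℂ fun z => fundSol b₁ b₂ q₁ q₂ z v :=
  (differentiable_diracResolvent b₁ b₂ q₁ q₂).clm_apply (differentiable_const _)

theorem differentiable_partSol : Differentiable ℂ fun z => partSol b₁ b₂ q₁ q₂ z u :=
  (differentiable_diracResolvent b₁ b₂ q₁ q₂).clm_apply (differentiable_const _)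

theorem differentiable_bcFun_fundSol (j : Fin 2) (v : ℂ × ℂ) :
    Differentiable ℂ fun z => bcFun a j (fundSol b₁ b₂ q₁ q₂ z v) :=
  (bcFun a j).differentiable.comp (differentiable_fundSol b₁ b₂ q₁ q₂ v)

theorem differentiable_bcFun_partSol (j : Fin 2) :
    Differentiable ℂ fun z => bcFun a j (partSol b₁ b₂ q₁ q₂ z u) :=
  (bcFun a j).differentiable.comp (differentiable_partSol b₁ b₂ q₁ q₂ u)

theorem differentiable_charDet : Differentiable ℂ (charDet a b₁ b₂ q₁ q₂) :=
  ((differentiable_bcFun_fundSol a b₁ b₂ q₁ q₂ 0 _).mul (differentiable_bcFun_fundSol a b₁ b₂ q₁ q₂ 1 _)).sub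
    ((differentiable_bcFun_fundSol a b₁ b₂ q₁ q₂ 0 _).mul (differentiable_bcFun_fundSol a b₁ b₂ q₁ q₂ 1 _))

theorem differentiable_numInit : Differentiable ℂ fun z => numInit a b₁ b₂ q₁ q₂ z u :=
  (((differentiable_bcFun_fundSol a b₁ b₂ q₁ q₂ 0 _).mul (differentiable_bcFun_partSol a b₁ b₂ q₁ q₂ u 1)).sub
    ((differentiable_bcFun_partSol a b₁ b₂ q₁ q₂ u 0).mul (differentiable_bcFun_fundSol a b₁ b₂ q₁ q₂ 1 _))).prodMk
  (((differentiable_bcFun_partSol a b₁ b₂ q₁ q₂ u 0).mul (differentiable_bcFun_fundSol a b₁ b₂ q₁ q₂ 1 _)).sub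
    ((differentiable_bcFun_fundSol a b₁ b₂ q₁ q₂ 0 _).mul (differentiable_bcFun_partSol a b₁ b₂ q₁ q₂ u 1)))

theorem differentiable_greenNum : Differentiable ℂ fun z => greenNum a b₁ b₂ q₁ q₂ z u :=
  (((differentiable_charDet a b₁ b₂ q₁ q₂).smul (differentiable_partSol b₁ b₂ q₁ q₂ u)).add
    ((differentiable_numInit a b₁ b₂ q₁ q₂ u).fst.smul (differentiable_fundSol b₁ b₂ q₁ q₂ _))).add
      ((differentiable_numInit a b₁ b₂ q₁ q₂ u).snd.smul (differentiable_fundSol b₁ b₂ q₁ q₂ _))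

/-- The Taylor coefficients of the numerator of the Green operator. -/
def greenCoeff (k : ℕ) : Curve :=
  (k.factorial : ℂ)⁻¹ • iteratedDeriv k (fun z => greenNum a b₁ b₂ q₁ q₂ z u) lam

theorem bcFun_greenCoeff (j : Fin 2) (k : ℕ) : bcFun a j (greenCoeff a b₁ b₂ q₁ q₂ lam u k) = 0 := by
  have h := congrFun ((bcFun a j).iteratedDeriv_comp (differentiable_greenNum a b₁ b₂ q₁ q₂ u) k) lam
  simp only [bcFun_greenNum] at h
  rw [greenCoeff, map_smul, ← h]
  simp

variable {a b₁ b₂ q₁ q₂ lam}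

theorem exists_iteratedDeriv_init {k : ℕ} (hk : iteratedDeriv k (charDet a b₁ b₂ q₁ q₂) lam = 0) :
    ∃ v, iteratedDeriv k (fun z => charDet a b₁ b₂ q₁ q₂ z • primitive (leadOp b₁ b₂ u) +
      constCurve (numInit a b₁ b₂ q₁ q₂ z u)) lam = constCurve v := by
  set g : ℂ → ℂ × (ℂ × ℂ) := fun z => (charDet a b₁ b₂ q₁ q₂ z, numInit a b₁ b₂ q₁ q₂ z u) with hgdef
  have hg : Differentiable ℂ g :=
    (differentiable_charDet a b₁ b₂ q₁ q₂).prodMk (differentiable_numInit a b₁ b₂ q₁ q₂ u)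
  have h1 := congrFun ((ContinuousLinearMap.fst ℂ ℂ (ℂ × ℂ)).iteratedDeriv_comp hg k) lam
  have h2 : (iteratedDeriv k g lam).1 = 0 := h1.symm.trans hk
  set L : ℂ × (ℂ × ℂ) →L[ℂ] Curve :=
    ContinuousLinearMap.toSpanSingleton ℂ (primitive (leadOp b₁ b₂ u)) ∘L
      ContinuousLinearMap.fst ℂ ℂ (ℂ × ℂ) + constCurve ∘L ContinuousLinearMap.snd ℂ ℂ (ℂ × ℂ) with hL
  have h3 := congrFun (L.iteratedDeriv_comp hg k) lam
  refine ⟨(iteratedDeriv k g lam).2, h3.trans ?_⟩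
  rw [hL]
  simp [h2]

theorem greenNum_affine (z : ℂ) : greenNum a b₁ b₂ q₁ q₂ z u =
    charDet a b₁ b₂ q₁ q₂ z • primitive (leadOp b₁ b₂ u) + constCurve (numInit a b₁ b₂ q₁ q₂ z u) +
      ((primitive ∘L potOp b₁ b₂ q₁ q₂) (greenNum a b₁ b₂ q₁ q₂ z u) +
        z • (primitive ∘L leadOp b₁ b₂) (greenNum a b₁ b₂ q₁ q₂ z u)) :=
  greenNum_eq a b₁ b₂ q₁ q₂ z u

theorem differentiable_init : Differentiable ℂ fun z =>
    charDet a b₁ b₂ q₁ q₂ z • primitive (leadOp b₁ b₂ u) + constCurve (numInit a b₁ b₂ q₁ q₂ z u) :=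
  ((differentiable_charDet a b₁ b₂ q₁ q₂).smul_const _).add
    (constCurve.differentiable.comp (differentiable_numInit a b₁ b₂ q₁ q₂ u))

theorem curveSol_greenCoeff_zero (h : charDet a b₁ b₂ q₁ q₂ lam = 0) :
    CurveSol b₁ b₂ q₁ q₂ lam 0 (greenCoeff a b₁ b₂ q₁ q₂ lam u 0) := by
  refine ⟨numInit a b₁ b₂ q₁ q₂ lam u, ?_⟩
  have h1 := greenNum_eq a b₁ b₂ q₁ q₂ lam u
  rw [h, zero_smul ℂ (primitive (leadOp b₁ b₂ u)), zero_add] at h1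
  simpa [greenCoeff, constCurve_apply] using h1

theorem curveSol_greenCoeff_succ {k : ℕ} (h : iteratedDeriv (k + 1) (charDet a b₁ b₂ q₁ q₂) lam = 0) :
    CurveSol b₁ b₂ q₁ q₂ lam (greenCoeff a b₁ b₂ q₁ q₂ lam u k)
      (greenCoeff a b₁ b₂ q₁ q₂ lam u (k + 1)) := by
  obtain ⟨v, hv⟩ := exists_iteratedDeriv_init u h
  have h1 := iteratedDeriv_eq_of_affine (differentiable_greenNum a b₁ b₂ q₁ q₂ u)
    (differentiable_init u) (greenNum_affine u) k lam
  rw [hv] at h1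
  refine ⟨((k + 1).factorial : ℂ)⁻¹ • v, ?_⟩
  have hk : ((k : ℂ) + 1) ≠ 0 := by exact_mod_cast k.succ_ne_zero
  have hf : (k.factorial : ℂ) ≠ 0 := by exact_mod_cast k.factorial_ne_zero
  have h2 : ((k + 1).factorial : ℂ)⁻¹ * (k + 1) = (k.factorial : ℂ)⁻¹ := by
    rw [Nat.factorial_succ]
    push_cast
    field_simp
  exact smul_eq_of_affine h1 h2

end Green

theorem isRootFunction_of_chain {a : Fin 2 → Fin 4 → ℂ} {b₁ b₂ : ℝ} {q₁ q₂ : C(Icc (0 : ℝ) 1, ℂ)}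
    {Q12 Q21 : ℝ → ℂ} (hb₁ : b₁ ≠ 0) (hb₂ : b₂ ≠ 0) (hq₁ : ∀ x ∈ I01, ext01 q₁ x = Q12 x)
    (hq₂ : ∀ x ∈ I01, ext01 q₂ x = Q21 x) {lam : ℂ} {c : ℕ → Curve} {k : ℕ}
    (hbc : ∀ i j, bcFun a j (c i) = 0) (h0 : CurveSol b₁ b₂ q₁ q₂ lam 0 (c 0))
    (h1 : ∀ i < k, CurveSol b₁ b₂ q₁ q₂ lam (c i) (c (i + 1))) (hk : c k ≠ 0) :
    IsRootFunction b₁ b₂ Q12 Q21 a (ext01 (c k)) := by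
  classical
  have hex : ∃ i, c i ≠ 0 := ⟨k, hk⟩
  set s := Nat.find hex with hs
  have hsk : s ≤ k := Nat.find_min' hex hk
  have hs0 : c s ≠ 0 := Nat.find_spec hex
  have hstart : CurveSol b₁ b₂ q₁ q₂ lam 0 (c s) := by
    rcases Nat.eq_zero_or_pos s with h | h
    · rwa [h]
    · have h2 := h1 (s - 1) (by omega)
      rwa [not_not.1 (Nat.find_min hex (show s - 1 < s by omega)), Nat.sub_add_cancel h] at h2
  refine ⟨lam, k - s, fun i => ext01 (c (s + i)), fun j _ => (satisfiesBC_iff a _).2 (hbc _), ?_, ?_,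
    fun j hj hjk => ?_, k - s, le_rfl, by simp [Nat.add_sub_cancel' hsk]⟩
  · by_contra! h
    refine hs0 (ContinuousMap.ext fun x => ?_)
    have h2 := h x x.2
    rwa [add_zero, ext01, IccExtend_val] at h2
  · have h2 := hstart.solvesDirac hb₁ hb₂ hq₁ hq₂
    have h3 : (fun x => lam • ext01 (c s) x + ext01 (0 : Curve) x) = fun x => lam • ext01 (c s) x :=
      funext fun x => add_zero _
    rwa [h3] at h2
  · have h2 := (h1 (s + (j - 1)) (by omega)).solvesDirac hb₁ hb₂ hq₁ hq₂
    rwa [add_assoc, Nat.sub_add_cancel hj] at h2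

section ExpGrowth

variable {E F : Type*} [NormedAddCommGroup E] [NormedAddCommGroup F]

/-- At most exponential growth. -/
def ExpGrowth (f : ℂ → E) : Prop := ∃ C, 0 ≤ C ∧ ∀ z, ‖f z‖ ≤ Real.exp (C * (1 + ‖z‖))

theorem ExpGrowth.add {f g : ℂ → E} (hf : ExpGrowth f) (hg : ExpGrowth g) :
    ExpGrowth fun z => f z + g z := by
  obtain ⟨C, hC, hf⟩ := hf
  obtain ⟨D, hD, hg⟩ := hg
  refine ⟨max C D + 1, by positivity, fun z => ?_⟩
  have h1 : Real.exp (C * (1 + ‖z‖)) ≤ Real.exp (max C D * (1 + ‖z‖)) := by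
    gcongr
    exact le_max_left _ _
  have h2 : Real.exp (D * (1 + ‖z‖)) ≤ Real.exp (max C D * (1 + ‖z‖)) := by
    gcongr
    exact le_max_right _ _
  have h3 : 2 ≤ Real.exp (1 * (1 + ‖z‖)) := by
    have := Real.add_one_le_exp (1 * (1 + ‖z‖))
    linarith [norm_nonneg z]
  calc ‖f z + g z‖ ≤ ‖f z‖ + ‖g z‖ := norm_add_le _ _
    _ ≤ 2 * Real.exp (max C D * (1 + ‖z‖)) := by linarith [hf z, hg z]
    _ ≤ Real.exp (1 * (1 + ‖z‖)) * Real.exp (max C D * (1 + ‖z‖)) := by gcongr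
    _ = _ := by
      rw [← Real.exp_add]
      ring_nf

theorem ExpGrowth.neg {f : ℂ → E} (hf : ExpGrowth f) : ExpGrowth fun z => -f z := by
  obtain ⟨C, hC, hf⟩ := hf
  exact ⟨C, hC, fun z => by simpa using hf z⟩

theorem ExpGrowth.sub {f g : ℂ → E} (hf : ExpGrowth f) (hg : ExpGrowth g) :
    ExpGrowth fun z => f z - g z := by
  simpa [sub_eq_add_neg] using hf.add hg.neg

theorem ExpGrowth.of_norm_mul_le {f : ℂ → E} {g : ℂ → F} {h : ℂ → ℂ} (hf : ExpGrowth f)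
    (hh : ExpGrowth h) (hle : ∀ z, ‖g z‖ ≤ ‖h z‖ * ‖f z‖) : ExpGrowth g := by
  obtain ⟨C, hC, hf⟩ := hf
  obtain ⟨D, hD, hh⟩ := hh
  refine ⟨D + C, by positivity, fun z => ?_⟩
  rw [add_mul, Real.exp_add]
  exact (hle z).trans (mul_le_mul (hh z) (hf z) (norm_nonneg _) (Real.exp_nonneg _))

theorem expGrowth_const (c : E) : ExpGrowth fun _ => c := by
  refine ⟨‖c‖, norm_nonneg c, fun z => ?_⟩
  have h1 := Real.add_one_le_exp (‖c‖ * (1 + ‖z‖))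
  have h2 : ‖c‖ * 1 ≤ ‖c‖ * (1 + ‖z‖) := by
    gcongr
    linarith [norm_nonneg z]
  linarith

variable [NormedSpace ℂ E] [NormedSpace ℂ F]

theorem ExpGrowth.smul {f : ℂ → E} {h : ℂ → ℂ} (hh : ExpGrowth h) (hf : ExpGrowth f) :
    ExpGrowth fun z => h z • f z := hf.of_norm_mul_le hh fun _ => norm_smul_le _ _

theorem ExpGrowth.mul {f : ℂ → ℂ} {h : ℂ → ℂ} (hh : ExpGrowth h) (hf : ExpGrowth f) :
    ExpGrowth fun z => h z * f z := hf.of_norm_mul_le hh fun _ => norm_mul_le _ _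

theorem ExpGrowth.clm_apply {f : ℂ → E →L[ℂ] F} (hf : ExpGrowth f) (x : E) :
    ExpGrowth fun z => f z x := by
  refine hf.of_norm_mul_le (expGrowth_const (‖x‖ : ℂ)) fun z => ?_
  simpa [mul_comm] using (f z).le_opNorm x

theorem ExpGrowth.clm_comp {f : ℂ → E} (hf : ExpGrowth f) (L : E →L[ℂ] F) :
    ExpGrowth fun z => L (f z) := by
  refine hf.of_norm_mul_le (expGrowth_const (‖L‖ : ℂ)) fun z => ?_
  simpa using L.le_opNorm (f z)

end ExpGrowth

section Green

variable (a : Fin 2 → Fin 4 → ℂ) (b₁ b₂ : ℝ) (q₁ q₂ : C(Icc (0 : ℝ) 1, ℂ)) (u : Curve)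

theorem expGrowth_diracResolvent : ExpGrowth (diracResolvent b₁ b₂ q₁ q₂) :=
  norm_diracResolvent_le b₁ b₂ q₁ q₂

theorem expGrowth_fundSol (v : ℂ × ℂ) : ExpGrowth fun z => fundSol b₁ b₂ q₁ q₂ z v :=
  (expGrowth_diracResolvent b₁ b₂ q₁ q₂).clm_apply _

theorem expGrowth_partSol : ExpGrowth fun z => partSol b₁ b₂ q₁ q₂ z u :=
  (expGrowth_diracResolvent b₁ b₂ q₁ q₂).clm_apply _

theorem expGrowth_charDet : ExpGrowth (charDet a b₁ b₂ q₁ q₂) := by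
  have h := fun j v => (expGrowth_fundSol b₁ b₂ q₁ q₂ v).clm_comp (bcFun a j)
  exact ((h 0 _).mul (h 1 _)).sub ((h 0 _).mul (h 1 _))

theorem expGrowth_greenNum : ExpGrowth fun z => greenNum a b₁ b₂ q₁ q₂ z u := by
  have h := fun j v => (expGrowth_fundSol b₁ b₂ q₁ q₂ v).clm_comp (bcFun a j)
  have h' := fun j => (expGrowth_partSol b₁ b₂ q₁ q₂ u).clm_comp (bcFun a j)
  exact (((expGrowth_charDet a b₁ b₂ q₁ q₂).smul (expGrowth_partSol b₁ b₂ q₁ q₂ u)).add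
    ((((h 0 _).mul (h' 1)).sub ((h' 0).mul (h 1 _))).smul (expGrowth_fundSol b₁ b₂ q₁ q₂ _))).add
    ((((h' 0).mul (h 1 _)).sub ((h 0 _).mul (h' 1))).smul (expGrowth_fundSol b₁ b₂ q₁ q₂ _))

end Green

section Uniqueness

variable {a : Fin 2 → Fin 4 → ℂ} {b₁ b₂ : ℝ} {q₁ q₂ : C(Icc (0 : ℝ) 1, ℂ)} {lam : ℂ} {u y z : Curve}
  {M : ℝ}

theorem CurveSol.norm_le (hb : ResolventBound a b₁ b₂ (ext01 q₁) (ext01 q₂) lam M)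
    (hy : CurveSol b₁ b₂ q₁ q₂ lam u y) (hbc : ∀ j, bcFun a j y = 0) : ‖y‖ ≤ M * ‖u‖ := by
  have hu : ∀ x, ‖ext01 u x‖ ≤ ‖u‖ := fun x => u.norm_coe_le_norm _
  have h := hb _ _ _ _ ‖u‖ (continuous_ext01 u).fst.continuousOn (continuous_ext01 u).snd.continuousOn
    (fun x _ => (norm_fst_le _).trans (hu x)) (fun x _ => (norm_snd_le _).trans (hu x)) hy.diracSol
    fun j => by rw [← bcFun_apply, hbc]
  refine (ContinuousMap.norm_le _ ((norm_nonneg _).trans (h 0 (by simp)).1)).2 fun x => ?_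
  have hx := h x x.2
  simp only [ext01, IccExtend_val] at hx
  exact max_le hx.1 hx.2

theorem CurveSol.eq_zero (hb : ResolventBound a b₁ b₂ (ext01 q₁) (ext01 q₂) lam M)
    (hy : CurveSol b₁ b₂ q₁ q₂ lam 0 y) (hbc : ∀ j, bcFun a j y = 0) : y = 0 := by
  have h := hy.norm_le hb hbc
  rw [norm_zero, mul_zero] at h
  exact norm_le_zero_iff.1 h

theorem CurveSol.sub (hy : CurveSol b₁ b₂ q₁ q₂ lam u y) (hz : CurveSol b₁ b₂ q₁ q₂ lam u z) :
    CurveSol b₁ b₂ q₁ q₂ lam 0 (y - z) := by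
  obtain ⟨v, hv⟩ := hy
  obtain ⟨w, hw⟩ := hz
  refine ⟨v - w, ?_⟩
  rw [← constCurve_apply] at *
  rw [map_sub, map_sub, map_zero, map_zero]
  linear_combination (norm := module) hv - hw

theorem fundSol_eq (v : ℂ × ℂ) : fundSol b₁ b₂ q₁ q₂ lam v =
    v.1 • fundSol b₁ b₂ q₁ q₂ lam (1, 0) + v.2 • fundSol b₁ b₂ q₁ q₂ lam (0, 1) := by
  simp only [fundSol, ← constCurve_apply]
  rw [← map_smul, ← map_smul, ← map_smul, ← map_smul, ← map_add, ← map_add]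
  simp

theorem charDet_ne_zero (hb : ResolventBound a b₁ b₂ (ext01 q₁) (ext01 q₂) lam M) :
    charDet a b₁ b₂ q₁ q₂ lam ≠ 0 := by
  intro h
  have key : ∀ v : ℂ × ℂ, (∀ j, v.1 * bcFun a j (fundSol b₁ b₂ q₁ q₂ lam (1, 0)) +
      v.2 * bcFun a j (fundSol b₁ b₂ q₁ q₂ lam (0, 1)) = 0) → v = 0 := by
    intro v hv
    have h1 := (curveSol_fundSol b₁ b₂ q₁ q₂ lam v).eq_zero hb fun j => by
      rw [fundSol_eq, map_add, map_smul, map_smul]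
      exact hv j
    rw [← fundSol_zero b₁ b₂ q₁ q₂ lam v, h1]
    rfl
  rw [charDet] at h
  have h0 := key (bcFun a 0 (fundSol b₁ b₂ q₁ q₂ lam (0, 1)),
    -bcFun a 0 (fundSol b₁ b₂ q₁ q₂ lam (1, 0))) (by
      rw [Fin.forall_fin_two]
      constructor
      · ring
      · linear_combination -h)
  have h1 := key (bcFun a 1 (fundSol b₁ b₂ q₁ q₂ lam (0, 1)),
    -bcFun a 1 (fundSol b₁ b₂ q₁ q₂ lam (1, 0))) (by
      rw [Fin.forall_fin_two]
      constructor
      · linear_combination h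
      · ring)
  simp only [Prod.mk_eq_zero, neg_eq_zero] at h0 h1
  have h2 := key (1, 0) (by
    rw [Fin.forall_fin_two]
    simp [h0, h1])
  simp at h2

theorem curveSol_greenNum (h : charDet a b₁ b₂ q₁ q₂ lam ≠ 0) : CurveSol b₁ b₂ q₁ q₂ lam u
    ((charDet a b₁ b₂ q₁ q₂ lam)⁻¹ • greenNum a b₁ b₂ q₁ q₂ lam u) := by
  refine ⟨(charDet a b₁ b₂ q₁ q₂ lam)⁻¹ • numInit a b₁ b₂ q₁ q₂ lam u, ?_⟩
  have h1 := greenNum_eq a b₁ b₂ q₁ q₂ lam u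
  rw [← constCurve_apply, map_smul, map_smul]
  have h2 : primitive (leadOp b₁ b₂ u) = (charDet a b₁ b₂ q₁ q₂ lam)⁻¹ •
      charDet a b₁ b₂ q₁ q₂ lam • primitive (leadOp b₁ b₂ u) := (inv_smul_smul₀ h _).symm
  rw [h2]
  linear_combination (norm := module) (charDet a b₁ b₂ q₁ q₂ lam)⁻¹ • h1

theorem norm_inv_smul_greenNum_le (hb : ResolventBound a b₁ b₂ (ext01 q₁) (ext01 q₂) lam M) :
    ‖(charDet a b₁ b₂ q₁ q₂ lam)⁻¹ • greenNum a b₁ b₂ q₁ q₂ lam u‖ ≤ M * ‖u‖ :=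
  (curveSol_greenNum (charDet_ne_zero hb)).norm_le hb fun j => by
    rw [map_smul, bcFun_greenNum, smul_zero]

theorem greenNum_eq_smul (hb : ResolventBound a b₁ b₂ (ext01 q₁) (ext01 q₂) lam M)
    (hy : CurveSol b₁ b₂ q₁ q₂ lam u y) (hbc : ∀ j, bcFun a j y = 0) :
    greenNum a b₁ b₂ q₁ q₂ lam u = charDet a b₁ b₂ q₁ q₂ lam • y := by
  have hΔ := charDet_ne_zero hb
  have h := ((curveSol_greenNum hΔ).sub hy).eq_zero hb fun j => by
    rw [map_sub, map_smul, bcFun_greenNum, hbc, smul_zero, sub_zero]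
  rw [sub_eq_zero] at h
  rw [← h, smul_inv_smul₀ hΔ]

end Uniqueness

section Vanishing

variable {a : Fin 2 → Fin 4 → ℂ} {b₁ b₂ : ℝ} {q₁ q₂ : C(Icc (0 : ℝ) 1, ℂ)} {Q12 Q21 : ℝ → ℂ}

theorem iteratedDeriv_functional_greenNum (hb₁ : b₁ ≠ 0) (hb₂ : b₂ ≠ 0)
    (hq₁ : ∀ x ∈ I01, ext01 q₁ x = Q12 x) (hq₂ : ∀ x ∈ I01, ext01 q₂ x = Q21 x)
    {ℓ : Curve →L[ℂ] ℂ} (hℓ : ∀ y : Curve, IsRootFunction b₁ b₂ Q12 Q21 a (ext01 y) → ℓ y = 0)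
    (u : Curve) (lam : ℂ) (k : ℕ) (hk : ∀ j ≤ k, iteratedDeriv j (charDet a b₁ b₂ q₁ q₂) lam = 0) :
    iteratedDeriv k (fun z => ℓ (greenNum a b₁ b₂ q₁ q₂ z u)) lam = 0 := by
  have h1 := congrFun (ℓ.iteratedDeriv_comp (differentiable_greenNum a b₁ b₂ q₁ q₂ u) k) lam
  have h2 : ℓ (greenCoeff a b₁ b₂ q₁ q₂ lam u k) = 0 := by
    by_cases h0 : greenCoeff a b₁ b₂ q₁ q₂ lam u k = 0
    · rw [h0, map_zero]
    · exact hℓ _ (isRootFunction_of_chain hb₁ hb₂ hq₁ hq₂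
        (fun i j => bcFun_greenCoeff a b₁ b₂ q₁ q₂ lam u j i)
        (curveSol_greenCoeff_zero u (by simpa using hk 0 k.zero_le))
        (fun i hi => curveSol_greenCoeff_succ u (hk (i + 1) hi)) h0)
  rw [h1]
  rw [greenCoeff, map_smul, smul_eq_zero] at h2
  exact h2.resolve_left (inv_ne_zero (by exact_mod_cast k.factorial_ne_zero))

theorem norm_quotient_le {lam : ℂ} {M : ℝ}
    (hb : ResolventBound a b₁ b₂ (ext01 q₁) (ext01 q₂) lam M) {ℓ : Curve →L[ℂ] ℂ} {u : Curve} {g : ℂ}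
    (hg : ℓ (greenNum a b₁ b₂ q₁ q₂ lam u) = g * charDet a b₁ b₂ q₁ q₂ lam) :
    ‖g‖ ≤ ‖ℓ‖ * ‖u‖ * M := by
  have h1 : g = ℓ ((charDet a b₁ b₂ q₁ q₂ lam)⁻¹ • greenNum a b₁ b₂ q₁ q₂ lam u) := by
    have := charDet_ne_zero hb
    rw [map_smul, hg, smul_eq_mul]
    field_simp
  rw [h1]
  calc _ ≤ ‖ℓ‖ * ‖(charDet a b₁ b₂ q₁ q₂ lam)⁻¹ • greenNum a b₁ b₂ q₁ q₂ lam u‖ := ℓ.le_opNorm _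
    _ ≤ ‖ℓ‖ * (M * ‖u‖) := mul_le_mul_of_nonneg_left (norm_inv_smul_greenNum_le hb) (norm_nonneg ℓ)
    _ = _ := by ring

theorem functional_greenNum_eq_zero (hb₁ : b₁ ≠ 0) (hb₂ : b₂ ≠ 0)
    (hq₁ : ∀ x ∈ I01, ext01 q₁ x = Q12 x) (hq₂ : ∀ x ∈ I01, ext01 q₂ x = Q21 x)
    {ℓ : Curve →L[ℂ] ℂ} (hℓ : ∀ y : Curve, IsRootFunction b₁ b₂ Q12 Q21 a (ext01 y) → ℓ y = 0)
    {k : ℕ} (hup : ∀ ε : ℝ, ∃ C, 0 ≤ C ∧ ∀ᶠ τ : ℝ in atTop,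
      ResolventBound a b₁ b₂ (ext01 q₁) (ext01 q₂) ((ε + Complex.I) * τ) (C * τ ^ k))
    (hlow : ∀ ε : ℝ, ∃ C, 0 ≤ C ∧ ∀ᶠ τ : ℝ in atTop,
      ResolventBound a b₁ b₂ (ext01 q₁) (ext01 q₂) (-((ε + Complex.I) * τ)) (C / τ)) (u : Curve) (z : ℂ) :
    ℓ (greenNum a b₁ b₂ q₁ q₂ z u) = 0 := by
  set Δ := charDet a b₁ b₂ q₁ q₂ with hΔ
  obtain ⟨C₁, hC₁, h₁⟩ := hup 1
  obtain ⟨C₂, hC₂, h₂⟩ := hup (-1)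
  obtain ⟨C₃, hC₃, h₃⟩ := hlow 1
  obtain ⟨C₄, hC₄, h₄⟩ := hlow (-1)
  have hne : ∃ z, Δ z ≠ 0 := by
    obtain ⟨τ, hτ⟩ := h₁.exists
    exact ⟨_, charDet_ne_zero hτ⟩
  have hF : Differentiable ℂ fun z => ℓ (greenNum a b₁ b₂ q₁ q₂ z u) :=
    ℓ.differentiable.comp (differentiable_greenNum a b₁ b₂ q₁ q₂ u)
  obtain ⟨G, hG, hFG⟩ := exists_entire_quotient hF (differentiable_charDet a b₁ b₂ q₁ q₂) hne
    (iteratedDeriv_functional_greenNum hb₁ hb₂ hq₁ hq₂ hℓ u)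
  obtain ⟨D₁, hD₁, hF'⟩ := (expGrowth_greenNum a b₁ b₂ q₁ q₂ u).clm_comp ℓ
  obtain ⟨D₂, hD₂, hΔ'⟩ := expGrowth_charDet a b₁ b₂ q₁ q₂
  have hmono : ∀ {D : ℝ} (w : ℂ), D ≤ max D₁ D₂ →
      Real.exp (D * (1 + ‖w‖)) ≤ Real.exp (max D₁ D₂ * (1 + ‖w‖)) := fun w hD => by gcongr
  obtain ⟨A, B, hAB⟩ := exists_exp_bound_of_quotient (differentiable_charDet a b₁ b₂ q₁ q₂) hG hFG hne
    (fun w => (hF' w).trans (hmono w (le_max_left _ _)))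
    (fun w => (hΔ' w).trans (hmono w (le_max_right _ _)))
  obtain ⟨T, hT⟩ := eventually_atTop.1 (((h₁.and h₂).and (h₃.and h₄)).and (eventually_ge_atTop 1))
  set L := ‖ℓ‖ * ‖u‖ with hL
  have hL0 : 0 ≤ L := mul_nonneg (norm_nonneg ℓ) (norm_nonneg u)
  set C := C₁ + C₂ + C₃ + C₄ with hC
  have hup' : ∀ {c t : ℝ} {w : ℂ}, T ≤ t → c ≤ C →
      ResolventBound a b₁ b₂ (ext01 q₁) (ext01 q₂) w (c * t ^ k) → ‖G w‖ ≤ L * C * t ^ k := by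
    intro c t w ht hc hb
    have ht0 : 0 ≤ t := zero_le_one.trans (hT t ht).2
    calc _ ≤ L * (c * t ^ k) := norm_quotient_le hb (hFG w)
      _ ≤ L * (C * t ^ k) := by gcongr
      _ = _ := by ring
  have hlow' : ∀ {c t : ℝ} {w : ℂ}, T ≤ t → c ≤ C →
      ResolventBound a b₁ b₂ (ext01 q₁) (ext01 q₂) w (c / t) → ‖G w‖ ≤ L * C / t := by
    intro c t w ht hc hb
    have ht0 : 0 ≤ t := zero_le_one.trans (hT t ht).2
    calc _ ≤ L * (c / t) := norm_quotient_le hb (hFG w)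
      _ ≤ L * (C / t) := by gcongr
      _ = _ := by ring
  set ω : ℂ := 1 + Complex.I with hω
  have hω0 : ω ≠ 0 := fun h => by
    have := congrArg Complex.re h
    simp [hω] at this
  have hωn : ‖ω‖ ≤ 2 := (norm_add_le _ _).trans (by simp; norm_num)
  have hzero := eq_zero_of_growth_on_axes k (fun w => G (ω * w)) (hG.comp (differentiable_id.const_mul ω))
    |A| (|B| * 2) (L * C) (max T 1) (le_max_right _ _) (fun w => ?_) (fun t ht => ?_) (fun t ht => ?_)
    (fun t ht => ?_) (fun t ht => ?_)
  · have h := hzero (ω⁻¹ * z)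
    rw [mul_inv_cancel_left₀ hω0] at h
    rw [hFG, h, zero_mul]
  · refine (hAB _).trans ?_
    rw [norm_mul]
    have h1 : B * (‖ω‖ * ‖w‖) ≤ |B| * 2 * ‖w‖ := by
      rw [mul_assoc]
      calc _ ≤ |B| * (‖ω‖ * ‖w‖) := by
            gcongr
            exact le_abs_self B
        _ ≤ _ := by gcongr
    calc _ ≤ |A| * Real.exp (B * (‖ω‖ * ‖w‖)) := by
          gcongr
          exact le_abs_self A
      _ ≤ _ := by gcongr
  · replace ht := (le_max_left _ _).trans ht
    refine hup' ht (c := C₁) (by linarith) ?_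
    simpa [hω] using (hT t ht).1.1.1
  · replace ht := (le_max_left _ _).trans ht
    refine hup' ht (c := C₂) (by linarith) ?_
    convert (hT t ht).1.1.2 using 1
    rw [hω]
    push_cast
    linear_combination (t : ℂ) * Complex.I_mul_I
  · replace ht := (le_max_left _ _).trans ht
    refine hlow' ht (c := C₃) (by linarith) ?_
    simpa [hω] using (hT t ht).1.2.1
  · replace ht := (le_max_left _ _).trans ht
    refine hlow' ht (c := C₄) (by linarith) ?_
    convert (hT t ht).1.2.2 using 1
    rw [hω]
    push_cast
    linear_combination -(t : ℂ) * Complex.I_mul_I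

end Vanishing

theorem Submodule.topologicalClosure_eq_top_of_dual {E : Type*} [NormedAddCommGroup E] [NormedSpace ℂ E]
    (V : Submodule ℂ E) (h : ∀ ℓ : E →L[ℂ] ℂ, (∀ x ∈ V, ℓ x = 0) → ℓ = 0) :
    V.topologicalClosure = ⊤ := by
  by_contra hV
  obtain ⟨x, -, hx⟩ := SetLike.exists_of_lt (lt_top_iff_ne_top.2 hV)
  have : IsClosed (V.topologicalClosure : Set E) := V.isClosed_topologicalClosure
  have hx' : (Submodule.Quotient.mk x : E ⧸ V.topologicalClosure) ≠ 0 := by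
    rwa [Ne, Submodule.Quotient.mk_eq_zero]
  obtain ⟨f, hf⟩ := SeparatingDual.exists_ne_zero (R := ℂ) hx'
  have h0 := h (f ∘L V.topologicalClosure.mkQL) fun y hy => by
    have : (Submodule.Quotient.mk y : E ⧸ V.topologicalClosure) = 0 :=
      (Submodule.Quotient.mk_eq_zero _).2 (V.le_topologicalClosure hy)
    change f (Submodule.Quotient.mk y) = 0
    rw [this, map_zero]
  exact hf (DFunLike.congr_fun h0 x)

/-- The restriction of a continuous function to `[0,1]`. -/
def toCurve (f : C(ℝ, ℂ × ℂ)) : Curve := f.restrict (Icc 0 1)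

theorem ext01_toCurve (f : C(ℝ, ℂ × ℂ)) {x : ℝ} (hx : x ∈ I01) : ext01 (toCurve f) x = f x := by
  rw [ext01, IccExtend_of_mem _ _ hx]
  rfl

theorem exists_curveSol {b₁ b₂ : ℝ} (hb₁ : b₁ ≠ 0) (hb₂ : b₂ ≠ 0) (q₁ q₂ : C(Icc (0 : ℝ) 1, ℂ)) (lam : ℂ)
    (φ φ' : C(ℝ, ℂ × ℂ)) (hφ : ∀ x, HasDerivAt φ (φ' x) x) :
    ∃ u, CurveSol b₁ b₂ q₁ q₂ lam u (toCurve φ) := by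
  have hb₁' : (b₁ : ℂ) ≠ 0 := by exact_mod_cast hb₁
  have hb₂' : (b₂ : ℂ) ≠ 0 := by exact_mod_cast hb₂
  let u : Curve := ⟨fun x => ((Complex.I * b₁)⁻¹ * (φ' x).1 + q₁ x * (φ x).2 - lam * (φ x).1,
    (Complex.I * b₂)⁻¹ * (φ' x).2 + q₂ x * (φ x).1 - lam * (φ x).2), by fun_prop⟩
  refine ⟨u, curveSol_iff.2 ⟨φ 0, fun x hx => ?_⟩⟩
  have h1 : ∫ t in (0 : ℝ)..x, ext01 (diracRhs b₁ b₂ q₁ q₂ lam u (toCurve φ)) t =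
      ∫ t in (0 : ℝ)..x, φ' t := by
    refine intervalIntegral.integral_congr fun t ht => ?_
    rw [uIcc_of_le hx.1] at ht
    have ht' : t ∈ Icc (0 : ℝ) 1 := ⟨ht.1, ht.2.trans hx.2⟩
    simp only [ext01_rhs, ext01_toCurve φ ht']
    simp only [ext01, IccExtend_of_mem _ _ ht', u, ContinuousMap.coe_mk]
    refine Prod.ext ?_ ?_ <;> dsimp only <;> field_simp [Complex.I_ne_zero] <;> ring
  rw [h1, ext01_toCurve φ hx, intervalIntegral.integral_eq_sub_of_hasDerivAt (fun t _ => hφ t)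
    (φ'.continuous.intervalIntegrable _ _), add_sub_cancel]

instance isFiniteMeasure_mu01 : IsFiniteMeasure mu01 := by
  rw [mu01, I01]
  infer_instance

theorem memLp_ext01 (y : Curve) : MemLp (ext01 y) 2 mu01 :=
  MemLp.of_bound (continuous_ext01 y).aestronglyMeasurable ‖y‖
    (ae_of_all _ fun _ => y.norm_coe_le_norm _)

/-- The square-integrable class of a continuous function on `[0,1]`. -/
def curveToLp : Curve →L[ℂ] Lp (ℂ × ℂ) 2 mu01 :=
  LinearMap.mkContinuous
    { toFun := fun y => (memLp_ext01 y).toLp _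
      map_add' := fun y z => MemLp.toLp_add (memLp_ext01 y) (memLp_ext01 z)
      map_smul' := fun c y => MemLp.toLp_const_smul c (memLp_ext01 y) }
    (measureUnivNNReal mu01 ^ (2 : ENNReal).toReal⁻¹) fun y => by
      refine Lp.norm_le_of_ae_bound (norm_nonneg y) ?_
      filter_upwards [(memLp_ext01 y).coeFn_toLp] with x hx
      change ‖(memLp_ext01 y).toLp _ x‖ ≤ _
      rw [hx]
      exact y.norm_coe_le_norm _

theorem curveToLp_apply (y : Curve) : curveToLp y = (memLp_ext01 y).toLp _ := rfl

theorem coeFn_curveToLp (y : Curve) : curveToLp y =ᵐ[mu01] ext01 y :=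
  (memLp_ext01 y).coeFn_toLp

theorem ae_mem_Ioo_mu01 : ∀ᵐ x ∂mu01, x ∈ Ioo (0 : ℝ) 1 := by
  rw [mu01, I01, ← restrict_Ioo_eq_restrict_Icc]
  exact ae_restrict_mem measurableSet_Ioo

/-- Multiplication of a function by the cutoff `1 - (1 - 2 x) ^ (2 k)`. -/
def cutoff (k : ℕ) (f : C(ℝ, ℂ × ℂ)) : C(ℝ, ℂ × ℂ) :=
  ⟨fun x => (1 - (1 - 2 * x) ^ (2 * k)) • f x, by fun_prop⟩

theorem cutoff_apply (k : ℕ) (f : C(ℝ, ℂ × ℂ)) (x : ℝ) :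
    cutoff k f x = (1 - (1 - 2 * x) ^ (2 * k)) • f x := rfl

theorem tendsto_curveToLp_cutoff (f : C(ℝ, ℂ × ℂ)) :
    Tendsto (fun k => curveToLp (toCurve (cutoff k f))) atTop (𝓝 (curveToLp (toCurve f))) := by
  rw [show (fun k => curveToLp (toCurve (cutoff k f))) =
    fun k => (memLp_ext01 (toCurve (cutoff k f))).toLp _ from rfl, curveToLp_apply,
    Lp.tendsto_Lp_iff_tendsto_eLpNorm'']
  set K := ‖toCurve f‖ with hK
  have hf : ∀ x ∈ I01, ‖f x‖ ≤ K := fun x hx => by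
    rw [← ext01_toCurve f hx]
    exact (toCurve f).norm_coe_le_norm _
  have hsub : ∀ (k : ℕ) x, x ∈ I01 → (ext01 (toCurve (cutoff k f)) - ext01 (toCurve f)) x =
      -((1 - 2 * x) ^ (2 * k)) • f x := fun k x hx => by
    rw [Pi.sub_apply, ext01_toCurve _ hx, ext01_toCurve _ hx, cutoff_apply]
    module
  have key : Tendsto (fun k : ℕ => ∫⁻ x, ‖(ext01 (toCurve (cutoff k f)) - ext01 (toCurve f)) x‖ₑ ^ (2 : ℝ) ∂mu01)
      atTop (𝓝 0) := by
    have := tendsto_lintegral_of_dominated_convergence (μ := mu01)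
      (F := fun k : ℕ => fun x => ‖(ext01 (toCurve (cutoff k f)) - ext01 (toCurve f)) x‖ₑ ^ (2 : ℝ))
      (f := fun _ => 0) (fun _ => ENNReal.ofReal K ^ (2 : ℝ)) (fun k => ?_) (fun k => ?_) ?_ ?_
    · simpa using this
    · have := ((continuous_ext01 (toCurve (cutoff k f))).sub (continuous_ext01 (toCurve f)))
      exact (this.enorm.measurable).pow_const _
    · filter_upwards [ae_mem_Ioo_mu01] with x hx
      rw [hsub k x ⟨hx.1.le, hx.2.le⟩]
      refine ENNReal.rpow_le_rpow ?_ (by norm_num)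
      rw [← ofReal_norm]
      refine ENNReal.ofReal_le_ofReal ?_
      rw [norm_smul, norm_neg, norm_pow]
      refine (mul_le_of_le_one_left (norm_nonneg _) (pow_le_one₀ (norm_nonneg _) ?_)).trans
        (hf x ⟨hx.1.le, hx.2.le⟩)
      rw [Real.norm_eq_abs, abs_le]
      constructor <;> linarith [hx.1, hx.2]
    · rw [lintegral_const]
      exact ENNReal.mul_ne_top (ENNReal.rpow_ne_top_of_nonneg (by norm_num) ENNReal.ofReal_ne_top)
        (measure_ne_top _ _)
    · filter_upwards [ae_mem_Ioo_mu01] with x hx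
      have h1 : Tendsto (fun k : ℕ => -((1 - 2 * x) ^ (2 * k)) • f x) atTop (𝓝 ((-0 : ℝ) • f x)) := by
        refine Tendsto.smul_const (Tendsto.neg ?_) _
        simp_rw [pow_mul]
        refine tendsto_pow_atTop_nhds_zero_of_lt_one (sq_nonneg _) ?_
        nlinarith [hx.1, hx.2]
      have h2 := (ENNReal.continuous_rpow_const (y := (2 : ℝ))).tendsto _ |>.comp h1.enorm
      simp only [neg_zero, zero_smul, enorm_zero] at h2
      rw [ENNReal.zero_rpow_of_pos (by norm_num)] at h2
      refine h2.congr fun k => ?_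
      simp only [Function.comp]
      rw [hsub k x ⟨hx.1.le, hx.2.le⟩]
  simp_rw [eLpNorm_eq_lintegral_rpow_enorm_toReal (p := 2) two_ne_zero ENNReal.ofNat_ne_top]
  have h2 := (ENNReal.continuous_rpow_const (y := 1 / (2 : ENNReal).toReal)).tendsto _ |>.comp key
  rw [ENNReal.zero_rpow_of_pos (by norm_num)] at h2
  exact h2

theorem functional_eq_zero_of_cutoff {ℓ : Lp (ℂ × ℂ) 2 mu01 →L[ℂ] ℂ}
    (h : ∀ φ φ' : C(ℝ, ℂ × ℂ), (∀ x, HasDerivAt φ (φ' x) x) → φ 0 = 0 → φ 1 = 0 →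
      ℓ (curveToLp (toCurve φ)) = 0) : ℓ = 0 := by
  refine ContinuousLinearMap.ext fun g => ?_
  refine (Lp.dense_hasCompactSupport_contDiff (F := ℂ × ℂ) (μ := mu01) (p := 2) (by norm_num)).induction
    (P := fun g => ℓ g = 0) ?_ (isClosed_eq ℓ.continuous continuous_const) g
  rintro g ⟨ψ, hgψ, -, hψ⟩
  let f : C(ℝ, ℂ × ℂ) := ⟨ψ, hψ.continuous⟩
  have hg : g = curveToLp (toCurve f) := by
    refine Lp.ext (hgψ.trans (EventuallyEq.trans ?_ (coeFn_curveToLp _).symm))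
    filter_upwards [ae_mem_Ioo_mu01] with x hx
    rw [ext01_toCurve f ⟨hx.1.le, hx.2.le⟩]
    rfl
  have hz : ∀ k : ℕ, ℓ (curveToLp (toCurve (cutoff k f))) = 0 := by
    intro k
    have hc : ContDiff ℝ 1 (cutoff k f) := by
      change ContDiff ℝ 1 fun x : ℝ => (1 - (1 - 2 * x) ^ (2 * k)) • ψ x
      have : ContDiff ℝ 1 ψ := hψ.of_le (by exact_mod_cast le_top)
      fun_prop
    refine h _ ⟨deriv (cutoff k f), hc.continuous_deriv le_rfl⟩
      (fun x => (hc.differentiable one_ne_zero x).hasDerivAt) ?_ ?_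
    · simp [cutoff_apply]
    · rw [cutoff_apply, pow_mul]
      norm_num
  rw [hg]
  refine tendsto_nhds_unique ((ℓ.continuous.tendsto _).comp (tendsto_curveToLp_cutoff f)) ?_
  exact tendsto_const_nhds.congr fun k => (hz k).symm

section Completeness

variable {a : Fin 2 → Fin 4 → ℂ} {b₁ b₂ : ℝ} {q₁ q₂ : C(Icc (0 : ℝ) 1, ℂ)} {Q12 Q21 : ℝ → ℂ}

theorem rootSystemComplete_of_resolventBound (hb₁ : b₁ ≠ 0) (hb₂ : b₂ ≠ 0)
    (hq₁ : ∀ x ∈ I01, ext01 q₁ x = Q12 x) (hq₂ : ∀ x ∈ I01, ext01 q₂ x = Q21 x)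
    {k : ℕ} (hup : ∀ ε : ℝ, ∃ C, 0 ≤ C ∧ ∀ᶠ τ : ℝ in atTop,
      ResolventBound a b₁ b₂ (ext01 q₁) (ext01 q₂) ((ε + Complex.I) * τ) (C * τ ^ k))
    (hlow : ∀ ε : ℝ, ∃ C, 0 ≤ C ∧ ∀ᶠ τ : ℝ in atTop,
      ResolventBound a b₁ b₂ (ext01 q₁) (ext01 q₂) (-((ε + Complex.I) * τ)) (C / τ)) :
    RootSystemComplete b₁ b₂ Q12 Q21 a := by
  refine Submodule.topologicalClosure_eq_top_of_dual _ fun ℓ hℓ => functional_eq_zero_of_cutoff ?_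
  intro φ φ' hφ h0 h1
  have hroot : ∀ y : Curve, IsRootFunction b₁ b₂ Q12 Q21 a (ext01 y) → (ℓ ∘L curveToLp) y = 0 :=
    fun y hy => hℓ _ (Submodule.subset_span ⟨_, hy, coeFn_curveToLp y⟩)
  obtain ⟨C, -, hC⟩ := hlow 0
  obtain ⟨τ, hτ⟩ := hC.exists
  obtain ⟨u, hu⟩ := exists_curveSol hb₁ hb₂ q₁ q₂ (-(((0 : ℝ) + Complex.I) * τ)) φ φ' hφ
  have hbc : ∀ j, bcFun a j (toCurve φ) = 0 := fun j => by
    rw [bcFun_apply, ext01_toCurve φ (by simp [I01]), ext01_toCurve φ (by simp [I01]), h0, h1]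
    simp
  have h := functional_greenNum_eq_zero hb₁ hb₂ hq₁ hq₂ hroot hup hlow u (-(((0 : ℝ) + Complex.I) * τ))
  rw [greenNum_eq_smul hτ hu hbc, map_smul, smul_eq_zero] at h
  exact h.resolve_left (charDet_ne_zero hτ)

end Completeness

theorem exists_ext01_eq {f : ℝ → ℂ} (hf : ContinuousOn f I01) :
    ∃ q : C(Icc (0 : ℝ) 1, ℂ), ∀ x ∈ I01, ext01 q x = f x :=
  ⟨⟨_, hf.domRestrict⟩, fun _ hx => IccExtend_of_mem _ _ hx⟩

/-- Corollary: generalization of Makin's result, `J₃₂ = 0`, `J₁₄ ≠ 0`. -/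
theorem statement_14
    (b₁ b₂ : ℝ) (hb₁ : b₁ < 0) (hb₂ : 0 < b₂)
    (Q12 Q21 : ℝ → ℂ) (a : Fin 2 → Fin 4 → ℂ)
    (n : ℕ) (hn : 1 ≤ n)
    (hQ12 : MemW1 n Q12) (hQ21 : MemW1 n Q21)
    (hJ32 : Jdet a 2 1 = 0) (hJ14 : Jdet a 0 3 ≠ 0)
    (P : ℝ → ℂ)
    (hP : ∀ x : ℝ, P x = Jdet a 0 2 * (b₁ : ℂ) * Q12 x + Jdet a 3 1 * (b₂ : ℂ) * Q21 (1 - x))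
    (m : ℕ) (hm : m = ⌈((n : ℚ) - 1) / 2⌉₊)
    (hPn : iteratedDerivWithin (n - 1) P I01 0 ≠ 0)
    (hQ0 : ∀ j < m, iteratedDerivWithin j Q12 I01 0 = 0 ∧ iteratedDerivWithin j Q21 I01 1 = 0) :
    RootSystemComplete b₁ b₂ Q12 Q21 a := by
  obtain ⟨N, rfl⟩ := Nat.exists_eq_add_of_le' hn
  have hmN : m ≤ N := by
    rw [hm, Nat.ceil_le]
    push_cast
    linarith [(N.cast_nonneg : (0 : ℚ) ≤ N)]
  have hNm : N ≤ 2 * m := by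
    have h := Nat.le_ceil ((((N + 1 : ℕ) : ℚ) - 1) / 2)
    rw [← hm] at h
    push_cast at h
    have : (N : ℚ) ≤ ((2 * m : ℕ) : ℚ) := by
      push_cast
      linarith
    exact_mod_cast this
  obtain rfl := funext hP
  obtain ⟨q₁, hq₁⟩ := exists_ext01_eq hQ12.1.continuousOn
  obtain ⟨q₂, hq₂⟩ := exists_ext01_eq hQ21.1.continuousOn
  obtain ⟨q₀, hq₀⟩ := exists_bddPot hQ12.1.continuousOn hQ21.1.continuousOn
  obtain ⟨k, hk⟩ := exists_resolventBound_of_iteratedDerivWithin hb₁ hb₂ hQ12.1 hQ21.1 hmN hNm hJ32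
    hPn hQ0
  refine rootSystemComplete_of_resolventBound (k := k) hb₁.ne hb₂.ne' hq₁ hq₂ (fun ε => ?_) fun ε => ?_
  · obtain ⟨C, hC, h⟩ := hk ε
    exact ⟨C, hC, h.mono fun τ hτ => hτ.congr hq₁ hq₂⟩
  · obtain ⟨C, hC, h⟩ := exists_resolventBound_neg hb₁ hb₂ hq₀ hJ14 ε
    exact ⟨C, hC, h.mono fun τ hτ => hτ.congr hq₁ hq₂⟩
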